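/- Fix an integer d ≥ 3, a finite set M, an integer r ≥ 1 and a real-valued function ψ on the set of rooted unlabeled M-colored graphs of radius r. If G_n is uniformly distributed on G_n(d) (with nd even and n ≥ d+1), then sup over { p ∈ I_{d,r}(M) : h̲(p) ≥ 0 } of ⟨p,ψ⟩ ≤ liminf_{n→∞} E[L_{G_n}]/n ≤ limsup_{n→∞} E[L_{G_n}]/n ≤ sup over { p ∈ I_{d,r}(M) : h̄(p) ≥ 0 } of ⟨p,ψ⟩. -/

import Mathlib

open MeasureTheory Filter Topology
open scoped ENNReal Classical

noncomputable section

namespace TreeEntropy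

@[ext]
structure RCG (M : Type*) where
  col : List ℕ → Option M
  adj : List ℕ × List ℕ → Bool

variable {M : Type*}

def resS (r : ℕ) (g : RCG M) : RCG M where
  col l := if l.length ≤ r then g.col l else none
  adj p := if p.1.length ≤ r ∧ p.2.length ≤ r then g.adj p else false

def rcgDist (g g' : RCG M) : ℝ :=
  ∑' r : ℕ, if resS r g = resS r g' then 0 else (2:ℝ)⁻¹ ^ r

private lemma rcg_summable (a b : RCG M) : Summable
    (fun r : ℕ => if resS r a = resS r b then (0:ℝ) else (2:ℝ)⁻¹ ^ r) := by
  refine Summable.of_nonneg_of_le (fun r => ?_) (fun r => ?_)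
    (summable_geometric_of_lt_one (by norm_num) (by norm_num : (2:ℝ)⁻¹ < 1))
  · split
    · exact le_rfl
    · positivity
  · split
    · positivity
    · exact le_rfl

private lemma rcg_nonneg (a b : RCG M) (r : ℕ) :
    (0:ℝ) ≤ if resS r a = resS r b then (0:ℝ) else (2:ℝ)⁻¹ ^ r := by
  split
  · exact le_rfl
  · positivity

private lemma rcgDist_self (g : RCG M) : rcgDist g g = 0 := by simp [rcgDist]

private lemma rcgDist_comm (g g' : RCG M) : rcgDist g g' = rcgDist g' g :=
  tsum_congr fun r => if_congr eq_comm rfl rfl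

private lemma rcgDist_triangle (g₁ g₂ g₃ : RCG M) :
    rcgDist g₁ g₃ ≤ rcgDist g₁ g₂ + rcgDist g₂ g₃ := by
  unfold rcgDist
  rw [← Summable.tsum_add (rcg_summable _ _) (rcg_summable _ _)]
  refine Summable.tsum_le_tsum (fun r => ?_) (rcg_summable _ _)
    ((rcg_summable _ _).add (rcg_summable _ _))
  have hx : (0:ℝ) ≤ (2:ℝ)⁻¹ ^ r := by positivity
  by_cases h12 : resS r g₁ = resS r g₂
  · by_cases h23 : resS r g₂ = resS r g₃
    · rw [if_pos h12, if_pos h23, if_pos (h12.trans h23)]; linarith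
    · rw [if_pos h12, if_neg h23, zero_add]
      split_ifs <;> linarith
  · by_cases h23 : resS r g₂ = resS r g₃
    · rw [if_neg h12, if_pos h23, add_zero]
      split_ifs <;> linarith
    · rw [if_neg h12, if_neg h23]
      split_ifs <;> linarith

private lemma rcgDist_eq_zero (g g' : RCG M) (h : rcgDist g g' = 0) : g = g' := by
  unfold rcgDist at h
  have hr : ∀ r : ℕ, resS r g = resS r g' := by
    intro r
    by_contra hne
    have hpos : (0:ℝ) <
        ∑' r : ℕ, if resS r g = resS r g' then (0:ℝ) else (2:ℝ)⁻¹ ^ r :=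
      Summable.tsum_pos (rcg_summable g g') (rcg_nonneg g g') r
        (by rw [if_neg hne]; positivity)
    exact absurd h hpos.ne'
  have hc : g.col = g'.col := by
    funext l
    have h1 := congrFun (congrArg RCG.col (hr l.length)) l
    simpa [resS] using h1
  have ha : g.adj = g'.adj := by
    funext p
    have h1 := congrFun (congrArg RCG.adj (hr (max p.1.length p.2.length))) p
    simpa [resS, le_max_left, le_max_right] using h1
  exact RCG.ext hc ha

instance : MetricSpace (RCG M) where
  dist := rcgDist
  dist_self := rcgDist_self
  dist_comm := rcgDist_comm
  dist_triangle := rcgDist_triangle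
  eq_of_dist_eq_zero := rcgDist_eq_zero _ _

instance : MeasurableSpace (RCG M) := borel _
instance : BorelSpace (RCG M) := ⟨rfl⟩


/-! ### The `d`-regular tree `T_d` -/

/-- A list `l = [i_k, …, i_1]` (deepest step first) is the breadth-first-search label of a
vertex of the `d`-regular tree `T_d` iff its first (root-side) step lies in `{1, …, d}` and all
subsequent steps lie in `{1, …, d-1}`. -/
def ValidTd (d : ℕ) (l : List ℕ) : Prop :=
  (∀ i ∈ l.dropLast, 1 ≤ i ∧ i ≤ d - 1) ∧ (∀ i ∈ l.getLast?, 1 ≤ i ∧ i ≤ d)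

/-- The vertex set of the `d`-regular tree `T_d`. -/
def TdVertex (d : ℕ) : Type := {l : List ℕ // ValidTd d l}

/-- The root `o` of `T_d`. -/
def rootTd (d : ℕ) : TdVertex d := ⟨[], by constructor <;> simp [List.getLast?]⟩

/-- The first neighbor `1` of the root of `T_d` (defined as the root for the degenerate case
`d = 0`, which never occurs below). -/
def node1 (d : ℕ) : TdVertex d :=
  if h : 1 ≤ d then ⟨[1], by constructor <;> simp [List.getLast?, h]⟩ else rootTd d

/-- The graph structure of the `d`-regular tree: two vertices are adjacent iff one is obtained
from the other by adding one step. -/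
def TdGraph (d : ℕ) : SimpleGraph (TdVertex d) where
  Adj v w := (∃ i, w.1 = i :: v.1) ∨ (∃ i, v.1 = i :: w.1)
  symm := by constructor; intro v w h; tauto
  loopless := by
    constructor
    rintro v (⟨i, h⟩ | ⟨i, h⟩) <;>
      · have := congrArg List.length h
        simp at this

/-- Graph distance between two vertices of a tree encoded by their BFS labels: the nearest
common ancestor corresponds to the longest common suffix. -/
def treeDist (u w : List ℕ) : ℕ :=
  ((u.reverse.zip w.reverse).takeWhile (fun p => p.1 = p.2)).length |> fun c =>
    (u.length - c) + (w.length - c)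

/-- The ball `S_r = B_r(o)` of radius `r` around the root of `T_d`. -/
def SrSet (d r : ℕ) : Set (TdVertex d) := {v | v.1.length ≤ r}

/-- The set `E_r = B_{r-1}({o,1})` of vertices at distance at most `r-1` from the edge `{o,1}`
of `T_d` (for `r ≥ 1`). -/
def ErSet (d r : ℕ) : Set (TdVertex d) :=
  {v | v.1.length + 1 ≤ r ∨ (v.1.getLast? = some 1 ∧ v.1.length ≤ r)}

lemma ErSet_subset_SrSet (d r : ℕ) : ErSet d r ⊆ SrSet d r := by
  rintro v (h | ⟨-, h⟩) <;> simp only [SrSet, Set.mem_setOf_eq] <;> omega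

/-! ### Invariant processes on `T_d` and their entropies -/

variable (d : ℕ) (M : Type*)

/-- `I_d(M)`: the set of probability measures on `M^{T_d}` invariant under all automorphisms
of the tree `T_d`. -/
def InvMeas [MeasurableSpace M] : Set (Measure (TdVertex d → M)) :=
  {μ | IsProbabilityMeasure μ ∧
    ∀ φ : TdGraph d ≃g TdGraph d, μ.map (fun x => fun v => x (φ v)) = μ}

variable {d M}

/-- The Shannon entropy of (the distribution of) a random variable with law `μ`, a measure
with countable support on a discrete space. -/
def shannon {α : Type*} [MeasurableSpace α] (μ : Measure α) : ℝ :=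
  ∑' a : α, Real.negMulLog (μ {a}).toReal

/-- The restriction `X_S` of a process `X` on `T_d` to a subset `S` of the vertices:
the pushforward of its law. -/
def restrictTo [MeasurableSpace M] (S : Set (TdVertex d))
    (μ : Measure (TdVertex d → M)) : Measure (↥S → M) :=
  μ.map (fun x => fun v => x v.1)

/-- The annealed entropy `Σ_r(μ) = H(X_{S_r}) - (d/2) H(X_{E_r})`. -/
def SigmaR [MeasurableSpace M] (d : ℕ) (r : ℕ) (μ : Measure (TdVertex d → M)) : ℝ :=
  shannon (restrictTo (SrSet d r) μ) - (d / 2 : ℝ) * shannon (restrictTo (ErSet d r) μ)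

/-- The annealed entropy `Σ(μ) = lim_r Σ_r(μ)`: the limit of the non-increasing sequence
`r ↦ Σ_r(μ)` (`r ≥ 1`), as an extended real (the limit may be `-∞`). -/
def SigmaInf [MeasurableSpace M] (d : ℕ) (μ : Measure (TdVertex d → M)) : EReal :=
  ⨅ r : ℕ, ((SigmaR d (r + 1) μ : ℝ) : EReal)

/-- `Σ_e(X) = (d/2) H(X_{E_1}) - (d-1) H(X_o)`. -/
def SigmaE [MeasurableSpace M] (d : ℕ) (μ : Measure (TdVertex d → M)) : ℝ :=
  (d / 2 : ℝ) * shannon (restrictTo (ErSet d 1) μ)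
    - ((d : ℝ) - 1) * shannon (restrictTo ({rootTd d} : Set (TdVertex d)) μ)

/-! ### Markov processes on `T_d` -/

/-- The elementary cylinder event: the coloring takes the values prescribed by `y` on `S`. -/
def cylEvent (S : Set (TdVertex d)) (y : TdVertex d → M) : Set (TdVertex d → M) :=
  {x | ∀ v ∈ S, x v = y v}

/-- The side of the edge `{u,w}` containing `u`, in the tree `T_d`. -/
def sideOf (u w : TdVertex d) : Set (TdVertex d) :=
  {v | treeDist v.1 u.1 < treeDist v.1 w.1}

/-- `B_{r-1}({u,w})`: the set of vertices at distance at most `r-1` from the edge `{u,w}`. -/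
def edgeBall (r : ℕ) (u w : TdVertex d) : Set (TdVertex d) :=
  {v | treeDist v.1 u.1 + 1 ≤ r ∨ treeDist v.1 w.1 + 1 ≤ r}

/-- A probability measure on `M^{T_d}` is `r`-Markov on a subset `A` of `T_d` if, for every
edge `{u,w}` of `A`, conditioned on the value on the `(r-1)`-neighborhood of the edge
(within `A`), the processes on the two sides of the edge (within `A`) are independent;
equivalently, the corresponding products of cylinder probabilities agree.  For `A` the whole
tree and `r = 1` this is the edge-Markov property. -/
def rMarkovOn [MeasurableSpace M] (r : ℕ) (A : Set (TdVertex d))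
    (μ : Measure (TdVertex d → M)) : Prop :=
  ∀ u w : TdVertex d, u ∈ A → w ∈ A → (TdGraph d).Adj u w →
    ∀ F₁ F₂ : Finset (TdVertex d), ↑F₁ ⊆ sideOf u w ∩ A → ↑F₂ ⊆ sideOf w u ∩ A →
      ∀ y : TdVertex d → M,
        μ (cylEvent (↑F₁ ∪ ↑F₂ ∪ (edgeBall r u w ∩ A)) y)
            * μ (cylEvent (edgeBall r u w ∩ A) y)
          = μ (cylEvent (↑F₁ ∪ (edgeBall r u w ∩ A)) y)
            * μ (cylEvent (↑F₂ ∪ (edgeBall r u w ∩ A)) y)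

/-- A probability measure on `M^{T_d}` is `r`-Markov if, conditioned on the value on the
`(r-1)`-neighborhood of any edge, the processes on the two sides of the edge are
independent. -/
def rMarkov [MeasurableSpace M] (r : ℕ) (μ : Measure (TdVertex d → M)) : Prop :=
  rMarkovOn r Set.univ μ

/-- A probability measure on `M^{T_d}` is vertex-Markov if, conditioned on the value at a
vertex, the processes on the pending subtrees of that vertex are independent. -/
def vertexMarkov [MeasurableSpace M] (μ : Measure (TdVertex d → M)) : Prop :=
  ∀ v : TdVertex d, ∀ k : ℕ, ∀ u : Fin k → TdVertex d,
    Function.Injective u → (∀ i, (TdGraph d).Adj v (u i)) →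
    ∀ F : Fin k → Finset (TdVertex d), (∀ i, ↑(F i) ⊆ sideOf (u i) v) →
      ∀ y : TdVertex d → M,
        μ (cylEvent ((⋃ i, ↑(F i)) ∪ {v}) y) * (μ (cylEvent {v} y)) ^ (k - 1)
          = ∏ i : Fin k, μ (cylEvent (↑(F i) ∪ {v}) y)

/-- `X_{S_1}` is a vertex-Markov process on `S_1`: the values at the `d` neighbors of the
root are conditionally independent given the value at the root. -/
def vertexMarkovOnS1 [MeasurableSpace M] (d : ℕ) (μ : Measure (TdVertex d → M)) : Prop :=
  ∀ y : TdVertex d → M,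
    μ (cylEvent (SrSet d 1) y) * (μ (cylEvent ({rootTd d} : Set (TdVertex d)) y)) ^ (d - 1)
      = ∏ i ∈ Finset.Icc 1 d,
          μ (cylEvent {v : TdVertex d | v = rootTd d ∨ v.1 = [i]} y)


/-! ### The randomly labeled rooted colored graph associated to a finite colored graph

Given a finite colored graph `(G,f)` and a vertex `v`, the associated randomly labeled rooted
colored graph is obtained by a breadth-first search exploration of the connected component of
`v` started at `v`, ties between vertices being broken uniformly at random.  We implement the
uniformly random tie-breaking by a uniformly random priority permutation `σ`. -/

variable {M : Type*} {n : ℕ}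

/-- The `k`-th layer of the breadth-first search of `G` started at `v`, ordered according to
the position of the parents in the previous layer, ties being broken by the priority `σ`. -/
def bfsLayer (G : SimpleGraph (Fin n)) (v : Fin n) (σ : Equiv.Perm (Fin n)) :
    ℕ → List (Fin n)
  | 0 => [v]
  | (k + 1) =>
    let prev := bfsLayer G v σ k
    let key : Fin n → ℕ := fun w =>
      (prev.idxOf (((prev.find? (fun u => decide (G.Adj u w))).getD v))) * n + (σ w : ℕ)
    ((List.finRange n).filter
        (fun w => decide (G.Reachable v w ∧ G.dist v w = k + 1))).mergeSort
      (fun a b => key a ≤ key b)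

/-- The breadth-first-search label of the vertex `w` lying in layer `k` of the exploration of
`G` started at `v` with tie-breaking priority `σ`. -/
def bfsPathAux (G : SimpleGraph (Fin n)) (v : Fin n) (σ : Equiv.Perm (Fin n)) :
    ℕ → Fin n → Option (List ℕ)
  | 0, w => if w = v then some [] else none
  | (k + 1), w =>
    match (bfsLayer G v σ k).find? (fun u => decide (G.Adj u w)) with
    | none => none
    | some p =>
      let L := bfsLayer G v σ (k + 1)
      let j := 1 + ((L.takeWhile (fun w' => w' ≠ w)).filter
        (fun w' => (bfsLayer G v σ k).find? (fun u => decide (G.Adj u w')) = some p)).length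
      (bfsPathAux G v σ k p).map (fun pl => j :: pl)

/-- The breadth-first-search label of the vertex `w` in the exploration of the connected
component of `v` in `G`, with tie-breaking priority `σ` (`none` if `w` is not in the component
of `v`). -/
def bfsPath (G : SimpleGraph (Fin n)) (v : Fin n) (σ : Equiv.Perm (Fin n)) (w : Fin n) :
    Option (List ℕ) :=
  if G.Reachable v w then bfsPathAux G v σ (G.dist v w) w else none

/-- The rooted colored graph obtained from the colored graph `(G,f)` by the breadth-first
search exploration of the connected component of `v` rooted at `v`, with tie-breaking
priority `σ`. -/
def bfsRCG (G : SimpleGraph (Fin n)) (f : Fin n → M) (v : Fin n) (σ : Equiv.Perm (Fin n)) :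
    RCG M where
  col l := if h : ∃ w, bfsPath G v σ w = some l then some (f h.choose) else none
  adj p :=
    if (∃ w₁ w₂, bfsPath G v σ w₁ = some p.1 ∧ bfsPath G v σ w₂ = some p.2 ∧ G.Adj w₁ w₂)
    then true else false

/-- `distr_{G,v}(f)`: the law of the randomly labeled rooted colored graph obtained from the
connected component of `v` in the colored graph `(G,f)`, rooted at `v`. -/
def distrAt (G : SimpleGraph (Fin n)) (f : Fin n → M) (v : Fin n) : Measure (RCG M) :=
  ((Nat.factorial n : ℝ≥0∞))⁻¹ •
    ∑ σ : Equiv.Perm (Fin n), Measure.dirac (bfsRCG G f v σ)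

/-- `distr_G(f) = (1/|V|) ∑_{v ∈ V} distr_{G,v}(f)`. -/
def distrG (G : SimpleGraph (Fin n)) (f : Fin n → M) : Measure (RCG M) :=
  ((n : ℝ≥0∞))⁻¹ • ∑ v : Fin n, distrAt G f v

/-! ### Random regular graphs -/

/-- The set `𝓖_n(d)` of simple `d`-regular graphs on the vertex set `{1, …, n}`. -/
def regularGraphs (d n : ℕ) : Set (SimpleGraph (Fin n)) :=
  {G | ∀ v, (G.neighborSet v).ncard = d}

/-- The probability that a uniformly distributed random `d`-regular graph `G_n` on `n`
vertices belongs to `A`. -/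
def PrG (d n : ℕ) (A : Set (SimpleGraph (Fin n))) : ℝ :=
  ((regularGraphs d n ∩ A).ncard : ℝ) / ((regularGraphs d n).ncard : ℝ)

/-- The expectation of `F(G_n)` for a uniformly distributed random `d`-regular graph `G_n`
on `n` vertices. -/
def ExG (d n : ℕ) (F : SimpleGraph (Fin n) → ℝ) : ℝ :=
  (∑ᶠ G ∈ regularGraphs d n, F G) / ((regularGraphs d n).ncard : ℝ)

/-- The integers `n` for which the set of simple `d`-regular graphs on `n` vertices is
non-empty: `n ≥ d + 1` and `nd` even.  Limits `n → ∞` are taken along this set. -/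
def goodN (d : ℕ) : Set ℕ := {n | d + 1 ≤ n ∧ Even (n * d)}

/-- The filter `n → ∞` along `{n : n ≥ d+1, nd even}`. -/
def goodFilter (d : ℕ) : Filter ℕ := Filter.atTop ⊓ Filter.principal (goodN d)

/-! ### The embedding of invariant processes into rooted colored graphs -/

/-- The rooted colored graph `(T_d, x, o)` associated to a coloring `x` of `T_d` (the
canonical labeling of `T_d` is a breadth-first-search labeling; for an invariant process the
resulting law is that of the randomly labeled rooted colored graph). -/
def iotaTd (d : ℕ) (x : TdVertex d → M) : RCG M where
  col l := if h : ValidTd d l then some (x ⟨l, h⟩) else none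
  adj p :=
    if (ValidTd d p.1 ∧ ValidTd d p.2 ∧ ((∃ i, p.2 = i :: p.1) ∨ (∃ i, p.1 = i :: p.2)))
    then true else false

/-- The law, as a probability measure on rooted colored graphs, of the randomly labeled rooted
colored tree `(T_d, X, o)` where `X` has law `μ`. -/
def lawTd (d : ℕ) [MeasurableSpace M] (μ : Measure (TdVertex d → M)) : Measure (RCG M) :=
  μ.map (iotaTd d)

/-! ### Micro-state (sofic) entropy -/

/-- `𝓕_G(μ,r,ε)`: the set of colorings `f` of `G` whose radius-`r` local statistics are
`ε`-close (in the Lévy-Prokhorov distance, which generates the weak topology) to the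
radius-`r` restriction of `μ`. -/
def FSet (d : ℕ) [MeasurableSpace M] (μ : Measure (TdVertex d → M)) (r : ℕ) (ε : ℝ)
    (G : SimpleGraph (Fin n)) : Set (Fin n → M) :=
  {f | levyProkhorovDist ((distrG G f).map (resS r)) ((lawTd d μ).map (resS r)) ≤ ε}

/-- `H_{G}(μ,r,ε) = (1/n) log |𝓕_G(μ,r,ε)| ∈ {-∞} ∪ [0,∞)`. -/
def HG (d : ℕ) [MeasurableSpace M] (μ : Measure (TdVertex d → M)) (r : ℕ) (ε : ℝ)
    (G : SimpleGraph (Fin n)) : EReal :=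
  if FSet d μ r ε G = ∅ then ⊥
  else ((Real.log ((FSet d μ r ε G).ncard) / n : ℝ) : EReal)

/-- `h_n(μ,r,ε,α)`: the `α`-quantile
`sup { h ∈ {-∞} ∪ [0,∞) : ℙ(H_{G_n}(μ,r,ε) ≥ h) ≥ α }`. -/
def hquant (d : ℕ) [MeasurableSpace M] (μ : Measure (TdVertex d → M)) (r : ℕ) (ε : ℝ)
    (α : ℝ) (n : ℕ) : EReal :=
  sSup {h : EReal | (h = ⊥ ∨ 0 ≤ h) ∧
    α ≤ PrG d n {G : SimpleGraph (Fin n) | h ≤ HG d μ r ε G}}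

/-- The upper entropy `h̄(μ,r,α) = lim_{ε → 0} limsup_n h_n(μ,r,ε,α)` (the limit over `ε`
of a quantity non-decreasing in `ε`, i.e. the infimum over `ε > 0`). -/
def hbarA (d : ℕ) [MeasurableSpace M] (μ : Measure (TdVertex d → M)) (r : ℕ) (α : ℝ) :
    EReal :=
  ⨅ ε : {e : ℝ // 0 < e}, (goodFilter d).limsup (fun n => hquant d μ r ε.1 α n)

/-- The lower entropy `h̲(μ,r,α) = lim_{ε → 0} liminf_n h_n(μ,r,ε,α)`. -/
def hlowA (d : ℕ) [MeasurableSpace M] (μ : Measure (TdVertex d → M)) (r : ℕ) (α : ℝ) :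
    EReal :=
  ⨅ ε : {e : ℝ // 0 < e}, (goodFilter d).liminf (fun n => hquant d μ r ε.1 α n)

/-- `h̄(μ,r)`: the common value of `h̄(μ,r,α)`, `0 < α < 1`. -/
def hbarR (d : ℕ) [MeasurableSpace M] (μ : Measure (TdVertex d → M)) (r : ℕ) : EReal :=
  hbarA d μ r (1 / 2)

/-- `h̲(μ,r)`: the common value of `h̲(μ,r,α)`, `0 < α < 1`. -/
def hlowR (d : ℕ) [MeasurableSpace M] (μ : Measure (TdVertex d → M)) (r : ℕ) : EReal :=
  hlowA d μ r (1 / 2)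

/-- The upper sofic entropy `h̄(μ) = lim_{r → ∞} h̄(μ,r)` (the limit of a non-increasing
sequence, i.e. the infimum over `r`). -/
def hbar (d : ℕ) [MeasurableSpace M] (μ : Measure (TdVertex d → M)) : EReal :=
  ⨅ r : ℕ, hbarR d μ r

/-- The lower sofic entropy `h̲(μ) = lim_{r → ∞} h̲(μ,r)`. -/
def hlow (d : ℕ) [MeasurableSpace M] (μ : Measure (TdVertex d → M)) : EReal :=
  ⨅ r : ℕ, hlowR d μ r

/-! ### Typical processes -/

/-- The probability that the random `d`-regular graph `G_n` admits a coloring whose local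
statistics are `ε`-close to `μ`. -/
def typicalPr (d : ℕ) [MeasurableSpace M] (μ : Measure (TdVertex d → M)) (ε : ℝ) (n : ℕ) :
    ℝ :=
  PrG d n {G : SimpleGraph (Fin n) |
    ∃ f : Fin n → M, levyProkhorovDist (distrG G f) (lawTd d μ) ≤ ε}

/-- `μ ∈ I_d(M)` is weakly typical if
`lim_{ε → 0} limsup_{n → ∞} ℙ(∃ f : d(distr_{G_n}(f), μ) ≤ ε) = 1`. -/
def WeaklyTypical (d : ℕ) [MeasurableSpace M] (μ : Measure (TdVertex d → M)) : Prop :=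
  Tendsto (fun ε => (goodFilter d).limsup (fun n => typicalPr d μ ε n))
    (nhdsWithin 0 (Set.Ioi 0)) (nhds 1)

/-- `μ ∈ I_d(M)` is strongly typical if
`lim_{ε → 0} lim_{n → ∞} ℙ(∃ f : d(distr_{G_n}(f), μ) ≤ ε) = 1` (in particular the inner
limits along `n → ∞` exist). -/
def StronglyTypical (d : ℕ) [MeasurableSpace M] (μ : Measure (TdVertex d → M)) : Prop :=
  ∃ L : ℝ → ℝ,
    (∀ ε : ℝ, 0 < ε → Tendsto (fun n => typicalPr d μ ε n) (goodFilter d) (nhds (L ε))) ∧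
    Tendsto L (nhdsWithin 0 (Set.Ioi 0)) (nhds 1)


/-! ### Processes on balls of `T_d` and the sets `I_{d,r}(M)`, `I_e(M)` -/

/-- The ball `S_r` of `T_d` as an induced subgraph. -/
def SrGraph (d r : ℕ) : SimpleGraph ↥(SrSet d r) := (TdGraph d).induce (SrSet d r)

/-- The set `E_r` of `T_d` as an induced subgraph. -/
def ErGraph (d r : ℕ) : SimpleGraph ↥(ErSet d r) := (TdGraph d).induce (ErSet d r)

lemma root_mem_Er (d r : ℕ) (hr : 1 ≤ r) : rootTd d ∈ ErSet d r := by
  left; simpa [rootTd] using hr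

lemma node1_mem_Er (d r : ℕ) (hr : 1 ≤ r) : node1 d ∈ ErSet d r := by
  by_cases h : 1 ≤ d
  · right
    constructor <;> simp [node1, h, List.getLast?, hr]
  · simpa [node1, h] using root_mem_Er d r hr

variable {M : Type*}

/-- The restriction to `E_r ⊆ S_r` of a probability measure on `M^{S_r}`. -/
def restrictErOfSr [MeasurableSpace M] (d r : ℕ) (p : Measure (↥(SrSet d r) → M)) :
    Measure (↥(ErSet d r) → M) :=
  p.map (fun x => fun v : ↥(ErSet d r) => x ⟨v.1, ErSet_subset_SrSet d r v.2⟩)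

/-- `I_{d,r}(M)`: the set of probability measures on `M^{S_r}` which are invariant under the
automorphisms of `S_r` and whose restriction to `E_r` is invariant under switching the two
sides of the edge `{o,1}`. -/
def IdrMeas (d r : ℕ) (M : Type*) [MeasurableSpace M] :
    Set (Measure (↥(SrSet d r) → M)) :=
  {p | IsProbabilityMeasure p ∧
    (∀ φ : SrGraph d r ≃g SrGraph d r, p.map (fun x => fun v => x (φ v)) = p) ∧
    (∀ ψ : ErGraph d r ≃g ErGraph d r,
      (∀ hv : rootTd d ∈ ErSet d r, ((ψ ⟨rootTd d, hv⟩ : ↥(ErSet d r)) : TdVertex d) = node1 d) →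
      (restrictErOfSr d r p).map (fun x => fun v => x (ψ v)) = restrictErOfSr d r p)}

/-- The annealed entropy `Σ(p) = H(X_{S_r}) - (d/2) H(X_{E_r})` of `p ∈ I_{d,r}(M)`. -/
def SigmaP [MeasurableSpace M] (d r : ℕ) (p : Measure (↥(SrSet d r) → M)) : ℝ :=
  shannon p - (d / 2 : ℝ) * shannon (restrictErOfSr d r p)

/-- The involution of `E_1 = {o, 1}` switching the two sides of the edge `{o,1}`. -/
def swapE1 (d : ℕ) : ↥(ErSet d 1) → ↥(ErSet d 1) := fun v =>
  if (v : TdVertex d) = rootTd d then ⟨node1 d, node1_mem_Er d 1 le_rfl⟩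
  else ⟨rootTd d, root_mem_Er d 1 le_rfl⟩

/-- `I_e(M)`: the set of probability measures on `M^{E_1}` invariant under switching the two
sides of the edge `{o,1}`. -/
def IeMeas (d : ℕ) (M : Type*) [MeasurableSpace M] : Set (Measure (↥(ErSet d 1) → M)) :=
  {p | IsProbabilityMeasure p ∧ p.map (fun x => fun v => x (swapE1 d v)) = p}

/-- The annealed entropy `Σ(p) = (d/2) H(X_{E_1}) - (d-1) H(X_o)` of `p ∈ I_e(M)`. -/
def SigmaPe [MeasurableSpace M] (d : ℕ) (p : Measure (↥(ErSet d 1) → M)) : ℝ :=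
  (d / 2 : ℝ) * shannon p
    - ((d : ℝ) - 1) * shannon (p.map (fun x => x ⟨rootTd d, root_mem_Er d 1 le_rfl⟩))

/-! ### Factor graphs: functions of rooted unlabeled colored graphs of radius `r` -/

/-- The vertex set of a rooted colored graph. -/
def vertsOf (g : RCG M) : Set (List ℕ) := {l | g.col l ≠ none}

/-- An isomorphism of rooted colored graphs (a color- and adjacency-preserving bijection of
the vertex sets mapping root to root). -/
def RCGRootedIso (g g' : RCG M) : Prop :=
  ∃ e : ↥(vertsOf g) ≃ ↥(vertsOf g'),
    (∀ v, g'.col ((e v) : List ℕ) = g.col (v : List ℕ)) ∧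
    (∀ v w, g'.adj (((e v) : List ℕ), ((e w) : List ℕ)) = g.adj ((v : List ℕ), (w : List ℕ))) ∧
    (∀ h : [] ∈ vertsOf g, ∀ _ : [] ∈ vertsOf g', ((e ⟨[], h⟩) : List ℕ) = [])

/-- A function on rooted unlabeled colored graphs of radius `r`: a function of rooted colored
graphs which only depends on the isomorphism class of the ball of radius `r` around the
root. -/
def IsRadiusRFn (r : ℕ) (ψ : RCG M → ℝ) : Prop :=
  ∀ g g' : RCG M, RCGRootedIso (resS r g) (resS r g') → ψ g = ψ g'

/-- The value `ψ((G,f,v)_r)` of `ψ` at the rooted unlabeled colored graph given by the ball of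
radius `r` around `v` in `(G,f)` (computed as the average over the random labelings, which is
the constant value of `ψ` on them when `ψ` is a function of the unlabeled graph). -/
def psiAt {n : ℕ} (G : SimpleGraph (Fin n)) (f : Fin n → M) (v : Fin n) (ψ : RCG M → ℝ) :
    ℝ :=
  ∫ g, ψ g ∂(distrAt G f v)

/-- The partition function `Z_G = ∑_f ∏_v exp(ψ((G,f,v)_r))` of the factor model `ψ`. -/
def ZG {n : ℕ} [Fintype M] (G : SimpleGraph (Fin n)) (ψ : RCG M → ℝ) : ℝ :=
  ∑ f : Fin n → M, Real.exp (∑ v : Fin n, psiAt G f v ψ)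

/-- The ground-state energy `L_G = max_f ∑_v ψ((G,f,v)_r)`. -/
def LG {n : ℕ} (G : SimpleGraph (Fin n)) (ψ : RCG M → ℝ) : ℝ :=
  sSup {x : ℝ | ∃ f : Fin n → M, x = ∑ v : Fin n, psiAt G f v ψ}

/-- The canonical rooted colored graph associated to a coloring of the ball `S_r` of `T_d`. -/
def iotaSr (d r : ℕ) (x : ↥(SrSet d r) → M) : RCG M where
  col l := if h : ValidTd d l ∧ l.length ≤ r then some (x ⟨⟨l, h.1⟩, h.2⟩) else none
  adj p := if (ValidTd d p.1 ∧ ValidTd d p.2 ∧ p.1.length ≤ r ∧ p.2.length ≤ r ∧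
      ((∃ i, p.2 = i :: p.1) ∨ (∃ i, p.1 = i :: p.2))) then true else false

/-- `⟨p, ψ⟩ = E[ψ(X)]` where `X` has law `p ∈ I_{d,r}(M)`. -/
def pairing [MeasurableSpace M] (d r : ℕ) (p : Measure (↥(SrSet d r) → M))
    (ψ : RCG M → ℝ) : ℝ :=
  ∫ x, ψ (iotaSr d r x) ∂p

/-! ### Annealed quantities for random regular graphs -/

/-- `log` with the convention `log 0 = -∞`, with values in the extended reals. -/
def elog (x : ℝ) : EReal := if x ≤ 0 then ⊥ else ((Real.log x : ℝ) : EReal)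

/-- The set `𝓖_n(μ,r,ε)` of pairs `(G,f)` of a `d`-regular graph together with a coloring
whose radius-`r` local statistics are `ε`-close to `μ_r`. -/
def GnPairs (d : ℕ) [MeasurableSpace M] (μ : Measure (TdVertex d → M)) (r : ℕ) (ε : ℝ)
    (n : ℕ) : Set (SimpleGraph (Fin n) × (Fin n → M)) :=
  {Gf | Gf.1 ∈ regularGraphs d n ∧ Gf.2 ∈ FSet d μ r ε Gf.1}

/-- The annealed entropy
`Σ_n(μ,r,ε) = (1/n) (log |𝓖_n(μ,r,ε)| - log |𝓖_n(d)|) = (1/n) log E |𝓕_{G_n}(μ,r,ε)|`. -/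
def SigmaN (d : ℕ) [MeasurableSpace M] (μ : Measure (TdVertex d → M)) (r : ℕ) (ε : ℝ)
    (n : ℕ) : EReal :=
  (((n : ℝ)⁻¹ : ℝ) : EReal) *
    elog (((GnPairs d μ r ε n).ncard : ℝ) / ((regularGraphs d n).ncard : ℝ))

/-- The relaxed partition function `Z_G(β) = ∑_f exp(-nβ d(distr_G(f)_r, μ_r))`. -/
def ZGbeta (d : ℕ) [MeasurableSpace M] {n : ℕ} [Fintype M] (μ : Measure (TdVertex d → M))
    (r : ℕ) (β : ℝ) (G : SimpleGraph (Fin n)) : ℝ :=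
  ∑ f : Fin n → M, Real.exp (-(n : ℝ) * β *
    levyProkhorovDist ((distrG G f).map (resS r)) ((lawTd d μ).map (resS r)))


/-! ### Processes on unimodular Galton-Watson trees

A colored rooted tree `(T, X, o)` with `T` a subtree of the label set, rooted at `[]` and
with the children of a vertex `v` labeled `1 :: v, …, N_v :: v`, is encoded as a rooted
colored graph in `RCG M`. -/

/-- `g` is a canonically labeled colored rooted tree. -/
def IsCanonTree (g : RCG M) : Prop :=
  g.col [] ≠ none ∧
  (∀ l : List ℕ, g.col l ≠ none → g.col l.tail ≠ none) ∧
  (∀ (v : List ℕ) (i : ℕ), 1 ≤ i → g.col ((i + 1) :: v) ≠ none → g.col (i :: v) ≠ none) ∧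
  (∀ v : List ℕ, g.col (0 :: v) = none) ∧
  (∀ p : List ℕ × List ℕ, g.adj p = true ↔
    (g.col p.1 ≠ none ∧ g.col p.2 ≠ none ∧
      ((∃ i, p.2 = i :: p.1) ∨ (∃ i, p.1 = i :: p.2))))

/-- A finite canonically labeled tree. -/
def IsFinTree (t : Finset (List ℕ)) : Prop :=
  [] ∈ t ∧ (∀ l ∈ t, l.tail ∈ t) ∧
  (∀ (v : List ℕ) (i : ℕ), 1 ≤ i → ((i + 1) :: v) ∈ t → (i :: v) ∈ t) ∧
  (∀ v : List ℕ, (0 :: v) ∉ t)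

/-- The number of children of the vertex `v` in the finite tree `t`. -/
def childCountF (t : Finset (List ℕ)) (v : List ℕ) : ℕ :=
  (t.filter (fun w => w ≠ [] ∧ w.tail = v)).card

/-- The size-biased version `π̂(k) = (k+1) π(k+1) / d` of the offspring distribution `π`. -/
def sizeBiased (π : ℕ → ℝ) (dd : ℝ) (k : ℕ) : ℝ := (k + 1 : ℝ) * π (k + 1) / dd

/-- The probability that the unimodular Galton-Watson tree with degree distribution `π`,
truncated at depth `k`, equals the finite tree `t`. -/
def treeWeight (π : ℕ → ℝ) (dd : ℝ) (k : ℕ) (t : Finset (List ℕ)) : ℝ :=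
  π (childCountF t []) *
    ∏ v ∈ t.filter (fun v => v ≠ [] ∧ v.length < k), sizeBiased π dd (childCountF t v)

/-- The law of the underlying tree is the unimodular Galton-Watson law `UGW(π)`:
all finite-depth truncations have the prescribed distribution. -/
def IsUGWTreeLaw (π : ℕ → ℝ) (dd : ℝ) (μ : Measure (RCG M)) : Prop :=
  ∀ (k : ℕ) (t : Finset (List ℕ)), IsFinTree t → (∀ v ∈ t, v.length ≤ k) →
    (μ {g | ∀ l : List ℕ, l.length ≤ k → (g.col l ≠ none ↔ l ∈ t)}).toReal
      = treeWeight π dd k t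

/-- `e` realizes an isomorphism (not necessarily root-preserving) of the colored graphs `g`
and `g'`. -/
def IsIsoVia (g g' : RCG M) (e : List ℕ → List ℕ) : Prop :=
  Set.BijOn e (vertsOf g) (vertsOf g') ∧
  (∀ l ∈ vertsOf g, g'.col (e l) = g.col l) ∧
  (∀ l ∈ vertsOf g, ∀ l' ∈ vertsOf g, g'.adj (e l, e l') = g.adj (l, l'))

/-- A function on doubly rooted colored graphs, invariant under isomorphisms. -/
def PairInvariant (F : RCG M → List ℕ → List ℕ → ℝ≥0∞) : Prop :=
  ∀ g g' e, IsIsoVia g g' e → ∀ u ∈ vertsOf g, ∀ v ∈ vertsOf g, F g' (e u) (e v) = F g u v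

/-- Unimodularity (the mass-transport principle):
`E ∑_v F(G,o,v) = E ∑_v F(G,v,o)` for all isomorphism-invariant `F ≥ 0`. -/
def Unimodular (μ : Measure (RCG M)) : Prop :=
  ∀ F : RCG M → List ℕ → List ℕ → ℝ≥0∞, PairInvariant F →
    ∫⁻ g, (∑' v : ↥(vertsOf g), F g [] (v : List ℕ)) ∂μ
      = ∫⁻ g, (∑' v : ↥(vertsOf g), F g (v : List ℕ) []) ∂μ

/-- `I_π(M)`: the laws of invariant (unimodular) processes `(T,X)` with colors in `M` over
the unimodular Galton-Watson tree with degree distribution `π` (of mean `dd`). -/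
def IPiMeas (π : ℕ → ℝ) (dd : ℝ) (M : Type*) [MeasurableSpace M] :
    Set (Measure (RCG M)) :=
  {μ | IsProbabilityMeasure μ ∧ μ {g | IsCanonTree g} = 1 ∧ Unimodular μ ∧
    IsUGWTreeLaw π dd μ}

/-- The root degree `deg(o)` of a canonically labeled tree (the number of children of the
root). -/
def rootDeg (g : RCG M) : ℕ := {i : ℕ | g.col [i] ≠ none}.ncard

/-- The edge-biased law `→μ(⬝) = (1/d) E[deg(o) 1{(T,X,(o,1)) ∈ ⬝}]` on colored edge-rooted
trees (the root edge being `([], [1])`). -/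
def vecLaw (dd : ℝ) [MeasurableSpace M] (μ : Measure (RCG M)) : Measure (RCG M) :=
  (ENNReal.ofReal dd)⁻¹ • μ.withDensity (fun g => (rootDeg g : ℝ≥0∞))

/-- Membership in `E_r = B_{r-1}({o,1})` for a vertex of a canonically labeled tree. -/
def inErL (r : ℕ) (l : List ℕ) : Prop :=
  l.length + 1 ≤ r ∨ (l.getLast? = some 1 ∧ l.length ≤ r)

/-- The restriction of a colored edge-rooted tree to `E_r = B_{r-1}({o,1})`. -/
def resE (r : ℕ) (g : RCG M) : RCG M where
  col l := if inErL r l then g.col l else none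
  adj p := if inErL r p.1 ∧ inErL r p.2 then g.adj p else false

/-- The Shannon entropy `H(π)` of the probability mass function `π`. -/
def Hpmf (π : ℕ → ℝ) : ℝ := ∑' k : ℕ, Real.negMulLog (π k)

/-- The annealed entropy `Σ_r(μ) = H(X_{S_r}) - (d/2) H(→X_{E_r}) - H(π)` of an invariant
process over the unimodular Galton-Watson tree. -/
def SigmaUGW (π : ℕ → ℝ) (dd : ℝ) [MeasurableSpace M] (r : ℕ) (μ : Measure (RCG M)) : ℝ :=
  shannon (μ.map (resS r)) - (dd / 2) * shannon ((vecLaw dd μ).map (resE r)) - Hpmf π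

/-- `Σ(μ) = lim_{r → ∞} Σ_r(μ)` (the limit of a non-increasing sequence). -/
def SigmaUGWInf (π : ℕ → ℝ) (dd : ℝ) [MeasurableSpace M] (μ : Measure (RCG M)) : EReal :=
  ⨅ r : ℕ, ((SigmaUGW π dd (r + 1) μ : ℝ) : EReal)

/-- `Σ_e(X) = (d/2) H(→X_{E_1}) - d H(→X_o) + H(X_o) - H(π)`. -/
def SigmaEUGW (π : ℕ → ℝ) (dd : ℝ) [MeasurableSpace M] (μ : Measure (RCG M)) : ℝ :=
  (dd / 2) * shannon ((vecLaw dd μ).map (resE 1))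
    - dd * shannon ((vecLaw dd μ).map (resS 0))
    + shannon (μ.map (resS 0)) - Hpmf π

/-! ### Markov processes on random trees -/

/-- The side of the (potential) edge `{u,w}` containing `u`, among the labels. -/
def sideL (u w : List ℕ) : Set (List ℕ) := {v | treeDist v u < treeDist v w}

/-- `B_{r-1}({u,w})` among the labels. -/
def edgeBallL (r : ℕ) (u w : List ℕ) : Set (List ℕ) :=
  {v | treeDist v u + 1 ≤ r ∨ treeDist v w + 1 ≤ r}

/-- The event that the tree structure agrees with that of `y` on `S` and that the colored
tree agrees with `y` on `B`. -/
def treeCylEvent (S B : Set (List ℕ)) (y : RCG M) : Set (RCG M) :=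
  {g | (∀ l ∈ S, (g.col l ≠ none ↔ y.col l ≠ none)) ∧ (∀ l ∈ B, g.col l = y.col l)}

/-- A random colored tree is `r`-Markov on the ambient set `A` if, conditioned on the tree
and on the value on the `(r-1)`-neighborhood of an edge, the processes on the two sides of
the edge are independent (conditioning on the tree is expressed through arbitrary finite
windows `S`). -/
def rMarkovTreeOn [MeasurableSpace M] (r : ℕ) (A : Set (List ℕ)) (μ : Measure (RCG M)) :
    Prop :=
  ∀ (u : List ℕ) (i : ℕ), 1 ≤ i → u ∈ A → (i :: u) ∈ A →
    ∀ F₁ F₂ : Finset (List ℕ), ↑F₁ ⊆ sideL u (i :: u) ∩ A → ↑F₂ ⊆ sideL (i :: u) u ∩ A →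
    ∀ S : Finset (List ℕ), ↑S ⊆ A → ∀ y : RCG M,
      μ (treeCylEvent ↑S (edgeBallL r u (i :: u) ∩ A) y ∩
          treeCylEvent ∅ ↑F₁ y ∩ treeCylEvent ∅ ↑F₂ y)
        * μ (treeCylEvent ↑S (edgeBallL r u (i :: u) ∩ A) y)
      = μ (treeCylEvent ↑S (edgeBallL r u (i :: u) ∩ A) y ∩ treeCylEvent ∅ ↑F₁ y)
        * μ (treeCylEvent ↑S (edgeBallL r u (i :: u) ∩ A) y ∩ treeCylEvent ∅ ↑F₂ y)

/-- A random colored tree is `r`-Markov if the above holds with ambient set everything. -/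
def rMarkovTree [MeasurableSpace M] (r : ℕ) (μ : Measure (RCG M)) : Prop :=
  rMarkovTreeOn r Set.univ μ

/-- A random colored tree is vertex-Markov on the ambient set `A` if, conditioned on the tree
and on the value at a vertex, the processes on the pending subtrees of that vertex are
independent. -/
def vertexMarkovTreeOn [MeasurableSpace M] (A : Set (List ℕ)) (μ : Measure (RCG M)) :
    Prop :=
  ∀ v ∈ A, ∀ (k : ℕ) (u : Fin k → List ℕ), Function.Injective u →
    (∀ j, u j ∈ A ∧ ((∃ i, 1 ≤ i ∧ u j = i :: v) ∨ (v ≠ [] ∧ u j = v.tail))) →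
    ∀ F : Fin k → Finset (List ℕ), (∀ j, ↑(F j) ⊆ sideL (u j) v ∩ A) →
    ∀ S : Finset (List ℕ), ↑S ⊆ A → ∀ y : RCG M,
      μ (treeCylEvent ↑S {v} y ∩ ⋂ j, treeCylEvent ∅ ↑(F j) y)
          * (μ (treeCylEvent ↑S {v} y)) ^ (k - 1)
        = ∏ j : Fin k, μ (treeCylEvent ↑S {v} y ∩ treeCylEvent ∅ ↑(F j) y)

/-- A random colored tree is vertex-Markov if the above holds with ambient set everything. -/
def vertexMarkovTree [MeasurableSpace M] (μ : Measure (RCG M)) : Prop :=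
  vertexMarkovTreeOn Set.univ μ

/-! ### Random graphs with given degree sequences -/

/-- The set of simple graphs on `{1,…,n}` with degree sequence `dn`. -/
def degSeqGraphs (n : ℕ) (dn : Fin n → ℕ) : Set (SimpleGraph (Fin n)) :=
  {G | ∀ v, (G.neighborSet v).ncard = dn v}

/-- The probability that a uniform random graph with degree sequence `dn` lies in `A`. -/
def PrD (n : ℕ) (dn : Fin n → ℕ) (A : Set (SimpleGraph (Fin n))) : ℝ :=
  ((degSeqGraphs n dn ∩ A).ncard : ℝ) / ((degSeqGraphs n dn).ncard : ℝ)

/-- `𝓕_G(μ,r,ε)` for a process `μ` over a unimodular Galton-Watson tree. -/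
def FSetD [MeasurableSpace M] (μ : Measure (RCG M)) (r : ℕ) (ε : ℝ) {n : ℕ}
    (G : SimpleGraph (Fin n)) : Set (Fin n → M) :=
  {f | levyProkhorovDist ((distrG G f).map (resS r)) (μ.map (resS r)) ≤ ε}

/-- `H_G(μ,r,ε) = (1/n) log |𝓕_G(μ,r,ε)|`. -/
def HGD [MeasurableSpace M] (μ : Measure (RCG M)) (r : ℕ) (ε : ℝ) {n : ℕ}
    (G : SimpleGraph (Fin n)) : EReal :=
  if FSetD μ r ε G = ∅ then ⊥
  else ((Real.log ((FSetD μ r ε G).ncard) / n : ℝ) : EReal)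

/-- The `α`-quantile of `H_{G_n}(μ,r,ε)` for the uniform random graph with degree sequence
`DN n`. -/
def hquantD [MeasurableSpace M] (DN : (n : ℕ) → Fin n → ℕ) (μ : Measure (RCG M)) (r : ℕ)
    (ε : ℝ) (α : ℝ) (n : ℕ) : EReal :=
  sSup {h : EReal | (h = ⊥ ∨ 0 ≤ h) ∧
    α ≤ PrD n (DN n) {G : SimpleGraph (Fin n) | h ≤ HGD μ r ε G}}

/-- `h̄(μ,r,α)` for the degree-sequence ensemble. -/
def hbarAD [MeasurableSpace M] (DN : (n : ℕ) → Fin n → ℕ) (μ : Measure (RCG M)) (r : ℕ)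
    (α : ℝ) : EReal :=
  ⨅ ε : {e : ℝ // 0 < e}, Filter.atTop.limsup (fun n => hquantD DN μ r ε.1 α n)

/-- `h̲(μ,r,α)` for the degree-sequence ensemble. -/
def hlowAD [MeasurableSpace M] (DN : (n : ℕ) → Fin n → ℕ) (μ : Measure (RCG M)) (r : ℕ)
    (α : ℝ) : EReal :=
  ⨅ ε : {e : ℝ // 0 < e}, Filter.atTop.liminf (fun n => hquantD DN μ r ε.1 α n)

/-- `h̄(μ,r)`: the common value of `h̄(μ,r,α)`, `0 < α < 1`. -/
def hbarRD [MeasurableSpace M] (DN : (n : ℕ) → Fin n → ℕ) (μ : Measure (RCG M)) (r : ℕ) :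
    EReal :=
  hbarAD DN μ r (1 / 2)

/-- `h̲(μ,r)`. -/
def hlowRD [MeasurableSpace M] (DN : (n : ℕ) → Fin n → ℕ) (μ : Measure (RCG M)) (r : ℕ) :
    EReal :=
  hlowAD DN μ r (1 / 2)

/-- The upper sofic entropy `h̄(μ) = lim_{r → ∞} h̄(μ,r)`. -/
def hbarD [MeasurableSpace M] (DN : (n : ℕ) → Fin n → ℕ) (μ : Measure (RCG M)) : EReal :=
  ⨅ r : ℕ, hbarRD DN μ r

/-- The lower sofic entropy `h̲(μ) = lim_{r → ∞} h̲(μ,r)`. -/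
def hlowD [MeasurableSpace M] (DN : (n : ℕ) → Fin n → ℕ) (μ : Measure (RCG M)) : EReal :=
  ⨅ r : ℕ, hlowRD DN μ r

/-- The hypotheses on the degree sequences: uniformly bounded by `Δ`, even sums, and
empirical distributions converging (weakly) to `π`. -/
def GoodDegSeq (π : ℕ → ℝ) (Δ : ℝ) (DN : (n : ℕ) → Fin n → ℕ) : Prop :=
  (∀ n v, (DN n v : ℝ) ≤ Δ) ∧ (∀ n, Even (∑ v : Fin n, DN n v)) ∧
  (∀ k : ℕ, Tendsto (fun n => (((Finset.univ.filter (fun v : Fin n => DN n v = k)).card : ℝ) / n))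
    atTop (nhds (π k)))

/-- The hypotheses on the degree distribution `π`: a probability mass function supported in
`{0,…,Δ}` with mean `dd > 0`. -/
def GoodPmf (π : ℕ → ℝ) (Δ : ℝ) (dd : ℝ) : Prop :=
  (∀ k, 0 ≤ π k) ∧ (∑' k : ℕ, π k) = 1 ∧ (∀ k : ℕ, (Δ : ℝ) < k → π k = 0) ∧
  (∑' k : ℕ, (k : ℝ) * π k) = dd ∧ 0 < dd


/-! ### Couplings -/

/-- `ν ∈ I_d(M × M)` is an invariant coupling of `μ` with itself: both coordinate marginal
processes of `ν` have law `μ`. -/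
def IsInvCoupling (d : ℕ) {M : Type*} [MeasurableSpace M] (μ : Measure (TdVertex d → M))
    (ν : Measure (TdVertex d → M × M)) : Prop :=
  ν ∈ InvMeas d (M × M) ∧ ν.map (fun x => fun v => (x v).1) = μ ∧
    ν.map (fun x => fun v => (x v).2) = μ

/-- The first coordinate marginal of a colored graph with colors in a product set. -/
def rcgFst {M₁ M₂ : Type*} (g : RCG (M₁ × M₂)) : RCG M₁ :=
  ⟨fun l => (g.col l).map Prod.fst, g.adj⟩

/-- The second coordinate marginal of a colored graph with colors in a product set. -/
def rcgSnd {M₁ M₂ : Type*} (g : RCG (M₁ × M₂)) : RCG M₂ :=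
  ⟨fun l => (g.col l).map Prod.snd, g.adj⟩

/-- `ν ∈ I_π(M × M)` is an invariant coupling of `μ ∈ I_π(M)` with itself. -/
def IsInvCouplingUGW (π : ℕ → ℝ) (dd : ℝ) {M : Type*} [MeasurableSpace M]
    (μ : Measure (RCG M)) (ν : Measure (RCG (M × M))) : Prop :=
  ν ∈ IPiMeas π dd (M × M) ∧ ν.map rcgFst = μ ∧ ν.map rcgSnd = μ


/-! ### Concentration of measure on finite permutation groups -/

lemma sum_exp_le_of_oscillation {ι : Type*} [Fintype ι] [Nonempty ι] (x : ι → ℝ) (c t : ℝ)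
    (hx : ∀ i j, |x i - x j| ≤ c) :
    ∑ i, Real.exp (t * x i) ≤ Fintype.card ι *
      (Real.exp (t * ((∑ i, x i) / Fintype.card ι)) * Real.exp (t ^ 2 * c ^ 2 / 2)) := by
  have hN : (0 : ℝ) < Fintype.card ι := by exact_mod_cast Fintype.card_pos
  set N : ℝ := (Fintype.card ι : ℝ) with hNdef
  set a := (∑ i, x i) / N with ha
  have hsum : ∑ i, (x i - a) = 0 := by
    rw [Finset.sum_sub_distrib, Finset.sum_const, Finset.card_univ, nsmul_eq_mul, ← hNdef, ha]
    field_simp; ring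
  have h1 : N ≤ ∑ j, Real.exp (-(t * (x j - a))) := by
    calc N = ∑ j : ι, (-(t * (x j - a)) + 1) := by
          rw [Finset.sum_add_distrib, Finset.sum_neg_distrib, ← Finset.mul_sum, hsum]
          simp [hNdef]
      _ ≤ _ := Finset.sum_le_sum fun j _ => Real.add_one_le_exp _
  have h2 : (∑ i, Real.exp (t * (x i - a))) * ∑ j, Real.exp (-(t * (x j - a)))
      ≤ N * N * Real.exp (t ^ 2 * c ^ 2 / 2) := by
    have e1 : (∑ i, Real.exp (t * (x i - a))) * ∑ j, Real.exp (-(t * (x j - a)))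
        = ∑ i, ∑ j, Real.exp (t * (x i - x j)) := by
      rw [Finset.sum_mul_sum]
      refine Finset.sum_congr rfl fun i _ => Finset.sum_congr rfl fun j _ => ?_
      rw [← Real.exp_add]; congr 1; ring
    have e2 : ∑ i, ∑ j, Real.exp (t * (x i - x j)) = ∑ i, ∑ j, Real.cosh (t * (x i - x j)) := by
      have e3 : ∑ i, ∑ j, Real.exp (t * (x i - x j)) = ∑ i, ∑ j, Real.exp (-(t * (x i - x j))) := by
        rw [Finset.sum_comm]
        refine Finset.sum_congr rfl fun i _ => Finset.sum_congr rfl fun j _ => ?_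
        congr 1; ring
      have e4 : ∑ i, ∑ j, Real.cosh (t * (x i - x j))
          = (∑ i, ∑ j, Real.exp (t * (x i - x j)) +
              ∑ i, ∑ j, Real.exp (-(t * (x i - x j)))) / 2 := by
        rw [← Finset.sum_add_distrib, Finset.sum_div]
        refine Finset.sum_congr rfl fun i _ => ?_
        rw [← Finset.sum_add_distrib, Finset.sum_div]
        exact Finset.sum_congr rfl fun j _ => Real.cosh_eq _
      rw [e4, ← e3]; ring
    rw [e1, e2]
    calc ∑ i, ∑ j, Real.cosh (t * (x i - x j))
        ≤ ∑ i : ι, ∑ j : ι, Real.exp (t ^ 2 * c ^ 2 / 2) := by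
          refine Finset.sum_le_sum fun i _ => Finset.sum_le_sum fun j _ => ?_
          refine (Real.cosh_le_exp_half_sq _).trans (Real.exp_le_exp.mpr ?_)
          have : (x i - x j) ^ 2 ≤ c ^ 2 := by
            rw [← sq_abs]; exact pow_le_pow_left₀ (abs_nonneg _) (hx i j) 2
          rw [mul_pow]
          have := mul_le_mul_of_nonneg_left this (sq_nonneg t)
          linarith
      _ = _ := by simp [hNdef]; ring
  have hS : 0 ≤ ∑ i, Real.exp (t * (x i - a)) := Finset.sum_nonneg fun i _ => (Real.exp_pos _).le
  have h3 : (∑ i, Real.exp (t * (x i - a))) * N ≤ (N * Real.exp (t ^ 2 * c ^ 2 / 2)) * N := by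
    calc _ ≤ _ := mul_le_mul_of_nonneg_left h1 hS
      _ ≤ _ := h2
      _ = _ := by ring
  have h4 := le_of_mul_le_mul_right h3 hN
  have h5 : ∑ i, Real.exp (t * x i) = Real.exp (t * a) * ∑ i, Real.exp (t * (x i - a)) := by
    rw [Finset.mul_sum]
    refine Finset.sum_congr rfl fun i _ => ?_
    rw [← Real.exp_add]; congr 1; ring
  rw [h5]
  calc _ ≤ _ := mul_le_mul_of_nonneg_left h4 (Real.exp_pos _).le
    _ = _ := by ring

lemma sum_exp_perm_fin_le (N : ℕ) (c t : ℝ) :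
    ∀ F : Equiv.Perm (Fin N) → ℝ,
      (∀ π a b, |F (Equiv.swap a b * π) - F π| ≤ c) →
      ∑ π, Real.exp (t * F π) ≤ (N.factorial : ℝ) *
        (Real.exp (t * ((∑ π, F π) / N.factorial)) * Real.exp (N * (t ^ 2 * (2 * c) ^ 2 / 2))) := by
  induction N with
  | zero =>
    intro F _
    simp
  | succ N ih =>
    intro F hF
    set e := (Equiv.Perm.decomposeFin (n := N)).symm with he
    have hsym : ∀ (G : Equiv.Perm (Fin (N + 1)) → ℝ),
        ∑ π, G π = ∑ i : Fin (N + 1), ∑ τ : Equiv.Perm (Fin N), G (e (i, τ)) := by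
      intro G
      rw [← Fintype.sum_prod_type', ← Equiv.sum_comp e]
    have hsw : ∀ i τ, e (i, τ) = Equiv.swap 0 i * e (0, τ) := by
      intro i τ
      ext x
      refine Fin.cases ?_ (fun y => ?_) x
      · simp only [he, Equiv.Perm.decomposeFin_symm_apply_zero, Equiv.Perm.mul_apply,
          Equiv.swap_apply_left]
      · simp only [he, Equiv.Perm.decomposeFin_symm_apply_succ, Equiv.Perm.mul_apply,
          Equiv.swap_self, Equiv.refl_apply]
    have hmul : ∀ a b τ, e (0, Equiv.swap a b * τ) = Equiv.swap a.succ b.succ * e (0, τ) := by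
      intro a b τ
      ext x
      refine Fin.cases ?_ (fun y => ?_) x
      · simp only [he, Equiv.Perm.decomposeFin_symm_apply_zero, Equiv.Perm.mul_apply]
        rw [Equiv.swap_apply_of_ne_of_ne (Fin.succ_ne_zero _).symm (Fin.succ_ne_zero _).symm]
      · simp only [he, Equiv.Perm.decomposeFin_symm_apply_succ, Equiv.Perm.mul_apply,
          Equiv.swap_self, Equiv.refl_apply]
        rw [(Fin.succ_injective N).map_swap]
    have hN : (0 : ℝ) < N.factorial := by exact_mod_cast N.factorial_pos
    set A : Fin (N + 1) → ℝ := fun i => (∑ τ, F (e (i, τ))) / N.factorial with hA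
    have hstep : ∀ i, ∑ τ, Real.exp (t * F (e (i, τ))) ≤ (N.factorial : ℝ) *
        (Real.exp (t * A i) * Real.exp (N * (t ^ 2 * (2 * c) ^ 2 / 2))) := by
      intro i
      refine ih (fun τ => F (e (i, τ))) ?_
      intro τ a b
      have : e (i, Equiv.swap a b * τ)
          = Equiv.swap (Equiv.swap 0 i a.succ) (Equiv.swap 0 i b.succ) * e (i, τ) := by
        rw [hsw i, hsw i τ, hmul, ← mul_assoc, ← mul_assoc, Equiv.mul_swap_eq_swap_mul]
      simp only [this]
      exact hF _ _ _
    have hosc : ∀ i j, |A i - A j| ≤ 2 * c := by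
      intro i j
      rw [hA]
      simp only
      rw [← sub_div, ← Finset.sum_sub_distrib, abs_div, abs_of_pos hN, div_le_iff₀ hN]
      refine (Finset.abs_sum_le_sum_abs _ _).trans ?_
      calc _ ≤ ∑ τ : Equiv.Perm (Fin N), 2 * c := by
            refine Finset.sum_le_sum fun τ _ => ?_
            have h1 := hF (e (0, τ)) 0 i
            have h2 := hF (e (0, τ)) 0 j
            rw [← hsw] at h1 h2
            rw [abs_le] at *
            constructor <;> linarith [h1.1, h1.2, h2.1, h2.2]
        _ = _ := by simp [Fintype.card_perm]; ring
    have hfin := sum_exp_le_of_oscillation A (2 * c) t hosc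
    have hmean : (∑ i, A i) / (Fintype.card (Fin (N + 1)) : ℝ)
        = (∑ π, F π) / (N + 1).factorial := by
      rw [hsym F, hA, ← Finset.sum_div, div_div, Nat.factorial_succ]
      simp [mul_comm]
    rw [hmean] at hfin
    rw [hsym]
    calc _ ≤ ∑ i, (N.factorial : ℝ) *
        (Real.exp (t * A i) * Real.exp (N * (t ^ 2 * (2 * c) ^ 2 / 2))) :=
          Finset.sum_le_sum fun i _ => hstep i
      _ = (N.factorial : ℝ) * Real.exp (N * (t ^ 2 * (2 * c) ^ 2 / 2)) *
          ∑ i, Real.exp (t * A i) := by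
          rw [Finset.mul_sum]; refine Finset.sum_congr rfl fun i _ => by ring
      _ ≤ _ := mul_le_mul_of_nonneg_left hfin (by positivity)
      _ = _ := by
          rw [Nat.factorial_succ, Fintype.card_fin]
          push_cast
          rw [show ((N : ℝ) + 1) * (t ^ 2 * (2 * c) ^ 2 / 2)
            = N * (t ^ 2 * (2 * c) ^ 2 / 2) + t ^ 2 * (2 * c) ^ 2 / 2 by ring, Real.exp_add]
          ring

lemma sum_exp_perm_le {V : Type*} [Fintype V] [DecidableEq V] (c t : ℝ) (F : Equiv.Perm V → ℝ)
    (hF : ∀ π a b, |F (Equiv.swap a b * π) - F π| ≤ c) :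
    ∑ π, Real.exp (t * F π) ≤ (Fintype.card (Equiv.Perm V) : ℝ) *
      (Real.exp (t * ((∑ π, F π) / Fintype.card (Equiv.Perm V))) *
        Real.exp (Fintype.card V * (t ^ 2 * (2 * c) ^ 2 / 2))) := by
  set e := Fintype.equivFin V
  have h := sum_exp_perm_fin_le (Fintype.card V) c t (fun π => F (e.symm.permCongr π)) (by
    intro π a b
    have : e.symm.permCongr (Equiv.swap a b * π)
        = Equiv.swap (e.symm a) (e.symm b) * e.symm.permCongr π := by
      ext x
      simp [Equiv.permCongr_apply, e.symm.injective.map_swap]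
    rw [this]; exact hF _ _ _)
  rw [Equiv.sum_comp e.symm.permCongr (fun π => F π),
    Equiv.sum_comp e.symm.permCongr (fun π => Real.exp (t * F π))] at h
  rwa [Fintype.card_perm]

/-- In a transitive action of a finite group, orbit averages are uniform averages. -/
lemma sum_smul_of_isPretransitive {G X : Type*} [Group G] [Fintype G] [Fintype X] [MulAction G X]
    [MulAction.IsPretransitive G X] (F : X → ℝ) (x₀ : X) :
    (Fintype.card X : ℝ) * ∑ g : G, F (g • x₀) = Fintype.card G * ∑ x, F x := by
  have h1 : ∀ x : X, ∑ g : G, F (g • x) = ∑ g : G, F (g • x₀) := by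
    intro x
    obtain ⟨h, rfl⟩ := MulAction.exists_smul_eq G x₀ x
    simp only [smul_smul]
    exact Equiv.sum_comp (Equiv.mulRight h) (fun g => F (g • x₀))
  have h2 : ∑ x : X, ∑ g : G, F (g • x) = Fintype.card X * ∑ g : G, F (g • x₀) := by
    simp [h1]
  have h3 : ∑ x : X, ∑ g : G, F (g • x) = Fintype.card G * ∑ x, F x := by
    rw [Finset.sum_comm]
    have : ∀ g : G, ∑ x, F (g • x) = ∑ x, F x := fun g => Equiv.sum_comp (MulAction.toPerm g) F
    simp [this]
  linarith

/-- Sub-Gaussian concentration on a finite set on which a permutation group acts transitively,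
for functions that are Lipschitz under transpositions. -/
lemma card_deviation_le {V X : Type*} [Fintype V] [DecidableEq V] [Fintype X] [Nonempty X]
    [MulAction (Equiv.Perm V) X] [MulAction.IsPretransitive (Equiv.Perm V) X]
    (c s : ℝ) (hc : 0 < c) (hs : 0 < s) (hV : 0 < Fintype.card V) (F : X → ℝ)
    (hF : ∀ (x : X) (a b : V), |F (Equiv.swap a b • x) - F x| ≤ c) :
    ((Finset.univ.filter fun x => s < |F x - (∑ y, F y) / Fintype.card X|).card : ℝ)
      ≤ 2 * Real.exp (-(s ^ 2 / (8 * Fintype.card V * c ^ 2))) * Fintype.card X := by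
  obtain ⟨x₀⟩ := ‹Nonempty X›
  set N : ℝ := (Fintype.card V : ℝ) with hN
  have hNpos : 0 < N := by rw [hN]; exact_mod_cast hV
  have hX : (0 : ℝ) < Fintype.card X := by exact_mod_cast Fintype.card_pos_iff.mpr ⟨x₀⟩
  have hP : (0 : ℝ) < Fintype.card (Equiv.Perm V) := by exact_mod_cast Fintype.card_pos
  set a := (∑ y, F y) / Fintype.card X with ha
  have hmgf : ∀ t : ℝ, ∑ x, Real.exp (t * F x) ≤ Fintype.card X *
      (Real.exp (t * a) * Real.exp (N * (t ^ 2 * (2 * c) ^ 2 / 2))) := by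
    intro t
    have h := sum_exp_perm_le c t (fun π : Equiv.Perm V => F (π • x₀)) (by
      intro π a b
      simp only [mul_smul]
      exact hF _ _ _)
    have h1 := sum_smul_of_isPretransitive (G := Equiv.Perm V) F x₀
    have h2 := sum_smul_of_isPretransitive (G := Equiv.Perm V) (fun x => Real.exp (t * F x)) x₀
    have h3 : (∑ π : Equiv.Perm V, F (π • x₀)) / Fintype.card (Equiv.Perm V) = a := by
      rw [ha, div_eq_div_iff hP.ne' hX.ne']; linarith
    rw [h3] at h
    have h4 := mul_le_mul_of_nonneg_left h hX.le
    rw [h2] at h4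
    refine le_of_mul_le_mul_left (h4.trans_eq ?_) hP
    ring
  set t := s / (4 * N * c ^ 2) with ht
  have htpos : 0 < t := by positivity
  have hone : ∀ τ : ℝ, (τ = t ∨ τ = -t) →
      ((Finset.univ.filter fun x => s < (τ / t) * (F x - a)).card : ℝ)
        ≤ Real.exp (-(s ^ 2 / (8 * N * c ^ 2))) * Fintype.card X := by
    intro τ hτ
    have hτ2 : τ ^ 2 = t ^ 2 := by rcases hτ with rfl | rfl <;> ring
    have h1 : ((Finset.univ.filter fun x => s < (τ / t) * (F x - a)).card : ℝ)
        * Real.exp (t * s + τ * a) ≤ ∑ x, Real.exp (τ * F x) := by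
      rw [← nsmul_eq_mul, ← Finset.sum_const]
      refine (Finset.sum_le_sum fun x hx => ?_).trans
        (Finset.sum_le_sum_of_subset_of_nonneg (Finset.filter_subset _ _)
          fun _ _ _ => (Real.exp_pos _).le)
      refine Real.exp_le_exp.mpr ?_
      have h := (Finset.mem_filter.mp hx).2
      have h' := mul_le_mul_of_nonneg_left h.le htpos.le
      have : t * (τ / t * (F x - a)) = τ * F x - τ * a := by field_simp
      linarith
    have h2 := h1.trans (hmgf τ)
    rw [hτ2] at h2
    have h3 : Fintype.card X * (Real.exp (τ * a) * Real.exp (N * (t ^ 2 * (2 * c) ^ 2 / 2)))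
        = (Real.exp (-(s ^ 2 / (8 * N * c ^ 2))) * Fintype.card X) * Real.exp (t * s + τ * a) := by
      have : N * (t ^ 2 * (2 * c) ^ 2 / 2) = -(s ^ 2 / (8 * N * c ^ 2)) + t * s := by
        rw [ht]; field_simp; ring
      rw [this, Real.exp_add, Real.exp_add (t * s)]; ring
    rw [h3] at h2
    exact le_of_mul_le_mul_right h2 (Real.exp_pos _)
  have hp := hone t (Or.inl rfl)
  have hm := hone (-t) (Or.inr rfl)
  have hsub : (Finset.univ.filter fun x => s < |F x - a|)
      ⊆ (Finset.univ.filter fun x => s < (t / t) * (F x - a)) ∪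
        (Finset.univ.filter fun x => s < (-t / t) * (F x - a)) := by
    intro x hx
    have h := (Finset.mem_filter.mp hx).2
    rw [neg_div, div_self htpos.ne']
    simp only [Finset.mem_union, Finset.mem_filter, Finset.mem_univ, true_and]
    rcases lt_abs.mp h with h | h
    · left; linarith
    · right; linarith
  have hcard := (Finset.card_le_card hsub).trans (Finset.card_union_le _ _)
  have hcard' : ((Finset.univ.filter fun x => s < |F x - a|).card : ℝ) ≤
      ((Finset.univ.filter fun x => s < (t / t) * (F x - a)).card : ℝ) +
      ((Finset.univ.filter fun x => s < (-t / t) * (F x - a)).card : ℝ) := by exact_mod_cast hcard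
  linarith

/-! ### The configuration model -/

/-- Fixed-point-free involutions, i.e. perfect matchings, of `V`. -/
abbrev Matching (V : Type*) : Type _ :=
  {m : Equiv.Perm V // (∀ a, m (m a) = a) ∧ ∀ a, m a ≠ a}

namespace Matching

instance {V : Type*} : MulAction (Equiv.Perm V) (Matching V) where
  smul σ m := ⟨σ * m.1 * σ⁻¹, by
    refine ⟨fun a => ?_, fun a h => ?_⟩
    · simp [Equiv.Perm.mul_apply, m.2.1]
    · have : m.1 (σ⁻¹ a) = σ⁻¹ a := by
        rw [Equiv.Perm.eq_inv_iff_eq]; exact h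
      exact m.2.2 _ this⟩
  one_smul m := Subtype.ext (by change 1 * m.1 * 1⁻¹ = m.1; simp)
  mul_smul σ τ m := Subtype.ext (by
    change (σ * τ) * m.1 * (σ * τ)⁻¹ = σ * (τ * m.1 * τ⁻¹) * σ⁻¹
    simp [mul_assoc])

lemma smul_val {V : Type*} (σ : Equiv.Perm V) (m : Matching V) (a : V) :
    (σ • m).1 a = σ (m.1 (σ⁻¹ a)) := rfl

lemma swap_smul_val {V : Type*} [DecidableEq V] (x y : V) (m : Matching V) (a : V) :
    (Equiv.swap x y • m).1 a = Equiv.swap x y (m.1 (Equiv.swap x y a)) := by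
  rw [smul_val, Equiv.swap_inv]

lemma cycleType_eq {V : Type*} [Fintype V] (m : Matching V) :
    m.1.cycleType = Multiset.replicate (Fintype.card V / 2) 2 := by
  have hsupp : m.1.support = Finset.univ := by
    ext a; simp [m.2.2 a]
  rcases isEmpty_or_nonempty V with hV | ⟨⟨a⟩⟩
  · have : m.1 = 1 := Subsingleton.elim _ _
    rw [this]; simp
  have hord : orderOf m.1 = 2 := by
    refine orderOf_eq_prime ?_ ?_
    · ext x; simp [pow_two, m.2.1]
    · intro h
      exact m.2.2 a (by rw [h]; rfl)
  obtain ⟨k, hk⟩ := Equiv.Perm.cycleType_prime_order (by rw [hord]; exact Nat.prime_two)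
  rw [hord] at hk
  have hs := m.1.sum_cycleType
  rw [hk, hsupp, Finset.card_univ, Multiset.sum_replicate, smul_eq_mul] at hs
  rw [hk, ← hs, Nat.mul_div_cancel _ two_pos]

instance {V : Type*} [Fintype V] :
    MulAction.IsPretransitive (Equiv.Perm V) (Matching V) where
  exists_smul_eq m m' := by
    have h : IsConj m.1 m'.1 := by
      rw [Equiv.Perm.isConj_iff_cycleType_eq, cycleType_eq, cycleType_eq]
    obtain ⟨σ, hσ⟩ := isConj_iff.mp h
    exact ⟨σ, Subtype.ext hσ⟩

lemma nonempty_of_even {V : Type*} [Fintype V] (h : Even (Fintype.card V)) :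
    Nonempty (Matching V) := by
  obtain ⟨k, hk⟩ := h
  have e : V ≃ Fin k ⊕ Fin k := Fintype.equivOfCardEq (by simp [hk])
  let s : Equiv.Perm (Fin k ⊕ Fin k) := Equiv.sumComm _ _
  refine ⟨⟨(e.trans s).trans e.symm, fun a => ?_, fun a h => ?_⟩⟩
  · simp [s]
  · have h2 : s (e a) = e a := by
      rw [← e.apply_symm_apply (s (e a))]; exact congrArg e h
    rcases hx : e a with i | i <;> rw [hx] at h2 <;> simp [s] at h2

/-- The number of matchings containing prescribed pairwise disjoint pairs. -/
lemma card_prescribed_le {V ι : Type*} [Fintype V] [DecidableEq V] [Fintype ι] (a b : ι → V)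
    (hab : Function.Injective (Sum.elim a b)) (s : Finset ι) :
    Fintype.card {m : Matching V // ∀ i ∈ s, m.1 (a i) = b i} *
      (Fintype.card V - 2 * Fintype.card ι) ^ s.card ≤ Fintype.card (Matching V) := by
  induction s using Finset.induction_on with
  | empty => simp
  | insert i s hi ih =>
    rw [Finset.card_insert_of_notMem hi, pow_succ', ← mul_assoc]
    refine (Nat.mul_le_mul_right _ ?_).trans ih
    set R : Finset V := Finset.univ.image (Sum.elim a b) with hR
    have hRc : Fintype.card V - 2 * Fintype.card ι ≤ Fintype.card {x // x ∉ R} := by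
      rw [Fintype.card_subtype_compl, Fintype.card_coe]
      have : R.card ≤ 2 * Fintype.card ι := by
        refine Finset.card_image_le.trans ?_
        simp [two_mul]
      omega
    refine (Nat.mul_le_mul_left _ hRc).trans ?_
    rw [← Fintype.card_prod]
    have hmem : ∀ j, a j ∈ R ∧ b j ∈ R := fun j =>
      ⟨Finset.mem_image.mpr ⟨Sum.inl j, Finset.mem_univ _, rfl⟩,
        Finset.mem_image.mpr ⟨Sum.inr j, Finset.mem_univ _, rfl⟩⟩
    have hne : ∀ j, a j ≠ b i := fun j h => by
      have := @hab (Sum.inl j) (Sum.inr i) h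
      simp at this
    have hneb : ∀ j ∈ s, b j ≠ b i := fun j hj h => by
      have := @hab (Sum.inr j) (Sum.inr i) h
      simp only [Sum.inr.injEq] at this
      exact hi (this ▸ hj)
    have hneR : ∀ (x : {x // x ∉ R}) (y : V), y ∈ R → y ≠ x.1 := fun x y hy h => x.2 (h ▸ hy)
    let Φ : {m : Matching V // ∀ j ∈ insert i s, m.1 (a j) = b j} × {x // x ∉ R} →
        {m : Matching V // ∀ j ∈ s, m.1 (a j) = b j} := fun p =>
      ⟨Equiv.swap (b i) p.2.1 • p.1.1, fun j hj => by
        rw [swap_smul_val, Equiv.swap_apply_of_ne_of_ne (hne j) (hneR _ _ (hmem j).1),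
          p.1.2 j (Finset.mem_insert_of_mem hj),
          Equiv.swap_apply_of_ne_of_ne (hneb j hj) (hneR _ _ (hmem j).2)]⟩
    refine Fintype.card_le_of_injective Φ ?_
    rintro ⟨m, x⟩ ⟨m', x'⟩ h
    have hval : ∀ (p : {m : Matching V // ∀ j ∈ insert i s, m.1 (a j) = b j} × {x // x ∉ R}),
        (Φ p).1.1 (a i) = p.2.1 := by
      intro p
      change (Equiv.swap (b i) p.2.1 • p.1.1).1 (a i) = p.2.1
      rw [swap_smul_val, Equiv.swap_apply_of_ne_of_ne (hne i) (hneR _ _ (hmem i).1),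
        p.1.2 i (Finset.mem_insert_self _ _), Equiv.swap_apply_left]
    have hx : x = x' := by
      have h1 := hval (m, x)
      rw [h, hval (m', x')] at h1
      exact Subtype.ext h1.symm
    subst hx
    have h2 : Equiv.swap (b i) x.1 • m.1 = Equiv.swap (b i) x.1 • m'.1 := congrArg Subtype.val h
    have h3 : m = m' := Subtype.ext (MulAction.injective _ h2)
    rw [h3]

end Matching

/-- The graph of a matching of the half-edges. -/
def cfgGraph {n d : ℕ} (m : Matching (Fin n × Fin d)) : SimpleGraph (Fin n) where
  Adj v w := v ≠ w ∧ ∃ i, (m.1 (v, i)).1 = w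
  symm := ⟨by
    rintro v w ⟨hvw, i, rfl⟩
    exact ⟨hvw.symm, (m.1 (v, i)).2, by rw [Prod.mk.eta, m.2.1]⟩⟩
  loopless := ⟨fun v h => h.1 rfl⟩

lemma cfgGraph_degree_le {n d : ℕ} (m : Matching (Fin n × Fin d)) (v : Fin n) :
    ((cfgGraph m).neighborSet v).ncard ≤ d := by
  have hsub : (cfgGraph m).neighborSet v ⊆ Set.range fun i : Fin d => (m.1 (v, i)).1 := by
    rintro w ⟨-, i, rfl⟩; exact ⟨i, rfl⟩
  refine (Set.ncard_le_ncard hsub (Set.toFinite _)).trans ?_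
  rw [← Set.image_univ]
  refine (Set.ncard_image_le (Set.toFinite _)).trans ?_
  simp [Set.ncard_univ]

/-- A graph functional which changes by at most `c` when the edges inside a set of at most four
vertices are modified, among graphs of maximal degree at most `d`. -/
def LocLipschitz (d : ℕ) {n : ℕ} (c : ℝ) (F : SimpleGraph (Fin n) → ℝ) : Prop :=
  ∀ (G G' : SimpleGraph (Fin n)) (D : Finset (Fin n)), D.card ≤ 4 →
    (∀ v, (G.neighborSet v).ncard ≤ d) → (∀ v, (G'.neighborSet v).ncard ≤ d) →
    (∀ v w, v ∉ D → (G.Adj v w ↔ G'.Adj v w)) → |F G - F G'| ≤ c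

lemma LocLipschitz.swap_smul {n d : ℕ} {c : ℝ} {F : SimpleGraph (Fin n) → ℝ}
    (hF : LocLipschitz d c F) (m : Matching (Fin n × Fin d)) (a b : Fin n × Fin d) :
    |F (cfgGraph (Equiv.swap a b • m)) - F (cfgGraph m)| ≤ c := by
  refine hF _ _ {a.1, b.1, (m.1 a).1, (m.1 b).1} Finset.card_le_four (cfgGraph_degree_le _)
    (cfgGraph_degree_le _) ?_
  intro v w hv
  simp only [Finset.mem_insert, Finset.mem_singleton, not_or] at hv
  have key : ∀ i, (Equiv.swap a b • m).1 (v, i) = m.1 (v, i) := by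
    intro i
    have h1 : Equiv.swap a b (v, i) = (v, i) :=
      Equiv.swap_apply_of_ne_of_ne (fun h => hv.1 (by rw [← h])) (fun h => hv.2.1 (by rw [← h]))
    rw [Matching.swap_smul_val, h1, Equiv.swap_apply_of_ne_of_ne]
    · intro h; exact hv.2.2.1 (by rw [← h, m.2.1])
    · intro h; exact hv.2.2.2 (by rw [← h, m.2.1])
  simp only [cfgGraph, key]

/-- A half-edge is bad if it belongs to a loop or to a multiple edge. -/
def IsBad {n d : ℕ} (m : Matching (Fin n × Fin d)) (a : Fin n × Fin d) : Prop :=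
  (m.1 a).1 = a.1 ∨ ∃ b, b ≠ a ∧ b.1 = a.1 ∧ (m.1 b).1 = (m.1 a).1

def badSet {n d : ℕ} (m : Matching (Fin n × Fin d)) : Finset (Fin n × Fin d) :=
  Finset.univ.filter (IsBad m)

lemma IsBad.apply {n d : ℕ} {m : Matching (Fin n × Fin d)} {a : Fin n × Fin d}
    (h : IsBad m a) : IsBad m (m.1 a) := by
  rcases h with h | ⟨b, hb, h1, h2⟩
  · left; rw [m.2.1, h]
  · right
    exact ⟨m.1 b, fun h => hb (m.1.injective h), h2, by rw [m.2.1, m.2.1, h1]⟩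

lemma badSet_swap_smul_ssubset {n d : ℕ} (m : Matching (Fin n × Fin d)) (a c : Fin n × Fin d)
    (ha : IsBad m a) (hc : ¬ IsBad m c)
    (h1 : c.1 ≠ a.1 ∧ ¬ (cfgGraph m).Adj a.1 c.1)
    (h3 : (m.1 c).1 ≠ (m.1 a).1 ∧ ¬ (cfgGraph m).Adj (m.1 a).1 (m.1 c).1)
    (h2 : c.1 ≠ (m.1 a).1) (h4 : (m.1 c).1 ≠ a.1) :
    badSet (Equiv.swap (m.1 a) c • m) ⊂ badSet m := by
  set b := m.1 a with hb
  set e := m.1 c with he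
  have hmb : m.1 b = a := m.2.1 a
  have hme : m.1 e = c := m.2.1 c
  have hac : a ≠ c := fun h => h1.1 (by rw [h])
  have hab : a ≠ b := fun h => m.2.2 a h.symm
  have hce : c ≠ e := fun h => m.2.2 c h.symm
  have hbc : b ≠ c := fun h => h2 (by rw [h])
  have hae : a ≠ e := fun h => h4 (by rw [h])
  have hbe : b ≠ e := fun h => h3.1 (by rw [h])
  have hce1 : e.1 ≠ c.1 := fun h => hc (Or.inl h)
  set m' := Equiv.swap b c • m with hm'
  have ma : m'.1 a = c := by
    rw [hm', Matching.swap_smul_val, Equiv.swap_apply_of_ne_of_ne hab hac, ← hb,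
      Equiv.swap_apply_left]
  have mc : m'.1 c = a := by rw [← ma, m'.2.1]
  have mb : m'.1 b = e := by
    rw [hm', Matching.swap_smul_val, Equiv.swap_apply_left, ← he,
      Equiv.swap_apply_of_ne_of_ne hbe.symm hce.symm]
  have me : m'.1 e = b := by rw [← mb, m'.2.1]
  have mo : ∀ x, x ≠ a → x ≠ b → x ≠ c → x ≠ e → m'.1 x = m.1 x := by
    intro x xa xb xc xe
    rw [hm', Matching.swap_smul_val, Equiv.swap_apply_of_ne_of_ne xb xc,
      Equiv.swap_apply_of_ne_of_ne]
    · intro h; exact xa (by rw [← hmb, ← h, m.2.1])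
    · intro h; exact xe (by rw [he, ← h, m.2.1])
  have nadj : ∀ x y : Fin n × Fin d, y.1 ≠ x.1 → ¬ (cfgGraph m).Adj x.1 y.1 →
      ∀ z, z.1 = x.1 → (m.1 z).1 ≠ y.1 := by
    intro x y hne hn z hz h
    exact hn ⟨hne.symm, z.2, by rw [← hz, Prod.mk.eta, h]⟩
  have nba : ¬ IsBad m' a := by
    rintro (h | ⟨y, hy, hy1, hy2⟩)
    · rw [ma] at h; exact h1.1 h
    · rw [ma] at hy2
      by_cases yb : y = b
      · rw [yb, mb] at hy2; exact hce1 hy2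
      by_cases yc : y = c
      · rw [yc] at hy1; exact h1.1 hy1
      by_cases ye : y = e
      · rw [ye] at hy1; exact h4 hy1
      rw [mo y hy yb yc ye] at hy2
      exact nadj a c h1.1 h1.2 y hy1 hy2
  have nbb : ¬ IsBad m' b := by
    rintro (h | ⟨y, hy, hy1, hy2⟩)
    · rw [mb] at h; exact h3.1 h
    · rw [mb] at hy2
      by_cases ya : y = a
      · rw [ya, ma] at hy2; exact hce1 hy2.symm
      by_cases yc : y = c
      · rw [yc] at hy1; exact h2 hy1
      by_cases ye : y = e
      · rw [ye] at hy1; exact h3.1 hy1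
      rw [mo y ya hy yc ye] at hy2
      exact nadj b e h3.1 h3.2 y hy1 hy2
  have nbc : ¬ IsBad m' c := fun h => nba (mc ▸ h.apply)
  have nbe : ¬ IsBad m' e := fun h => nbb (me ▸ h.apply)
  have nb : ∀ y, IsBad m' y → m'.1 y = m.1 y := fun y hy =>
    mo y (fun h => nba (h ▸ hy)) (fun h => nbb (h ▸ hy)) (fun h => nbc (h ▸ hy))
      (fun h => nbe (h ▸ hy))
  rw [Finset.ssubset_iff_of_subset]
  · exact ⟨a, by simpa [badSet] using ha, by simpa [badSet] using nba⟩
  · intro x hx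
    simp only [badSet, Finset.mem_filter, Finset.mem_univ, true_and] at hx ⊢
    rcases hx with h | ⟨y, hy, hy1, hy2⟩
    · left; rw [← nb x (Or.inl h)]; exact h
    · right
      refine ⟨y, hy, hy1, ?_⟩
      rw [← nb x (Or.inr ⟨y, hy, hy1, hy2⟩), ← nb y (Or.inr ⟨x, hy.symm, hy1.symm, hy2.symm⟩)]
      exact hy2

lemma exists_swap_smul_badSet_card_lt {n d K : ℕ} (m : Matching (Fin n × Fin d))
    (hK : (badSet m).card ≤ K) (hn : K + 4 * (d + 1) * d < n * d) (h : (badSet m).Nonempty) :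
    ∃ x y : Fin n × Fin d, (badSet (Equiv.swap x y • m)).card < (badSet m).card := by
  obtain ⟨a, ha⟩ := h
  have ha' : IsBad m a := by simpa [badSet] using ha
  set nb : Fin n → Finset (Fin n) :=
    fun v => insert v (Set.toFinset ((cfgGraph m).neighborSet v)) with hnb
  have hnbc : ∀ v, (nb v).card ≤ d + 1 := by
    intro v
    refine (Finset.card_insert_le _ _).trans ?_
    have := cfgGraph_degree_le m v
    rw [Set.ncard_eq_toFinset_card'] at this
    omega
  set U : Finset (Fin n) := nb a.1 ∪ nb (m.1 a).1 with hU
  have hUc : U.card ≤ 2 * (d + 1) := by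
    refine (Finset.card_union_le _ _).trans ?_
    have := hnbc a.1
    have := hnbc (m.1 a).1
    omega
  set W : Finset (Fin n × Fin d) := U ×ˢ Finset.univ with hW
  have hWc : W.card ≤ 2 * (d + 1) * d := by
    rw [hW, Finset.card_product, Finset.card_univ, Fintype.card_fin]
    exact Nat.mul_le_mul_right _ hUc
  have hlt : (badSet m ∪ W ∪ W.image m.1).card < (Finset.univ : Finset (Fin n × Fin d)).card := by
    rw [Finset.card_univ, Fintype.card_prod, Fintype.card_fin, Fintype.card_fin]
    refine lt_of_le_of_lt ?_ hn
    have h1 := Finset.card_union_le (badSet m ∪ W) (W.image m.1)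
    have h2 := Finset.card_union_le (badSet m) W
    have h3 : (W.image m.1).card ≤ W.card := Finset.card_image_le
    have : 4 * (d + 1) * d = 2 * (d + 1) * d + 2 * (d + 1) * d := by ring
    omega
  obtain ⟨c, -, hc⟩ := Finset.exists_mem_notMem_of_card_lt_card hlt
  simp only [Finset.mem_union, not_or] at hc
  obtain ⟨⟨hcb, hcW⟩, hcW'⟩ := hc
  have hcb' : ¬ IsBad m c := by simpa [badSet] using hcb
  have hcU : c.1 ∉ U := fun h => hcW (by simp [hW, h])
  have hcU' : (m.1 c).1 ∉ U := fun h => hcW' (by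
    refine Finset.mem_image.mpr ⟨m.1 c, by simp [hW, h], m.2.1 c⟩)
  simp only [hU, hnb, Finset.mem_union, Finset.mem_insert, Set.mem_toFinset,
    SimpleGraph.mem_neighborSet, not_or] at hcU hcU'
  exact ⟨_, _, Finset.card_lt_card (badSet_swap_smul_ssubset m a c ha' hcb' hcU.1 hcU'.2
    hcU.2.1 hcU'.1.1)⟩

lemma card_badSet_le_card_simple {n d K : ℕ} (hd : 0 < d)
    (hn : K + 4 * (d + 1) * d < n * d) :
    Fintype.card {m : Matching (Fin n × Fin d) // (badSet m).card ≤ K} ≤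
      ((n * d) ^ 2) ^ K * Fintype.card {m : Matching (Fin n × Fin d) // badSet m = ∅} := by
  have key : ∀ j ≤ K, Fintype.card {m : Matching (Fin n × Fin d) // (badSet m).card ≤ j} ≤
      ((n * d) ^ 2) ^ j * Fintype.card {m : Matching (Fin n × Fin d) // badSet m = ∅} := by
    intro j
    induction j with
    | zero =>
      intro _
      simp only [Nat.le_zero, Finset.card_eq_zero, pow_zero, one_mul]
      exact le_rfl
    | succ j ih =>
      intro hj
      have ih' := ih (by omega)
      rw [pow_succ', mul_assoc]
      refine le_trans ?_ (Nat.mul_le_mul_left _ ih')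
      have hcard : (n * d) ^ 2 * Fintype.card {m : Matching (Fin n × Fin d) // (badSet m).card ≤ j}
          = Fintype.card (((Fin n × Fin d) × (Fin n × Fin d)) ×
              {m : Matching (Fin n × Fin d) // (badSet m).card ≤ j}) := by
        simp [pow_two]
      rw [hcard]
      have hne : Nonempty (Fin n × Fin d) := by
        rw [← Fintype.card_pos_iff]; simp; constructor
        · rcases Nat.eq_zero_or_pos n with h | h
          · subst h; omega
          · exact h
        · exact hd
      obtain ⟨z⟩ := hne
      have hex : ∀ m : {m : Matching (Fin n × Fin d) // (badSet m).card ≤ j + 1},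
          ∃ q : ((Fin n × Fin d) × (Fin n × Fin d)) ×
              {m : Matching (Fin n × Fin d) // (badSet m).card ≤ j},
            Equiv.swap q.1.1 q.1.2 • q.2.1 = m.1 := by
        rintro ⟨m, hm⟩
        by_cases h0 : (badSet m).card ≤ j
        · exact ⟨⟨(z, z), ⟨m, h0⟩⟩, by rw [Equiv.swap_self]; exact one_smul _ m⟩
        · obtain ⟨x, y, hxy⟩ := exists_swap_smul_badSet_card_lt m (hm.trans hj) hn
            (Finset.card_pos.mp (by omega))
          refine ⟨⟨(x, y), ⟨Equiv.swap x y • m, by omega⟩⟩, ?_⟩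
          simp [smul_smul]
      choose q hq using hex
      refine Fintype.card_le_of_injective q ?_
      intro m m' h
      exact Subtype.ext (by rw [← hq m, ← hq m', h])
  exact key K le_rfl

/-- Cyclic sequences of `k + 1` disjoint edges of a matching, consecutive edges sharing a
vertex. -/
def IsEdgeCycle {n d k : ℕ} (c : Fin (k + 1) → (Fin n × Fin d) × (Fin n × Fin d)) : Prop :=
  Function.Injective (Sum.elim (fun i => (c i).1) (fun i => (c i).2)) ∧
    ∀ i, (c i).2.1 = (c (i + 1)).1.1

def edgeCycles {n d : ℕ} (k : ℕ) (m : Matching (Fin n × Fin d)) :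
    Finset (Fin (k + 1) → (Fin n × Fin d) × (Fin n × Fin d)) :=
  Finset.univ.filter fun c => IsEdgeCycle c ∧ ∀ i, m.1 (c i).1 = (c i).2

lemma card_isEdgeCycle_le (n d k : ℕ) :
    Fintype.card {c : Fin (k + 1) → (Fin n × Fin d) × (Fin n × Fin d) // IsEdgeCycle c} ≤
      (n * d * d) ^ (k + 1) := by
  have h : (n * d * d) ^ (k + 1) = Fintype.card (Fin (k + 1) → (Fin n × Fin d) × Fin d) := by
    simp
  rw [h]
  refine Fintype.card_le_of_injective (fun c i => ((c.1 i).1, (c.1 i).2.2)) ?_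
  intro c c' hcc
  have h1 : ∀ i, (c.1 i).1 = (c'.1 i).1 ∧ (c.1 i).2.2 = (c'.1 i).2.2 := fun i => by
    simpa using congrFun hcc i
  refine Subtype.ext (funext fun i => Prod.ext (h1 i).1 (Prod.ext ?_ (h1 i).2))
  rw [c.2.2 i, c'.2.2 i, (h1 (i + 1)).1]

lemma sum_card_edgeCycles_le {n d k : ℕ} (hn : 4 * (k + 1) ≤ n * d) :
    ∑ m : Matching (Fin n × Fin d), (edgeCycles k m).card ≤
      (2 * d) ^ (k + 1) * Fintype.card (Matching (Fin n × Fin d)) := by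
  set N' := n * d - 2 * (k + 1) with hN'
  have hpos : 0 < N' ^ (k + 1) := by
    have : 0 < N' := by omega
    positivity
  have h1 : ∑ m : Matching (Fin n × Fin d), (edgeCycles k m).card
      = ∑ c : {c : Fin (k + 1) → (Fin n × Fin d) × (Fin n × Fin d) // IsEdgeCycle c},
        Fintype.card {m : Matching (Fin n × Fin d) // ∀ i ∈ Finset.univ,
          m.1 (c.1 i).1 = (c.1 i).2} := by
    have : ∀ m : Matching (Fin n × Fin d), (edgeCycles k m).card =
        ∑ c : {c : Fin (k + 1) → (Fin n × Fin d) × (Fin n × Fin d) // IsEdgeCycle c},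
          if ∀ i, m.1 (c.1 i).1 = (c.1 i).2 then 1 else 0 := by
      intro m
      rw [edgeCycles, ← Finset.filter_filter, Finset.card_filter,
        ← Finset.sum_subtype_eq_sum_filter, Finset.subtype_univ]
    simp only [this]
    rw [Finset.sum_comm]
    refine Finset.sum_congr rfl fun c _ => ?_
    rw [← Finset.card_filter, Fintype.card_subtype]
    simp
  refine Nat.le_of_mul_le_mul_right ?_ hpos
  rw [h1, Finset.sum_mul]
  calc _ ≤ ∑ c : {c : Fin (k + 1) → (Fin n × Fin d) × (Fin n × Fin d) // IsEdgeCycle c},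
        Fintype.card (Matching (Fin n × Fin d)) := by
        refine Finset.sum_le_sum fun c _ => ?_
        have := Matching.card_prescribed_le (fun i => (c.1 i).1) (fun i => (c.1 i).2) c.2.1
          Finset.univ
        simpa using this
    _ = Fintype.card {c : Fin (k + 1) → (Fin n × Fin d) × (Fin n × Fin d) // IsEdgeCycle c}
        * Fintype.card (Matching (Fin n × Fin d)) := by simp
    _ ≤ (n * d * d) ^ (k + 1) * Fintype.card (Matching (Fin n × Fin d)) :=
        Nat.mul_le_mul_right _ (card_isEdgeCycle_le n d k)
    _ ≤ ((2 * d) * N') ^ (k + 1) * Fintype.card (Matching (Fin n × Fin d)) := by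
        refine Nat.mul_le_mul_right _ (Nat.pow_le_pow_left ?_ _)
        have : n * d ≤ 2 * N' := by omega
        calc n * d * d ≤ 2 * N' * d := Nat.mul_le_mul_right _ this
          _ = _ := by ring
    _ = _ := by rw [mul_pow (2 * d) N']; ring

lemma mem_edgeCycles {n d k : ℕ} {m : Matching (Fin n × Fin d)}
    {c : Fin (k + 1) → (Fin n × Fin d) × (Fin n × Fin d)} :
    c ∈ edgeCycles k m ↔ IsEdgeCycle c ∧ ∀ i, m.1 (c i).1 = (c i).2 := by
  simp [edgeCycles]

lemma card_badSet_le {n d : ℕ} (m : Matching (Fin n × Fin d)) :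
    (badSet m).card ≤ (edgeCycles 0 m).card + (edgeCycles 1 m).card := by
  have h1 : ((badSet m).filter fun a => (m.1 a).1 = a.1).card ≤ (edgeCycles 0 m).card := by
    refine Finset.card_le_card_of_surjOn (fun c => (c 0).1) ?_
    intro a ha
    rw [Finset.mem_coe, Finset.mem_filter] at ha
    refine ⟨fun _ => (a, m.1 a), ?_, rfl⟩
    rw [Finset.mem_coe, mem_edgeCycles]
    refine ⟨⟨?_, fun _ => ha.2⟩, fun _ => rfl⟩
    rintro (i | i) (j | j) h
    · rw [Subsingleton.elim (α := Fin 1) i j]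
    · exact absurd h.symm (m.2.2 a)
    · exact absurd h (m.2.2 a)
    · rw [Subsingleton.elim (α := Fin 1) i j]
  have h2 : ((badSet m).filter fun a => ¬ (m.1 a).1 = a.1).card ≤ (edgeCycles 1 m).card := by
    refine Finset.card_le_card_of_surjOn (fun c => (c 0).1) ?_
    intro a ha
    simp only [badSet, Finset.mem_coe, Finset.mem_filter, Finset.mem_univ, true_and] at ha
    obtain ⟨b, hb⟩ := ha.1.resolve_left ha.2
    refine ⟨![(a, m.1 a), (m.1 b, b)], ?_, rfl⟩
    rw [Finset.mem_coe, mem_edgeCycles]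
    have e1 : m.1 a ≠ a := m.2.2 a
    have e2 : m.1 b ≠ b := m.2.2 _
    have e3 : m.1 b ≠ m.1 a := fun h => hb.1 (m.1.injective h)
    have e4 : b ≠ m.1 a := fun h => ha.2 (by rw [← h, hb.2.1])
    have e5 : m.1 b ≠ a := fun h => e4 (by rw [← h, m.2.1])
    refine ⟨⟨?_, ?_⟩, ?_⟩
    · have hb1 := hb.1
      clear ha hb
      rintro (i | i) (j | j) h <;> fin_cases i <;> fin_cases j <;>
        simp_all [eq_comm]
    · intro i; fin_cases i
      · exact hb.2.2.symm
      · exact hb.2.1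
    · intro i; fin_cases i
      · rfl
      · exact m.2.1 _
  have h3 := Finset.card_filter_add_card_filter_not (s := badSet m) (fun a => (m.1 a).1 = a.1)
  omega

/-- The number of injective closed walks of length `k + 1`. -/
def cycCount {n : ℕ} (k : ℕ) (G : SimpleGraph (Fin n)) : ℕ :=
  Fintype.card {e : Fin (k + 1) → Fin n //
    Function.Injective e ∧ ∀ i, G.Adj (e i) (e (i + 1))}

lemma cycCount_cfgGraph_le {n d k : ℕ} (hk : 2 ≤ k) (m : Matching (Fin n × Fin d)) :
    cycCount k (cfgGraph m) ≤ (edgeCycles k m).card := by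
  rw [cycCount, Fintype.card_subtype]
  refine Finset.card_le_card_of_surjOn (fun c i => (c i).1.1) ?_
  intro e he
  simp only [Finset.mem_coe, Finset.mem_filter, Finset.mem_univ, true_and] at he
  obtain ⟨hinj, hadj⟩ := he
  choose x hx using fun i => (hadj i).2
  refine ⟨fun i => ((e i, x i), m.1 (e i, x i)), ?_, rfl⟩
  rw [Finset.mem_coe, mem_edgeCycles]
  have h2 : ∀ i : Fin (k + 1), i + 1 + 1 ≠ i := by
    intro i h
    rw [add_assoc, add_eq_left, Fin.ext_iff, Fin.val_add] at h
    have h1 : ((1 : Fin (k + 1)) : ℕ) = 1 := by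
      rw [Fin.val_one', Nat.mod_eq_of_lt (by omega)]
    rw [h1, Nat.mod_eq_of_lt (by omega)] at h
    simp at h
  have hcross : ∀ i j, (e i, x i) ≠ m.1 (e j, x j) := by
    intro i j h
    have hi : e i = e (j + 1) := by rw [← hx j, ← h]
    have hij := hinj hi
    have hj : e j = e (i + 1) := by rw [← hx i, h, m.2.1]
    have hji := hinj hj
    exact h2 j (by rw [← hij, ← hji])
  refine ⟨⟨?_, fun i => hx i⟩, fun _ => rfl⟩
  rintro (i | i) (j | j) h
  · rw [hinj (Prod.mk.inj h).1]
  · exact absurd h (hcross _ _)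
  · exact absurd h.symm (hcross _ _)
  · rw [hinj (Prod.mk.inj (m.1.injective h)).1]

/-! ### Simple matchings and regular graphs -/

lemma cfgGraph_mem_regularGraphs {n d : ℕ} {m : Matching (Fin n × Fin d)} (hm : badSet m = ∅) :
    cfgGraph m ∈ regularGraphs d n := by
  have hb : ∀ a, ¬ IsBad m a := fun a ha => by
    have : a ∈ badSet m := by simpa [badSet] using ha
    simp [hm] at this
  intro v
  have hset : (cfgGraph m).neighborSet v = Set.range fun i : Fin d => (m.1 (v, i)).1 := by
    ext w
    constructor
    · rintro ⟨-, i, rfl⟩; exact ⟨i, rfl⟩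
    · rintro ⟨i, rfl⟩
      exact ⟨fun h => hb (v, i) (Or.inl h.symm), i, rfl⟩
  have hinj : Function.Injective fun i : Fin d => (m.1 (v, i)).1 := by
    intro i j hij
    by_contra hne
    exact hb (v, j) (Or.inr ⟨(v, i), fun h => hne (Prod.mk.inj h).2, rfl, hij⟩)
  rw [hset, ← Set.image_univ, Set.ncard_image_of_injective _ hinj]
  simp [Set.ncard_univ]

/-- Each simple regular graph comes from the same number of matchings. -/
lemma card_fiber_cfgGraph {n d : ℕ} {G : SimpleGraph (Fin n)} (hG : G ∈ regularGraphs d n) :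
    Fintype.card {m : Matching (Fin n × Fin d) // badSet m = ∅ ∧ cfgGraph m = G} =
      d.factorial ^ n := by
  have hcard : ∀ v, Fintype.card (Fin d ≃ G.neighborSet v) = d.factorial := by
    intro v
    have : Fintype.card (G.neighborSet v) = d := by
      rw [← Nat.card_eq_fintype_card, Nat.card_coe_set_eq]; exact hG v
    have e : Fin d ≃ G.neighborSet v := Fintype.equivOfCardEq (by simp [this])
    rw [Fintype.card_equiv e, Fintype.card_fin]
  have hpi : Fintype.card (∀ v, Fin d ≃ G.neighborSet v) = d.factorial ^ n := by
    rw [Fintype.card_pi]; simp [hcard]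
  rw [← hpi]
  let Φ : (∀ v, Fin d ≃ G.neighborSet v) → Equiv.Perm (Fin n × Fin d) := fun ρ =>
    Function.Involutive.toPerm
      (fun a => (((ρ a.1 a.2 : G.neighborSet a.1) : Fin n),
        (ρ (ρ a.1 a.2 : G.neighborSet a.1)).symm ⟨a.1, (ρ a.1 a.2).2.symm⟩)) (by
      rintro ⟨v, i⟩
      have haux : ∀ (hv : v ∈ G.neighborSet (ρ v i)) (y : G.neighborSet (ρ v i : Fin n)),
          y = ⟨v, hv⟩ →
          ((y : Fin n), (ρ y).symm ⟨(ρ v i : Fin n), y.2.symm⟩) = (v, i) := by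
        rintro hv _ rfl
        exact Prod.ext rfl ((ρ v).symm_apply_apply i)
      exact haux (ρ v i).2.symm _ (Equiv.apply_symm_apply _ _))
  have hΦ1 : ∀ ρ v i, (Φ ρ (v, i)).1 = (ρ v i : Fin n) := fun ρ v i => rfl
  have hb : ∀ m : Matching (Fin n × Fin d), badSet m = ∅ → ∀ a, ¬ IsBad m a := fun m hm a ha => by
    have : a ∈ badSet m := by simpa [badSet] using ha
    simp [hm] at this
  symm
  refine Fintype.card_of_bijective (f := fun ρ => ⟨⟨Φ ρ, ?_, ?_⟩, ?_, ?_⟩) ⟨?_, ?_⟩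
  · exact Function.Involutive.toPerm_involutive _
  · intro a h
    have h1 : (ρ a.1 a.2 : Fin n) = a.1 := congrArg Prod.fst h
    exact (ρ a.1 a.2).2.ne h1.symm
  · rw [badSet, Finset.filter_eq_empty_iff]
    rintro ⟨v, i⟩ - (h | ⟨⟨w, j⟩, hne, h1, h2⟩)
    · exact (ρ v i).2.ne (Eq.symm h)
    · simp only at h1
      subst h1
      have h3 : (ρ w j : Fin n) = ρ w i := h2
      exact hne (by rw [(ρ w).injective (Subtype.ext h3)])
  · ext v w
    constructor
    · rintro ⟨-, i, h⟩
      have : (ρ v i : Fin n) = w := h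
      rw [← this]; exact (ρ v i).2
    · intro h
      refine ⟨h.ne, (ρ v).symm ⟨w, h⟩, ?_⟩
      change ((ρ v ((ρ v).symm ⟨w, h⟩) : G.neighborSet v) : Fin n) = w
      simp
  · intro ρ ρ' h
    funext v
    ext i
    have h1 : Φ ρ = Φ ρ' := congrArg (fun q => q.1.1) h
    rw [← hΦ1, ← hΦ1, h1]
  · rintro ⟨m, hm, rfl⟩
    have hmem : ∀ v i, (m.1 (v, i)).1 ∈ (cfgGraph m).neighborSet v := fun v i =>
      ⟨fun h => hb m hm (v, i) (Or.inl h.symm), i, rfl⟩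
    have hbij : ∀ v, Function.Bijective
        (fun i : Fin d => (⟨(m.1 (v, i)).1, hmem v i⟩ : (cfgGraph m).neighborSet v)) := by
      intro v
      constructor
      · intro i j hij
        by_contra hne
        exact hb m hm (v, j) (Or.inr ⟨(v, i), fun h => hne (Prod.mk.inj h).2, rfl,
          congrArg Subtype.val hij⟩)
      · rintro ⟨w, -, i, rfl⟩
        exact ⟨i, rfl⟩
    refine ⟨fun v => Equiv.ofBijective _ (hbij v), ?_⟩
    refine Subtype.ext (Subtype.ext (Equiv.ext ?_))
    rintro ⟨v, i⟩
    refine Prod.ext rfl ?_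
    change (Equiv.ofBijective _ (hbij (m.1 (v, i)).1)).symm ⟨v, _⟩ = (m.1 (v, i)).2
    rw [Equiv.symm_apply_eq]
    refine Subtype.ext ?_
    change v = (m.1 ((m.1 (v, i)).1, (m.1 (v, i)).2)).1
    rw [Prod.mk.eta, m.2.1]

lemma card_simple_mem {n d : ℕ} (A : Set (SimpleGraph (Fin n))) :
    Fintype.card {m : Matching (Fin n × Fin d) // badSet m = ∅ ∧ cfgGraph m ∈ A} =
      d.factorial ^ n * (regularGraphs d n ∩ A).ncard := by
  rw [Set.ncard_eq_toFinset_card', Fintype.card_subtype, mul_comm, ← smul_eq_mul,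
    ← Finset.sum_const]
  rw [Finset.card_eq_sum_card_fiberwise (f := cfgGraph) (t := (regularGraphs d n ∩ A).toFinset)]
  · refine Finset.sum_congr rfl fun G hG => ?_
    rw [Set.mem_toFinset] at hG
    rw [← card_fiber_cfgGraph hG.1, Fintype.card_subtype, Finset.filter_filter]
    congr 1
    ext m
    simp only [Finset.mem_filter, Finset.mem_univ, true_and]
    constructor
    · rintro ⟨⟨h1, -⟩, h3⟩; exact ⟨h1, h3⟩
    · rintro ⟨h1, rfl⟩; exact ⟨⟨h1, hG.2⟩, rfl⟩
  · intro m hm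
    simp only [Finset.coe_filter, Finset.mem_univ, true_and] at hm
    rw [Finset.mem_coe, Set.mem_toFinset]
    exact ⟨cfgGraph_mem_regularGraphs hm.1, hm.2⟩

/-- The polynomial exponent in the comparison between regular graphs and matchings. -/
def switchDepth (d : ℕ) : ℕ := 2 * (2 * d + (2 * d) ^ 2)

lemma card_matching_le {n d : ℕ} (hd : 0 < d)
    (hn : switchDepth d + 4 * (d + 1) * d < n * d) :
    Fintype.card (Matching (Fin n × Fin d)) ≤ 2 * (((n * d) ^ 2) ^ switchDepth d *
      Fintype.card {m : Matching (Fin n × Fin d) // badSet m = ∅}) := by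
  set K := switchDepth d with hK
  set T := Fintype.card (Matching (Fin n × Fin d)) with hT
  have h8 : 8 ≤ n * d := by
    have : 1 ≤ d := hd
    nlinarith
  have h0 := sum_card_edgeCycles_le (n := n) (d := d) (k := 0) (by omega)
  have h1 := sum_card_edgeCycles_le (n := n) (d := d) (k := 1) (by omega)
  have hsum : ∑ m : Matching (Fin n × Fin d), (badSet m).card ≤ (2 * d + (2 * d) ^ 2) * T := by
    calc _ ≤ ∑ m : Matching (Fin n × Fin d), ((edgeCycles 0 m).card + (edgeCycles 1 m).card) :=
          Finset.sum_le_sum fun m _ => card_badSet_le m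
      _ = _ := Finset.sum_add_distrib
      _ ≤ _ := by
        rw [add_mul]
        refine Nat.add_le_add ?_ h1
        simpa using h0
  have hmk : (Finset.univ.filter fun m : Matching (Fin n × Fin d) => ¬ (badSet m).card ≤ K).card
      * (K + 1) ≤ ∑ m : Matching (Fin n × Fin d), (badSet m).card := by
    rw [← smul_eq_mul, ← Finset.sum_const]
    refine (Finset.sum_le_sum fun m hm => ?_).trans
      (Finset.sum_le_sum_of_subset (Finset.filter_subset _ _))
    have := (Finset.mem_filter.mp hm).2
    omega
  have hsplit := Finset.card_filter_add_card_filter_not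
    (s := (Finset.univ : Finset (Matching (Fin n × Fin d)))) (fun m => (badSet m).card ≤ K)
  rw [Finset.card_univ, ← hT] at hsplit
  have hsw := card_badSet_le_card_simple (K := K) hd hn
  rw [Fintype.card_subtype] at hsw
  set x := (Finset.univ.filter fun m : Matching (Fin n × Fin d) => ¬ (badSet m).card ≤ K).card
  set y := (Finset.univ.filter fun m : Matching (Fin n × Fin d) => (badSet m).card ≤ K).card
  have h2K : K = 2 * (2 * d + (2 * d) ^ 2) := hK
  have hx : x * (K + 1) * 2 ≤ K * T := by
    calc x * (K + 1) * 2 ≤ ((2 * d + (2 * d) ^ 2) * T) * 2 :=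
          Nat.mul_le_mul_right _ (hmk.trans hsum)
      _ = K * T := by rw [h2K]; ring
  have hxT : x * 2 ≤ T := by
    have h3 : (x * 2) * (K + 1) ≤ T * (K + 1) := by nlinarith
    exact Nat.le_of_mul_le_mul_right h3 (Nat.succ_pos _)
  have hTy : T ≤ 2 * y := by omega
  exact hTy.trans (Nat.mul_le_mul_left _ hsw)

lemma nonempty_regularGraphs {n d : ℕ} (hd : 0 < d) (he : Even (n * d))
    (hn : switchDepth d + 4 * (d + 1) * d < n * d) : (regularGraphs d n).Nonempty := by
  have hne : Nonempty (Matching (Fin n × Fin d)) := Matching.nonempty_of_even (by simpa using he)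
  have h := card_matching_le hd hn
  have hpos : 0 < Fintype.card (Matching (Fin n × Fin d)) := Fintype.card_pos
  have h2 : 0 < Fintype.card {m : Matching (Fin n × Fin d) // badSet m = ∅} := by
    rcases Nat.eq_zero_or_pos (Fintype.card {m : Matching (Fin n × Fin d) // badSet m = ∅})
      with h0 | h0
    · rw [h0] at h; simp at h
    · exact h0
  obtain ⟨m, hm⟩ := Fintype.card_pos_iff.mp h2
  exact ⟨_, cfgGraph_mem_regularGraphs hm⟩

lemma PrG_le_card {n d : ℕ} (hd : 0 < d) (he : Even (n * d))
    (hn : switchDepth d + 4 * (d + 1) * d < n * d) (A : Set (SimpleGraph (Fin n))) :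
    PrG d n A ≤ 2 * ((n * d : ℝ) ^ 2) ^ switchDepth d *
      ((Finset.univ.filter fun m : Matching (Fin n × Fin d) => cfgGraph m ∈ A).card /
        Fintype.card (Matching (Fin n × Fin d))) := by
  have hne : Nonempty (Matching (Fin n × Fin d)) := Matching.nonempty_of_even (by simpa using he)
  have hreg := nonempty_regularGraphs hd he hn
  have hA := card_simple_mem (n := n) (d := d) A
  have hU := card_simple_mem (n := n) (d := d) Set.univ
  simp only [Set.mem_univ, and_true, Set.inter_univ] at hU
  have hf : (0 : ℝ) < (d.factorial : ℝ) ^ n := by positivity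
  have hR : (0 : ℝ) < (regularGraphs d n).ncard := by
    exact_mod_cast (Set.ncard_pos (Set.toFinite _)).mpr hreg
  have hT : (0 : ℝ) < Fintype.card (Matching (Fin n × Fin d)) := by
    exact_mod_cast Fintype.card_pos
  have h := card_matching_le hd hn
  rw [hU] at h
  have h' : (Fintype.card (Matching (Fin n × Fin d)) : ℝ) ≤
      2 * (((n * d : ℝ) ^ 2) ^ switchDepth d *
        ((d.factorial : ℝ) ^ n * (regularGraphs d n).ncard)) := by exact_mod_cast h
  have hle : (d.factorial : ℝ) ^ n * (regularGraphs d n ∩ A).ncard ≤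
      (Finset.univ.filter fun m : Matching (Fin n × Fin d) => cfgGraph m ∈ A).card := by
    have : d.factorial ^ n * (regularGraphs d n ∩ A).ncard ≤
      (Finset.univ.filter fun m : Matching (Fin n × Fin d) => cfgGraph m ∈ A).card := by
      rw [← hA, Fintype.card_subtype]
      exact Finset.card_le_card fun m hm => by
        simp only [Finset.mem_filter, Finset.mem_univ, true_and] at hm ⊢
        exact hm.2
    exact_mod_cast this
  rw [PrG, div_le_iff₀ hR]
  set a : ℝ := ((regularGraphs d n ∩ A).ncard : ℝ)
  set b : ℝ := ((regularGraphs d n).ncard : ℝ)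
  set T : ℝ := (Fintype.card (Matching (Fin n × Fin d)) : ℝ)
  set S : ℝ := ((Finset.univ.filter fun m : Matching (Fin n × Fin d) => cfgGraph m ∈ A).card : ℝ)
  set P : ℝ := ((n * d : ℝ) ^ 2) ^ switchDepth d
  set f : ℝ := (d.factorial : ℝ) ^ n
  have hS : 0 ≤ S := Nat.cast_nonneg _
  have h1 : f * a * T ≤ S * (2 * (P * (f * b))) :=
    mul_le_mul hle h' hT.le hS
  have h2 : a * (f * T) ≤ (2 * P * (S / T) * b) * (f * T) := by
    have : (2 * P * (S / T) * b) * (f * T) = S * (2 * (P * (f * b))) := by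
      field_simp
    rw [this]; linarith
  exact le_of_mul_le_mul_right h2 (mul_pos hf hT)

lemma eventually_goodFilter {d : ℕ} {P : ℕ → Prop} :
    (∀ᶠ n in goodFilter d, P n) ↔ ∃ n₀, ∀ n ≥ n₀, n ∈ goodN d → P n := by
  rw [goodFilter, eventually_inf_principal, eventually_atTop]

/-- Mean of a graph functional over the configuration model. -/
def cfgMean (d : ℕ) {n : ℕ} (F : SimpleGraph (Fin n) → ℝ) : ℝ :=
  (∑ m : Matching (Fin n × Fin d), F (cfgGraph m)) / Fintype.card (Matching (Fin n × Fin d))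

lemma tendsto_poly_mul_exp (A b : ℝ) (hb : 0 < b) (k : ℕ) :
    Tendsto (fun n : ℕ => A * (n : ℝ) ^ k * Real.exp (-(b * n))) atTop (𝓝 0) := by
  have h := (Real.tendsto_pow_mul_exp_neg_atTop_nhds_zero k).comp
    ((tendsto_natCast_atTop_atTop (R := ℝ)).const_mul_atTop hb)
  have h2 := h.const_mul (A / b ^ k)
  rw [mul_zero] at h2
  refine h2.congr fun n => ?_
  simp only [Function.comp]
  rw [mul_pow]
  field_simp

/-- Concentration of local functionals of random regular graphs. -/
theorem concentration_regular (d : ℕ) (hd : 0 < d) (C δ η : ℝ) (hC : 0 < C) (hδ : 0 < δ)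
    (hη : 0 < η) :
    ∀ᶠ n in goodFilter d, (regularGraphs d n).Nonempty ∧
      ∀ F : SimpleGraph (Fin n) → ℝ, LocLipschitz d (C / n) F →
        PrG d n {G | δ < |F G - cfgMean d F|} ≤ η := by
  have hd' : (0 : ℝ) < d := by exact_mod_cast hd
  have hlim := tendsto_poly_mul_exp (4 * ((d : ℝ) ^ 2) ^ switchDepth d)
    (δ ^ 2 / (8 * d * C ^ 2)) (by positivity) (2 * switchDepth d)
  have hev := (hlim.eventually_lt_const hη).and
    (eventually_gt_atTop (switchDepth d + 4 * (d + 1) * d))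
  have hev2 : ∀ᶠ n in goodFilter d, _ := hev.filter_mono inf_le_left
  refine (hev2.and (mem_inf_of_right (mem_principal_self _))).mono ?_
  rintro n ⟨⟨hlt, hn⟩, hgood⟩
  have hnpos : 0 < n := by omega
  have hn' : switchDepth d + 4 * (d + 1) * d < n * d :=
    lt_of_lt_of_le hn (Nat.le_mul_of_pos_right _ hd)
  have hnr : (0 : ℝ) < n := by exact_mod_cast hnpos
  have hev : Even (n * d) := hgood.2
  refine ⟨nonempty_regularGraphs hd hev hn', fun F hF => ?_⟩
  have hne : Nonempty (Matching (Fin n × Fin d)) := Matching.nonempty_of_even (by simpa using hev)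
  have hT : (0 : ℝ) < Fintype.card (Matching (Fin n × Fin d)) := by
    exact_mod_cast Fintype.card_pos
  refine (PrG_le_card hd hev hn' _).trans (le_trans ?_ hlt.le)
  have hc := card_deviation_le (V := Fin n × Fin d) (X := Matching (Fin n × Fin d)) (C / n) δ
    (by positivity) hδ (by simp; exact ⟨hnpos, hd⟩) (fun m => F (cfgGraph m))
    (fun m a b => hF.swap_smul m a b)
  have hfr : ((Finset.univ.filter fun m : Matching (Fin n × Fin d) =>
      cfgGraph m ∈ {G | δ < |F G - cfgMean d F|}).card : ℝ) /
        Fintype.card (Matching (Fin n × Fin d))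
      ≤ 2 * Real.exp (-(δ ^ 2 / (8 * d * C ^ 2) * n)) := by
    rw [div_le_iff₀ hT]
    have : δ ^ 2 / (8 * (Fintype.card (Fin n × Fin d) : ℝ) * (C / n) ^ 2)
        = δ ^ 2 / (8 * d * C ^ 2) * n := by
      rw [Fintype.card_prod, Fintype.card_fin, Fintype.card_fin]
      push_cast
      field_simp
    rw [this] at hc
    exact hc
  refine (mul_le_mul_of_nonneg_left hfr (by positivity)).trans_eq ?_
  rw [← pow_mul, mul_pow, ← pow_mul]; ring

/-! ### Counting homomorphisms -/

/-- Homomorphisms to `G` of the relation `E`, subject to a constraint `R` not depending on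
`G`. -/
def HomSet {T : Type*} {n : ℕ} (E : T → T → Prop) (R : (T → Fin n) → Prop)
    (G : SimpleGraph (Fin n)) : Set (T → Fin n) :=
  {e | (∀ s t, E s t → G.Adj (e s) (e t)) ∧ R e}

/-- Finite balls in a graph. -/
def ballF {n : ℕ} (G : SimpleGraph (Fin n)) (x : Fin n) : ℕ → Finset (Fin n)
  | 0 => {x}
  | k + 1 => (ballF G x k).biUnion fun y => insert y (Set.toFinset (G.neighborSet y))

lemma ballF_card_le {n d : ℕ} {G : SimpleGraph (Fin n)}
    (hG : ∀ v, (G.neighborSet v).ncard ≤ d) (x : Fin n) (k : ℕ) :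
    (ballF G x k).card ≤ (d + 1) ^ k := by
  induction k with
  | zero => simp [ballF]
  | succ k ih =>
    rw [ballF, pow_succ]
    refine (Finset.card_biUnion_le_card_mul _ _ (d + 1) fun y _ => ?_).trans
      (Nat.mul_le_mul_right _ ih)
    refine (Finset.card_insert_le _ _).trans ?_
    have := hG y
    rw [Set.ncard_eq_toFinset_card'] at this
    omega

lemma ballF_subset_succ {n : ℕ} (G : SimpleGraph (Fin n)) (x : Fin n) (k : ℕ) :
    ballF G x k ⊆ ballF G x (k + 1) := fun y hy =>
  Finset.mem_biUnion.mpr ⟨y, hy, Finset.mem_insert_self _ _⟩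

lemma ballF_mono {n : ℕ} (G : SimpleGraph (Fin n)) (x : Fin n) : Monotone (ballF G x) :=
  monotone_nat_of_le_succ (ballF_subset_succ G x)

lemma ballF_adj {n : ℕ} {G : SimpleGraph (Fin n)} {x y z : Fin n} {k : ℕ}
    (hy : y ∈ ballF G x k) (h : G.Adj y z) : z ∈ ballF G x (k + 1) :=
  Finset.mem_biUnion.mpr ⟨y, hy, by simp [h]⟩

/-- The relation `E` is connected. -/
def RelConn {T : Type*} (E : T → T → Prop) : Prop :=
  ∀ s t, Relation.ReflTransGen (fun a b => E a b ∨ E b a) s t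

lemma RelConn.exists_radius {T : Type*} [Finite T] {E : T → T → Prop} (hE : RelConn E) :
    ∃ k, ∀ (n : ℕ) (G : SimpleGraph (Fin n)) (e : T → Fin n),
      (∀ s t, E s t → G.Adj (e s) (e t)) → ∀ s t, e t ∈ ballF G (e s) k := by
  have h1 : ∀ p : T × T, ∃ k, ∀ (n : ℕ) (G : SimpleGraph (Fin n)) (e : T → Fin n),
      (∀ s t, E s t → G.Adj (e s) (e t)) → e p.2 ∈ ballF G (e p.1) k := by
    rintro ⟨s, t⟩
    induction hE s t with
    | refl => exact ⟨0, fun n G e _ => by simp [ballF]⟩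
    | tail _ hbc ih =>
      obtain ⟨k, hk⟩ := ih
      refine ⟨k + 1, fun n G e he => ballF_adj (hk n G e he) ?_⟩
      rcases hbc with h | h
      · exact he _ _ h
      · exact (he _ _ h).symm
  choose k hk using h1
  obtain ⟨K, hK⟩ := (Set.finite_range k).bddAbove
  exact ⟨K, fun n G e he s t => ballF_mono G _ (hK ⟨(s, t), rfl⟩) (hk (s, t) n G e he)⟩

/-- The number of homomorphic copies of a fixed connected relation is a local functional. -/
lemma exists_locLipschitz_homSet {T : Type*} [Fintype T] {E : T → T → Prop} (hE : RelConn E)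
    (d : ℕ) : ∃ C : ℝ, 0 < C ∧ ∀ (n : ℕ) (R : (T → Fin n) → Prop),
      LocLipschitz d C fun G => ((HomSet E R G).ncard : ℝ) := by
  obtain ⟨k, hk⟩ := hE.exists_radius
  set C₀ : ℕ := Fintype.card T * 4 * ((d + 1) ^ k) ^ Fintype.card T with hC₀
  refine ⟨C₀ + 1, by positivity, ?_⟩
  intro n R
  have touch : ∀ (G : SimpleGraph (Fin n)) (D : Finset (Fin n)), D.card ≤ 4 →
      (∀ v, (G.neighborSet v).ncard ≤ d) →
      {e ∈ HomSet E R G | ∃ t, e t ∈ D}.ncard ≤ C₀ := by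
    intro G D hD hG
    have hsub : {e ∈ HomSet E R G | ∃ t, e t ∈ D} ⊆
        ↑((Finset.univ ×ˢ D : Finset (T × Fin n)).biUnion fun p =>
          Fintype.piFinset fun _ : T => ballF G p.2 k) := by
      rintro e ⟨he, t, ht⟩
      rw [Finset.mem_coe, Finset.mem_biUnion]
      refine ⟨(t, e t), by simp [ht], ?_⟩
      rw [Fintype.mem_piFinset]
      exact fun s => hk n G e he.1 t s
    refine (Set.ncard_le_ncard hsub (Finset.finite_toSet _)).trans ?_
    rw [Set.ncard_coe_finset]
    refine (Finset.card_biUnion_le_card_mul _ _ (((d + 1) ^ k) ^ Fintype.card T)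
      fun p _ => ?_).trans ?_
    · rw [Fintype.card_piFinset, Finset.prod_const, Finset.card_univ]
      exact Nat.pow_le_pow_left (ballF_card_le hG _ _) _
    · rw [hC₀, Finset.card_product, Finset.card_univ]
      exact Nat.mul_le_mul_right _ (Nat.mul_le_mul_left _ hD)
  have one : ∀ (G G' : SimpleGraph (Fin n)) (D : Finset (Fin n)), D.card ≤ 4 →
      (∀ v, (G.neighborSet v).ncard ≤ d) →
      (∀ v w, v ∉ D → (G.Adj v w ↔ G'.Adj v w)) →
      (HomSet E R G).ncard ≤ (HomSet E R G').ncard + C₀ := by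
    intro G G' D hD hG hGG
    have hsub : HomSet E R G ⊆ HomSet E R G' ∪ {e ∈ HomSet E R G | ∃ t, e t ∈ D} := by
      intro e he
      by_cases ht : ∃ t, e t ∈ D
      · exact Or.inr ⟨he, ht⟩
      · rw [not_exists] at ht
        exact Or.inl ⟨fun s t hst => (hGG _ _ (ht s)).mp (he.1 s t hst), he.2⟩
    refine (Set.ncard_le_ncard hsub (Set.toFinite _)).trans ?_
    exact (Set.ncard_union_le _ _).trans (Nat.add_le_add_left (touch G D hD hG) _)
  intro G G' D hD hG hG' hGG
  have h1 := one G G' D hD hG hGG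
  have h2 := one G' G D hD hG' fun v w hv => (hGG v w hv).symm
  have h1' : ((HomSet E R G).ncard : ℝ) ≤ (HomSet E R G').ncard + C₀ := by exact_mod_cast h1
  have h2' : ((HomSet E R G').ncard : ℝ) ≤ (HomSet E R G).ncard + C₀ := by exact_mod_cast h2
  rw [abs_le]
  constructor <;> linarith

lemma LocLipschitz.mul_const {d n : ℕ} {c a : ℝ} {F : SimpleGraph (Fin n) → ℝ}
    (hF : LocLipschitz d c F) (ha : 0 ≤ a) : LocLipschitz d (c * a) fun G => F G * a := by
  intro G G' D hD hG hG' h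
  rw [← sub_mul, abs_mul, abs_of_nonneg ha]
  exact mul_le_mul_of_nonneg_right (hF G G' D hD hG hG' h) ha

lemma LocLipschitz.mono {d n : ℕ} {c c' : ℝ} {F : SimpleGraph (Fin n) → ℝ}
    (hF : LocLipschitz d c F) (h : c ≤ c') : LocLipschitz d c' F :=
  fun G G' D hD hG hG' hGG => (hF G G' D hD hG hG' hGG).trans h

/-! ### Short cycles -/

/-- The number of injective closed walks of length between `3` and `L + 2`. -/
def shortCycles {n : ℕ} (L : ℕ) (G : SimpleGraph (Fin n)) : ℕ :=
  ∑ k ∈ Finset.range L, cycCount (k + 2) G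

lemma exists_locLipschitz_shortCycles (d L : ℕ) :
    ∃ C : ℝ, 0 < C ∧ ∀ n : ℕ, LocLipschitz d (n := n) C fun G => (shortCycles L G : ℝ) := by
  have hk : ∀ k : ℕ, ∃ C : ℝ, 0 < C ∧ ∀ n : ℕ,
      LocLipschitz d (n := n) C fun G => (cycCount (k + 2) G : ℝ) := by
    intro k
    have hrev : ∀ {s t : Fin (k + 2 + 1)}, Relation.ReflTransGen
        (fun a b : Fin (k + 2 + 1) => b = a + 1 ∨ a = b + 1) s t → Relation.ReflTransGen
        (fun a b : Fin (k + 2 + 1) => b = a + 1 ∨ a = b + 1) t s := fun h =>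
      by
      induction h with
      | refl => exact Relation.ReflTransGen.refl
      | tail _ hbc ih => exact ih.head hbc.symm
    have hconn : RelConn fun i j : Fin (k + 2 + 1) => j = i + 1 := by
      have h0 : ∀ j : Fin (k + 2 + 1), Relation.ReflTransGen
          (fun a b : Fin (k + 2 + 1) => b = a + 1 ∨ a = b + 1) 0 j := by
        intro j
        induction j using Fin.induction with
        | zero => exact Relation.ReflTransGen.refl
        | succ i ih =>
          refine ih.tail (Or.inl ?_)
          exact Fin.coeSucc_eq_succ.symm
      intro s t
      refine Relation.ReflTransGen.trans ?_ (h0 t)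
      exact hrev (h0 s)
    obtain ⟨C, hC, h⟩ := exists_locLipschitz_homSet hconn d
    refine ⟨C, hC, fun n => ?_⟩
    have := h n Function.Injective
    convert this using 3 with G
    rw [cycCount, ← Nat.card_eq_fintype_card, ← Nat.card_coe_set_eq]
    refine Nat.card_congr (Equiv.subtypeEquivRight fun e => ?_)
    constructor
    · rintro ⟨h1, h2⟩; exact ⟨by rintro s t rfl; exact h2 s, h1⟩
    · rintro ⟨h1, h2⟩; exact ⟨h2, fun i => h1 i _ rfl⟩
  choose C hC hL using hk
  refine ⟨∑ k ∈ Finset.range L, C k + 1, ?_, fun n => ?_⟩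
  · have : 0 ≤ ∑ k ∈ Finset.range L, C k := Finset.sum_nonneg fun k _ => (hC k).le
    linarith
  · intro G G' D hD hG hG' h
    simp only [shortCycles, Nat.cast_sum]
    rw [← Finset.sum_sub_distrib]
    refine (Finset.abs_sum_le_sum_abs _ _).trans ?_
    have := Finset.sum_le_sum fun k (_ : k ∈ Finset.range L) => hL k n G G' D hD hG hG' h
    simp only at this
    linarith

/-- Random regular graphs have few short cycles. -/
theorem shortCycles_rare (d : ℕ) (hd : 0 < d) (L : ℕ) (δ η : ℝ) (hδ : 0 < δ) (hη : 0 < η) :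
    ∀ᶠ n in goodFilter d, PrG d n {G | δ * n < shortCycles L G} ≤ η := by
  obtain ⟨C, hC, hLip⟩ := exists_locLipschitz_shortCycles d L
  set B : ℕ := ∑ k ∈ Finset.range L, (2 * d) ^ (k + 2 + 1) with hB
  have hev : ∀ᶠ n : ℕ in goodFilter d, 4 * (L + 2) < n ∧ (2 * B / δ : ℝ) < n :=
    ((eventually_gt_atTop _).and (tendsto_natCast_atTop_atTop.eventually_gt_atTop _)).filter_mono
      inf_le_left
  filter_upwards [concentration_regular d hd C (δ / 2) η hC (by positivity) hη, hev]
    with n hn hnL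
  have hnr : (0 : ℝ) < n := by
    have : 0 < n := by omega
    exact_mod_cast this
  have h1 := hn.2 (fun G => (shortCycles L G : ℝ) * (1 / n)) (by
    have := (hLip n).mul_const (a := 1 / (n : ℝ)) (by positivity)
    rwa [mul_one_div] at this)
  refine le_trans ?_ h1
  have hmean : cfgMean d (fun G : SimpleGraph (Fin n) =>
      (shortCycles L G : ℝ) * (1 / n)) ≤ B / n := by
    have hs : ∑ m : Matching (Fin n × Fin d), shortCycles L (cfgGraph m) ≤
        B * Fintype.card (Matching (Fin n × Fin d)) := by
      simp only [shortCycles]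
      rw [Finset.sum_comm, hB, Finset.sum_mul]
      refine Finset.sum_le_sum fun k hk => ?_
      refine le_trans (Finset.sum_le_sum fun m _ => cycCount_cfgGraph_le (by omega) m) ?_
      refine sum_card_edgeCycles_le ?_
      have := Finset.mem_range.mp hk
      nlinarith
    have hs' : ∑ m : Matching (Fin n × Fin d), (shortCycles L (cfgGraph m) : ℝ) ≤
        B * Fintype.card (Matching (Fin n × Fin d)) := by exact_mod_cast hs
    rw [cfgMean, ← Finset.sum_mul]
    refine div_le_of_le_mul₀ (Nat.cast_nonneg _) (by positivity) ?_
    calc _ ≤ (B * Fintype.card (Matching (Fin n × Fin d)) : ℝ) * (1 / n) :=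
          mul_le_mul_of_nonneg_right hs' (by positivity)
      _ = _ := by ring
  have hBn : (B : ℝ) / n < δ / 2 := by
    rw [div_lt_iff₀ hnr]
    have := hnL.2
    rw [div_lt_iff₀ hδ] at this
    linarith
  rw [PrG, PrG]
  refine div_le_div_of_nonneg_right ?_ (Nat.cast_nonneg _)
  refine Nat.cast_le.mpr (Set.ncard_le_ncard ?_ (Set.toFinite _))
  rintro G ⟨hG, hlt⟩
  refine ⟨hG, ?_⟩
  have h2 : δ < (shortCycles L G : ℝ) * (1 / n) := by
    rw [mul_one_div, lt_div_iff₀ hnr]; exact hlt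
  have : δ / 2 < (shortCycles L G : ℝ) * (1 / n) -
      cfgMean d (fun G : SimpleGraph (Fin n) => (shortCycles L G : ℝ) * (1 / n)) := by linarith
  exact lt_of_lt_of_le this (le_abs_self _)

/-! ### Locally injective homomorphisms -/

/-- `e` is injective on the neighborhood of every vertex of `H`. -/
def LocInj {T V : Type*} (H : SimpleGraph T) (e : T → V) : Prop :=
  ∀ s t u, H.Adj s t → H.Adj s u → e t = e u → t = u

/-- The locally injective homomorphisms from `H` to `G`. -/
def covSet {T : Type*} {n : ℕ} (H : SimpleGraph T) (G : SimpleGraph (Fin n)) :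
    Set (T → Fin n) :=
  HomSet H.Adj (LocInj H) G

lemma exists_injOn_extension {ι α : Type*} [DecidableEq α] {U U' : Finset α}
    (hU : U.card = U'.card) (g g' : ι → α) (hg : ∀ i, g i ∈ U) (hg' : ∀ i, g' i ∈ U')
    (hgi : Function.Injective g) (hgi' : Function.Injective g') :
    ∃ β : α → α, Set.InjOn β U ∧ (∀ x ∈ U, β x ∈ U') ∧ ∀ i, β (g i) = g' i := by
  classical
  let s : Finset ↥U := Finset.univ.filter fun x => ∃ i, g i = x.1
  let f : ↥U → α := fun x => if h : ∃ i, g i = x.1 then g' h.choose else x.1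
  have hf : ∀ i, f ⟨g i, hg i⟩ = g' i := by
    intro i
    have h : ∃ j, g j = g i := ⟨i, rfl⟩
    have : f ⟨g i, hg i⟩ = g' h.choose := dif_pos h
    rw [this, hgi h.choose_spec]
  obtain ⟨β, hβ⟩ := Finset.exists_equiv_extend_of_card_eq (α := ↥U) (t := U') (s := s) (f := f)
    (by simpa using hU) (by
      intro y hy
      obtain ⟨x, hx, rfl⟩ := Finset.mem_image.mp hy
      obtain ⟨i, hi⟩ := (Finset.mem_filter.mp hx).2
      obtain rfl : x = ⟨g i, hg i⟩ := Subtype.ext hi.symm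
      rw [hf]
      exact hg' i) (by
      intro x hx y hy hxy
      obtain ⟨i, hi⟩ := (Finset.mem_filter.mp (Finset.mem_coe.mp hx)).2
      obtain ⟨j, hj⟩ := (Finset.mem_filter.mp (Finset.mem_coe.mp hy)).2
      obtain rfl : x = ⟨g i, hg i⟩ := Subtype.ext hi.symm
      obtain rfl : y = ⟨g j, hg j⟩ := Subtype.ext hj.symm
      rw [hf, hf] at hxy
      obtain rfl := hgi' hxy
      rfl)
  refine ⟨fun x => if h : x ∈ U then β ⟨x, h⟩ else x, ?_, ?_, ?_⟩
  · intro x hx y hy hxy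
    rw [Finset.mem_coe] at hx hy
    simp only [hx, hy, dif_pos] at hxy
    exact congrArg Subtype.val (β.injective (Subtype.ext hxy))
  · intro x hx
    simp only [hx, dif_pos]
    exact (β ⟨x, hx⟩).2
  · intro i
    simp only [hg i, dif_pos]
    rw [hβ _ (by simp [s]), hf]

/-- All vertices of `H` outside the image of `ι` are leaves hanging from the image. -/
def LeafExt {T₀ T : Type*} {H₀ : SimpleGraph T₀} {H : SimpleGraph T} (ι : H₀ ↪g H) : Prop :=
  ∀ b, b ∉ Set.range ι → ∃ s, ∀ t, H.Adj b t ↔ t = ι s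

lemma card_ext_le {T₀ T : Type*} [Finite T] {H₀ : SimpleGraph T₀} {H : SimpleGraph T}
    {ι : H₀ ↪g H} (hι : LeafExt ι) {d n : ℕ} {G G' : SimpleGraph (Fin n)}
    (hG : G ∈ regularGraphs d n) (hG' : G' ∈ regularGraphs d n) {j j' : T₀ → Fin n}
    (hj : j ∈ covSet H₀ G) (hj' : j' ∈ covSet H₀ G') :
    {e ∈ covSet H G | e ∘ ι = j}.ncard ≤ {e ∈ covSet H G' | e ∘ ι = j'}.ncard := by
  have hβ : ∀ s : T₀, ∃ β : Fin n → Fin n, Set.InjOn β (G.neighborSet (j s)) ∧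
      (∀ x, G.Adj (j s) x → G'.Adj (j' s) (β x)) ∧ ∀ t, H₀.Adj s t → β (j t) = j' t := by
    intro s
    obtain ⟨β, h1, h2, h3⟩ := exists_injOn_extension (ι := {t // H₀.Adj s t})
      (U := (G.neighborSet (j s)).toFinset) (U' := (G'.neighborSet (j' s)).toFinset)
      (by rw [← Set.ncard_eq_toFinset_card', ← Set.ncard_eq_toFinset_card', hG, hG'])
      (fun t => j t.1) (fun t => j' t.1) (fun t => by simpa using hj.1 _ _ t.2)
      (fun t => by simpa using hj'.1 _ _ t.2)
      (fun t t' h => Subtype.ext (hj.2 s _ _ t.2 t'.2 h))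
      (fun t t' h => Subtype.ext (hj'.2 s _ _ t.2 t'.2 h))
    refine ⟨β, by simpa using h1, fun x hx => ?_, fun t ht => h3 ⟨t, ht⟩⟩
    simpa using h2 x (by simpa using hx)
  choose β hβi hβm hβe using hβ
  choose p hp using hι
  let Φ : (T → Fin n) → T → Fin n := fun e b =>
    if h : b ∈ Set.range ι then j' h.choose else β (p b h) (e b)
  have hΦι : ∀ e s, Φ e (ι s) = j' s := by
    intro e s
    have h : ι s ∈ Set.range ι := ⟨s, rfl⟩
    have : Φ e (ι s) = j' h.choose := dif_pos h
    rw [this, ι.injective h.choose_spec]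
  have hΦn : ∀ e b (h : b ∉ Set.range ι), Φ e b = β (p b h) (e b) := fun e b h => dif_neg h
  have hΦs : ∀ e : T → Fin n, e ∘ ι = j → ∀ s t, H.Adj (ι s) t → Φ e t = β s (e t) := by
    intro e he s t hst
    by_cases ht : t ∈ Set.range ι
    · obtain ⟨t, rfl⟩ := ht
      rw [hΦι, ← Function.comp_apply (f := e), he, hβe s t (ι.map_adj_iff.mp hst)]
    · rw [hΦn e t ht]
      have := (hp t ht _).mp hst.symm
      rw [ι.injective this]
  refine Set.ncard_le_ncard_of_injOn Φ ?_ ?_ (Set.toFinite _)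
  · rintro e ⟨he, hej⟩
    have hej' : ∀ s, e (ι s) = j s := fun s => congrFun hej s
    have key : ∀ s t, H.Adj (ι s) t → G'.Adj (Φ e (ι s)) (Φ e t) := by
      intro s t hst
      rw [hΦι, hΦs e hej s t hst]
      exact hβm s _ (by rw [← hej']; exact he.1 _ _ hst)
    refine ⟨⟨fun s t hst => ?_, fun s t t' hst hst' htt => ?_⟩, funext fun s => hΦι e s⟩
    · by_cases hs : s ∈ Set.range ι
      · obtain ⟨s, rfl⟩ := hs
        exact key s t hst
      · obtain rfl := (hp s hs t).mp hst
        exact (key _ _ hst.symm).symm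
    · by_cases hs : s ∈ Set.range ι
      · obtain ⟨s, rfl⟩ := hs
        rw [hΦs e hej s t hst, hΦs e hej s t' hst'] at htt
        refine he.2 _ _ _ hst hst' (hβi s ?_ ?_ htt) <;>
          · rw [SimpleGraph.mem_neighborSet, ← hej']
            first
              | exact he.1 _ _ hst
              | exact he.1 _ _ hst'
      · rw [(hp s hs t).mp hst, (hp s hs t').mp hst']
  · rintro e ⟨he, hej⟩ e' ⟨he', hej'⟩ hee
    funext b
    by_cases hb : b ∈ Set.range ι
    · obtain ⟨s, rfl⟩ := hb
      exact (congrFun hej s).trans (congrFun hej' s).symm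
    · have h := congrFun hee b
      rw [hΦn e b hb, hΦn e' b hb] at h
      have hadj : H.Adj (ι (p b hb)) b := ((hp b hb _).mpr rfl).symm
      refine hβi (p b hb) ?_ ?_ h
      · rw [SimpleGraph.mem_neighborSet, ← hej]
        exact he.1 _ _ hadj
      · rw [SimpleGraph.mem_neighborSet, ← hej']
        exact he'.1 _ _ hadj

/-- The number of extensions of a locally injective homomorphism along a leaf extension is
the same for all regular graphs. -/
lemma exists_card_ext {T₀ T : Type*} [Finite T] {H₀ : SimpleGraph T₀} {H : SimpleGraph T}
    {ι : H₀ ↪g H} (hι : LeafExt ι) (d n : ℕ) :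
    ∃ K : ℕ, ∀ G ∈ regularGraphs d n, ∀ j ∈ covSet H₀ G,
      {e ∈ covSet H G | e ∘ ι = j}.ncard = K := by
  by_cases h : ∃ G ∈ regularGraphs d n, (covSet H₀ G).Nonempty
  · obtain ⟨G, hG, j, hj⟩ := h
    exact ⟨_, fun G' hG' j' hj' => le_antisymm (card_ext_le hι hG' hG hj' hj)
      (card_ext_le hι hG hG' hj hj')⟩
  · push Not at h
    exact ⟨0, fun G hG j hj => absurd hj (by rw [h G hG]; exact Set.notMem_empty j)⟩

lemma comp_mem_covSet {T₀ T : Type*} {H₀ : SimpleGraph T₀} {H : SimpleGraph T}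
    (ι : H₀ ↪g H) {n : ℕ} {G : SimpleGraph (Fin n)} {e : T → Fin n} (he : e ∈ covSet H G) :
    e ∘ ι ∈ covSet H₀ G :=
  ⟨fun _ _ h => he.1 _ _ (ι.map_adj_iff.mpr h), fun _ _ _ h h' htt =>
    ι.injective (he.2 _ _ _ (ι.map_adj_iff.mpr h) (ι.map_adj_iff.mpr h') htt)⟩

lemma exists_card_ext_pred {T₀ T : Type*} [Finite T] [Finite T₀] {H₀ : SimpleGraph T₀}
    {H : SimpleGraph T} {ι : H₀ ↪g H} (hι : LeafExt ι) (d n : ℕ) :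
    ∃ K : ℕ, ∀ G ∈ regularGraphs d n, ∀ P : (T₀ → Fin n) → Prop,
      {e ∈ covSet H G | P (e ∘ ι)}.ncard = {j ∈ covSet H₀ G | P j}.ncard * K := by
  obtain ⟨K, hK⟩ := exists_card_ext hι d n
  refine ⟨K, fun G hG P => ?_⟩
  have := Fintype.ofFinite T
  have := Fintype.ofFinite T₀
  rw [Set.ncard_eq_toFinset_card', Set.ncard_eq_toFinset_card']
  rw [Finset.card_eq_sum_card_fiberwise (f := fun e => e ∘ ι)
    (t := {j ∈ covSet H₀ G | P j}.toFinset) (fun e he => by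
      have he' : e ∈ covSet H G ∧ P (e ∘ ι) := by simpa using he
      simpa using ⟨comp_mem_covSet ι he'.1, he'.2⟩)]
  rw [← smul_eq_mul]
  refine Finset.sum_const_nat fun j hj => ?_
  have hj' : j ∈ covSet H₀ G ∧ P j := by simpa using hj
  rw [← hK G hG j hj'.1, Set.ncard_eq_toFinset_card']
  congr 1
  ext e
  simp only [Finset.mem_filter, Set.mem_toFinset, Set.mem_ofPred_eq]
  constructor
  · rintro ⟨⟨h1, -⟩, h2⟩
    exact ⟨h1, h2⟩
  · rintro ⟨h1, h2⟩
    exact ⟨⟨h1, by rw [h2]; exact hj'.2⟩, h2⟩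

/-! ### The tree -/

lemma validTd_cons_cons {d i j : ℕ} {l : List ℕ} :
    ValidTd d (i :: j :: l) ↔ (1 ≤ i ∧ i ≤ d - 1) ∧ ValidTd d (j :: l) := by
  simp only [ValidTd, List.dropLast_cons_cons, List.mem_cons, forall_eq_or_imp,
    List.getLast?_cons_cons]
  tauto

lemma validTd_singleton {d i : ℕ} : ValidTd d [i] ↔ 1 ≤ i ∧ i ≤ d := by
  simp [ValidTd]

lemma validTd_nil {d : ℕ} : ValidTd d [] := (rootTd d).2

lemma ValidTd.tail {d i : ℕ} {l : List ℕ} (h : ValidTd d (i :: l)) : ValidTd d l := by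
  cases l with
  | nil => exact validTd_nil
  | cons j l => exact (validTd_cons_cons.mp h).2

lemma ValidTd.head_le {d i : ℕ} {l : List ℕ} (h : ValidTd d (i :: l)) : 1 ≤ i ∧ i ≤ d := by
  cases l with
  | nil => exact validTd_singleton.mp h
  | cons j l =>
    have := (validTd_cons_cons.mp h).1
    omega

lemma ValidTd.mem_le {d : ℕ} {l : List ℕ} (h : ValidTd d l) : ∀ i ∈ l, i ≤ d := by
  induction l with
  | nil => simp
  | cons j l ih =>
    intro i hi
    rcases List.mem_cons.mp hi with rfl | hi
    · exact h.head_le.2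
    · exact ih h.tail i hi

lemma finite_lists_le (d r : ℕ) : {l : List ℕ | l.length ≤ r ∧ ∀ i ∈ l, i ≤ d}.Finite := by
  induction r with
  | zero =>
    refine (Set.finite_singleton []).subset fun l hl => ?_
    simpa using hl.1
  | succ r ih =>
    refine ((Set.finite_singleton []).union
      (((Set.finite_Iic d).prod ih).image fun p => p.1 :: p.2)).subset fun l hl => ?_
    cases l with
    | nil => exact Or.inl rfl
    | cons i l =>
      refine Or.inr ⟨(i, l), ⟨hl.2 i (by simp), ?_, fun j hj => hl.2 j (by simp [hj])⟩, rfl⟩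
      exact Nat.succ_le_succ_iff.mp hl.1

instance finite_SrSet (d r : ℕ) : Finite ↥(SrSet d r) :=
  Set.Finite.to_subtype (Set.Finite.of_finite_image
    (f := Subtype.val) ((finite_lists_le d r).subset (by
      rintro _ ⟨v, hv, rfl⟩
      exact ⟨hv, v.2.mem_le⟩)) Subtype.val_injective.injOn)

instance finite_ErSet (d r : ℕ) : Finite ↥(ErSet d r) :=
  Finite.of_injective (fun v : ↥(ErSet d r) => (⟨v.1, ErSet_subset_SrSet d r v.2⟩ : ↥(SrSet d r)))
    fun _ _ h => Subtype.ext (congrArg (fun u : ↥(SrSet d r) => u.1) h)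

/-- The embedding of the subgraphs of `T_d` induced by nested sets. -/
def indEmb {d : ℕ} {A B : Set (TdVertex d)} (h : A ⊆ B) :
    (TdGraph d).induce A ↪g (TdGraph d).induce B where
  toFun v := ⟨v.1, h v.2⟩
  inj' _ _ hvw := Subtype.ext (congrArg (fun u : ↥B => u.1) hvw)
  map_rel_iff' := Iff.rfl

lemma leafExt_indEmb {d k : ℕ} {A : Set (TdVertex d)} (hA : A ⊆ SrSet d (k + 1))
    (hk : SrSet d k ⊆ A) : LeafExt (indEmb hA) := by
  rintro ⟨⟨l, hl⟩, hb⟩ hbA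
  have hlk : ¬ l.length ≤ k := fun h => hbA ⟨⟨⟨l, hl⟩, hk h⟩, rfl⟩
  have hlen : l.length ≤ k + 1 := hb
  cases l with
  | nil => simp at hlk
  | cons i l =>
    simp only [List.length_cons] at hlk hlen
    refine ⟨⟨⟨l, hl.tail⟩, hk (show l.length ≤ k by omega)⟩, ?_⟩
    rintro ⟨⟨t, ht⟩, htk⟩
    have htk' : t.length ≤ k + 1 := htk
    simp only [SimpleGraph.comap_adj, Function.Embedding.subtype_apply, TdGraph]
    constructor
    · rintro (⟨a, ha⟩ | ⟨a, ha⟩)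
      · have := congrArg List.length ha
        simp only [List.length_cons] at this
        omega
      · simp only [List.cons.injEq] at ha
        obtain ⟨-, rfl⟩ := ha
        rfl
    · intro h
      have : t = l := congrArg (fun u : ↥(SrSet d (k + 1)) => u.1.1) h
      exact Or.inr ⟨i, by rw [this]⟩

lemma SrSet_mono {d k l : ℕ} (h : k ≤ l) : SrSet d k ⊆ SrSet d l :=
  fun _ hv => le_trans hv h

/-- The root of `S_r`. -/
def rootSr (d r : ℕ) : ↥(SrSet d r) := ⟨rootTd d, Nat.zero_le r⟩

/-- The number of rooted locally injective homomorphisms of `S_r` to a regular graph does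
not depend on the root. -/
lemma exists_card_covSet (d n r : ℕ) : ∃ κ : ℕ, ∀ G ∈ regularGraphs d n, ∀ v,
    {e ∈ covSet (SrGraph d r) G | e (rootSr d r) = v}.ncard = κ := by
  induction r with
  | zero =>
    refine ⟨1, fun G hG v => ?_⟩
    rw [Set.ncard_eq_one]
    have hr : ∀ w : ↥(SrSet d 0), w = rootSr d 0 := by
      rintro ⟨⟨l, hl⟩, hw⟩
      obtain rfl : l = [] := List.length_eq_zero_iff.mp (Nat.le_zero.mp hw)
      rfl
    refine ⟨fun _ => v, Set.eq_singleton_iff_unique_mem.mpr ⟨⟨⟨?_, ?_⟩, rfl⟩, ?_⟩⟩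
    · intro s t hst
      rw [hr s, hr t] at hst
      exact absurd hst (SimpleGraph.irrefl _)
    · intro s t t' hst
      rw [hr s, hr t] at hst
      exact absurd hst (SimpleGraph.irrefl _)
    · rintro e ⟨-, he⟩
      funext w
      rw [hr w, he]
  | succ r ih =>
    obtain ⟨κ, hκ⟩ := ih
    obtain ⟨K, hK⟩ := exists_card_ext_pred
      (leafExt_indEmb (d := d) (SrSet_mono (Nat.le_succ r)) subset_rfl) d n
    refine ⟨κ * K, fun G hG v => ?_⟩
    rw [← hκ G hG v]
    exact hK G hG fun j => j (rootSr d r) = v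

/-! ### Empirical measures of locally injective homomorphisms -/

instance fintypeSrSet (d r : ℕ) : Fintype ↥(SrSet d r) := Fintype.ofFinite _

/-- Restriction of colorings from `S_r` to `E_r`. -/
def resEr (d r : ℕ) {M : Type*} (x : ↥(SrSet d r) → M) : ↥(ErSet d r) → M :=
  fun v => x ⟨v.1, ErSet_subset_SrSet d r v.2⟩

/-- The number of locally injective homomorphisms of `S_r` along which `f` pulls back to `x`. -/
def covCount (d r : ℕ) {M : Type*} {n : ℕ} (G : SimpleGraph (Fin n)) (f : Fin n → M)
    (x : ↥(SrSet d r) → M) : ℕ :=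
  {e ∈ covSet (SrGraph d r) G | f ∘ e = x}.ncard

lemma sum_covCount (d r : ℕ) {M : Type*} [Fintype M] {n : ℕ} (G : SimpleGraph (Fin n))
    (f : Fin n → M) (P : (↥(SrSet d r) → M) → Prop) :
    ∑ x with P x, covCount d r G f x = {e ∈ covSet (SrGraph d r) G | P (f ∘ e)}.ncard := by
  rw [Set.ncard_eq_toFinset_card', Finset.card_eq_sum_card_fiberwise (f := fun e => f ∘ e)
    (t := Finset.univ.filter P) (fun e he => by
      have he' : e ∈ covSet (SrGraph d r) G ∧ P (f ∘ e) := by simpa using he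
      simpa using he'.2)]
  refine Finset.sum_congr rfl fun x hx => ?_
  have hx' : P x := (Finset.mem_filter.mp hx).2
  rw [covCount, Set.ncard_eq_toFinset_card']
  congr 1
  ext e
  simp only [Finset.mem_filter, Set.mem_toFinset, Set.mem_ofPred_eq]
  constructor
  · rintro ⟨h1, h2⟩
    exact ⟨⟨h1, by rw [h2]; exact hx'⟩, h2⟩
  · rintro ⟨⟨h1, -⟩, h2⟩
    exact ⟨h1, h2⟩

lemma ncard_covSet (d r : ℕ) {n κ : ℕ} {G : SimpleGraph (Fin n)}
    (hκ : ∀ v, {e ∈ covSet (SrGraph d r) G | e (rootSr d r) = v}.ncard = κ) :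
    (covSet (SrGraph d r) G).ncard = n * κ := by
  rw [Set.ncard_eq_toFinset_card', Finset.card_eq_sum_card_fiberwise
    (f := fun e => e (rootSr d r)) (t := Finset.univ) (fun e _ => by simp)]
  rw [Finset.sum_congr rfl (g := fun _ => κ)]
  · simp
  · intro v _
    rw [← hκ v, Set.ncard_eq_toFinset_card']
    congr 1
    ext e
    simp

lemma ncard_covSet_iso {T : Type*} [Finite T] {H : SimpleGraph T} (φ : H ≃g H) {n : ℕ}
    (G : SimpleGraph (Fin n)) (P : (T → Fin n) → Prop) :
    {e ∈ covSet H G | P (e ∘ φ)}.ncard = {e ∈ covSet H G | P e}.ncard := by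
  refine Set.ncard_congr (fun e _ => e ∘ φ) ?_ ?_ ?_
  · rintro e ⟨he, hP⟩
    exact ⟨comp_mem_covSet φ.toEmbedding he, hP⟩
  · intro e e' _ _ h
    funext t
    simpa using congrFun h (φ.symm t)
  · rintro e ⟨he, hP⟩
    have h : (e ∘ φ.symm) ∘ φ = e := by
      funext t
      simp
    exact ⟨e ∘ φ.symm, ⟨comp_mem_covSet φ.symm.toEmbedding he, by rwa [h]⟩, h⟩

/-- Coordinate form of membership in `I_{d,r}(M)`. -/
def IdrVec (d r : ℕ) (M : Type*) [Fintype M] : Set ((↥(SrSet d r) → M) → ℝ) :=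
  {w | (∀ x, 0 ≤ w x) ∧ ∑ x, w x = 1 ∧
    (∀ (φ : SrGraph d r ≃g SrGraph d r) x, w (x ∘ φ) = w x) ∧
    ∀ (φ : ErGraph d r ≃g ErGraph d r) y,
      ∑ x with resEr d r x = y ∘ φ, w x = ∑ x with resEr d r x = y, w x}

/-- The normalized count of locally injective homomorphisms of `S_r` by color pattern. -/
def empVec (d r κ : ℕ) {M : Type*} {n : ℕ} (G : SimpleGraph (Fin n)) (f : Fin n → M)
    (x : ↥(SrSet d r) → M) : ℝ :=
  covCount d r G f x / (n * κ)

lemma ErSet_le {d r : ℕ} (hr : 1 ≤ r) : SrSet d (r - 1) ⊆ ErSet d r := fun v hv => by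
  have : v.1.length ≤ r - 1 := hv
  exact Or.inl (by omega)

/-- Empirical vectors of regular graphs lie in `I_{d,r}(M)`. -/
lemma empVec_mem (d r : ℕ) (hr : 1 ≤ r) {M : Type*} [Fintype M] {n κ : ℕ} (hn : 0 < n)
    (hκ0 : 0 < κ) {G : SimpleGraph (Fin n)} (hG : G ∈ regularGraphs d n)
    (hκ : ∀ v, {e ∈ covSet (SrGraph d r) G | e (rootSr d r) = v}.ncard = κ) (f : Fin n → M) :
    empVec d r κ G f ∈ IdrVec d r M := by
  refine ⟨fun x => by unfold empVec; positivity, ?_, fun φ x => ?_, fun φ y => ?_⟩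
  · have h := sum_covCount d r G f fun _ => True
    simp only [Finset.filter_true, and_true] at h
    unfold empVec
    rw [← Finset.sum_div, ← Nat.cast_sum, h]
    have : (covSet (SrGraph d r) G).ncard = n * κ := ncard_covSet d r hκ
    rw [show {e | e ∈ covSet (SrGraph d r) G} = covSet (SrGraph d r) G from rfl, this]
    push_cast
    have : (0 : ℝ) < n * κ := by positivity
    exact div_self this.ne'
  · unfold empVec covCount
    congr 2
    rw [← ncard_covSet_iso φ G fun e => f ∘ e = x ∘ φ]
    congr 1
    ext e
    simp only [Set.mem_ofPred_eq, ← Function.comp_assoc]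
    rw [φ.surjective.injective_comp_right.eq_iff]
  · unfold empVec
    rw [← Finset.sum_div, ← Finset.sum_div, ← Nat.cast_sum, ← Nat.cast_sum, sum_covCount,
      sum_covCount]
    congr 2
    obtain ⟨k, rfl⟩ : ∃ k, r = k + 1 := ⟨r - 1, by omega⟩
    obtain ⟨K, hK⟩ := exists_card_ext_pred
      (leafExt_indEmb (ErSet_subset_SrSet d (k + 1)) (ErSet_le (d := d) hr)) d n
    have h : ∀ z : ↥(ErSet d (k + 1)) → M,
        {e ∈ covSet (SrGraph d (k + 1)) G | resEr d (k + 1) (f ∘ e) = z}.ncard =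
          {j ∈ covSet (ErGraph d (k + 1)) G | f ∘ j = z}.ncard * K :=
      fun z => hK G hG fun j => f ∘ j = z
    rw [h, h]
    congr 1
    rw [← ncard_covSet_iso φ G fun e => f ∘ e = y ∘ φ]
    congr 1
    ext e
    simp only [Set.mem_ofPred_eq, ← Function.comp_assoc]
    rw [φ.surjective.injective_comp_right.eq_iff]

/-- The measure on a finite set with given weights. -/
def vecMeas {X : Type*} [Fintype X] [MeasurableSpace X] (w : X → ℝ) : Measure X :=
  ∑ x, ENNReal.ofReal (w x) • Measure.dirac x

lemma vecMeas_apply {X : Type*} [Fintype X] [MeasurableSpace X] [DiscreteMeasurableSpace X]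
    {w : X → ℝ} (hw : ∀ x, 0 ≤ w x) (S : Set X) :
    vecMeas w S = ENNReal.ofReal (∑ x with x ∈ S, w x) := by
  rw [vecMeas, Measure.finsetSum_apply, ENNReal.ofReal_sum_of_nonneg fun x _ => hw x,
    Finset.sum_filter]
  refine Finset.sum_congr rfl fun x _ => ?_
  rw [Measure.smul_apply, Measure.dirac_apply' _ (MeasurableSet.of_discrete)]
  by_cases hx : x ∈ S <;> simp [hx]

lemma vecMeas_singleton {X : Type*} [Fintype X] [MeasurableSpace X]
    [DiscreteMeasurableSpace X] {w : X → ℝ} (hw : ∀ x, 0 ≤ w x) (x : X) :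
    vecMeas w {x} = ENNReal.ofReal (w x) := by
  rw [vecMeas_apply hw]
  simp only [Set.mem_singleton_iff]
  rw [Finset.filter_eq' Finset.univ x, if_pos (Finset.mem_univ x), Finset.sum_singleton]

lemma integral_vecMeas {X : Type*} [Fintype X] [MeasurableSpace X] [DiscreteMeasurableSpace X]
    {w : X → ℝ} (hw : ∀ x, 0 ≤ w x) (g : X → ℝ) :
    ∫ x, g x ∂(vecMeas w) = ∑ x, w x * g x := by
  have : IsFiniteMeasure (vecMeas w) := ⟨by
    rw [vecMeas_apply hw]; exact ENNReal.ofReal_lt_top⟩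
  rw [integral_fintype (Integrable.of_finite)]
  refine Finset.sum_congr rfl fun x _ => ?_
  rw [smul_eq_mul, measureReal_def, vecMeas_singleton hw, ENNReal.toReal_ofReal (hw x)]

lemma vecMeas_mem_IdrMeas {d r : ℕ} {M : Type*} [Fintype M] [MeasurableSpace M]
    [DiscreteMeasurableSpace M] {w : (↥(SrSet d r) → M) → ℝ} (hw : w ∈ IdrVec d r M) :
    vecMeas w ∈ IdrMeas d r M := by
  obtain ⟨h0, h1, h2, h3⟩ := hw
  refine ⟨⟨?_⟩, fun φ => ?_, fun φ _ => ?_⟩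
  · rw [vecMeas_apply h0]
    simp [h1]
  · refine Measure.ext_of_singleton fun y => ?_
    rw [Measure.map_apply Measurable.of_discrete (measurableSet_singleton y),
      vecMeas_singleton h0, vecMeas_apply h0]
    congr 1
    have e1 : (Finset.univ.filter fun x : ↥(SrSet d r) → M =>
        x ∈ (fun x v => x (φ v)) ⁻¹' {y}) = {y ∘ φ.symm} := by
      ext x
      simp only [Finset.mem_filter, Finset.mem_univ, true_and, Set.mem_preimage,
        Set.mem_singleton_iff, Finset.mem_singleton]
      constructor
      · rintro rfl
        funext v
        simp
      · rintro rfl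
        funext v
        simp
    rw [e1, Finset.sum_singleton, h2 φ.symm]
  · have hm : ∀ y, restrictErOfSr d r (vecMeas w) {y} =
        ENNReal.ofReal (∑ x with resEr d r x = y, w x) := by
      intro y
      rw [restrictErOfSr, Measure.map_apply Measurable.of_discrete (measurableSet_singleton y),
        vecMeas_apply h0]
      rfl
    refine Measure.ext_of_singleton fun y => ?_
    rw [Measure.map_apply Measurable.of_discrete (measurableSet_singleton y)]
    have e1 : (fun (x : ↥(ErSet d r) → M) v => x (φ v)) ⁻¹' {y} = {y ∘ φ.symm} := by
      ext x
      simp only [Set.mem_preimage, Set.mem_singleton_iff]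
      constructor
      · rintro rfl
        funext v
        simp
      · rintro rfl
        funext v
        simp
    rw [e1, hm, hm, h3 φ.symm]

/-! ### Local functionals built from empirical vectors -/

lemma relConn_SrGraph (d r : ℕ) : RelConn (SrGraph d r).Adj := by
  have hrev : ∀ {s t : ↥(SrSet d r)}, Relation.ReflTransGen
      (fun a b => (SrGraph d r).Adj a b ∨ (SrGraph d r).Adj b a) s t → Relation.ReflTransGen
      (fun a b => (SrGraph d r).Adj a b ∨ (SrGraph d r).Adj b a) t s := fun h => by
    induction h with
    | refl => exact Relation.ReflTransGen.refl
    | tail _ hbc ih => exact ih.head hbc.symm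
  have h0 : ∀ (l : List ℕ) (hl : ValidTd d l) (h : l.length ≤ r), Relation.ReflTransGen
      (fun a b => (SrGraph d r).Adj a b ∨ (SrGraph d r).Adj b a) (rootSr d r)
      ⟨⟨l, hl⟩, h⟩ := by
    intro l
    induction l with
    | nil => exact fun _ _ => Relation.ReflTransGen.refl
    | cons i l ih =>
      intro hl h
      refine (ih hl.tail (Nat.le_of_succ_le h)).tail (Or.inl ?_)
      exact Or.inl ⟨i, rfl⟩
  exact fun s t => (hrev (h0 s.1.1 s.1.2 s.2)).trans (h0 t.1.1 t.1.2 t.2)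

lemma exists_locLipschitz_empVec (d r : ℕ) : ∃ C : ℝ, 0 < C ∧
    ∀ (M : Type) (n κ : ℕ) (_ : 0 < κ) (f : Fin n → M) (x : ↥(SrSet d r) → M),
      LocLipschitz d (C / n) fun G => empVec d r κ G f x := by
  obtain ⟨C, hC, h⟩ := exists_locLipschitz_homSet (relConn_SrGraph d r) d
  refine ⟨C, hC, fun M n κ hκ f x => ?_⟩
  have h1 := (h n fun e => LocInj (SrGraph d r) e ∧ f ∘ e = x).mul_const
    (a := 1 / (n * κ : ℝ)) (by positivity)
  have h2 : ∀ G, (HomSet (SrGraph d r).Adj (fun e => LocInj (SrGraph d r) e ∧ f ∘ e = x) G)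
      = {e ∈ covSet (SrGraph d r) G | f ∘ e = x} := fun G => by
    ext e
    exact and_assoc.symm
  refine LocLipschitz.mono (c := C / (n * κ : ℝ)) ?_ ?_
  · simp only [h2, mul_one_div] at h1
    exact h1
  · rcases Nat.eq_zero_or_pos n with rfl | hn
    · simp
    · have hn' : (0 : ℝ) < n := by exact_mod_cast hn
      have hκ' : (1 : ℝ) ≤ κ := by exact_mod_cast hκ
      exact div_le_div_of_nonneg_left hC.le hn' (by nlinarith)

lemma LocLipschitz.iSup {ι : Type*} [Finite ι] [Nonempty ι] {d n : ℕ} {c : ℝ}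
    {F : ι → SimpleGraph (Fin n) → ℝ} (hF : ∀ i, LocLipschitz d c (F i)) :
    LocLipschitz d c fun G => ⨆ i, F i G := by
  intro G G' D hD hG hG' h
  have key : ∀ G₁ G₂ : SimpleGraph (Fin n), (∀ i, |F i G₁ - F i G₂| ≤ c) →
      (⨆ i, F i G₁) ≤ (⨆ i, F i G₂) + c := fun G₁ G₂ h12 => ciSup_le fun i => by
    have := le_ciSup (f := fun i => F i G₂) (Set.finite_range _).bddAbove i
    have := (abs_le.mp (h12 i)).2
    linarith
  have h1 := key G G' fun i => hF i G G' D hD hG hG' h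
  have h2 := key G' G fun i => by rw [abs_sub_comm]; exact hF i G G' D hD hG hG' h
  rw [abs_le]
  constructor <;> linarith

lemma LocLipschitz.iInf {ι : Type*} [Finite ι] [Nonempty ι] {d n : ℕ} {c : ℝ}
    {F : ι → SimpleGraph (Fin n) → ℝ} (hF : ∀ i, LocLipschitz d c (F i)) :
    LocLipschitz d c fun G => ⨅ i, F i G := by
  intro G G' D hD hG hG' h
  have key : ∀ G₁ G₂ : SimpleGraph (Fin n), (∀ i, |F i G₁ - F i G₂| ≤ c) →
      (⨅ i, F i G₁) - c ≤ ⨅ i, F i G₂ := fun G₁ G₂ h12 => le_ciInf fun i => by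
    have := ciInf_le (f := fun i => F i G₁) (Set.finite_range _).bddBelow i
    have := (abs_le.mp (h12 i)).2
    linarith
  have h1 := key G G' fun i => hF i G G' D hD hG hG' h
  have h2 := key G' G fun i => by rw [abs_sub_comm]; exact hF i G G' D hD hG hG' h
  rw [abs_le]
  constructor <;> linarith

/-- The maximum over colorings of a linear functional of the empirical vector. -/
def maxEmp (d r κ : ℕ) {M : Type*} [Fintype M] (g : (↥(SrSet d r) → M) → ℝ) {n : ℕ}
    (G : SimpleGraph (Fin n)) : ℝ :=
  ⨆ f : Fin n → M, ∑ x, empVec d r κ G f x * g x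

/-- The minimum over colorings of the distance from the empirical vector to `w`. -/
def minDev (d r κ : ℕ) {M : Type*} [Fintype M] (w : (↥(SrSet d r) → M) → ℝ) {n : ℕ}
    (G : SimpleGraph (Fin n)) : ℝ :=
  ⨅ f : Fin n → M, ∑ x, |empVec d r κ G f x - w x|

lemma exists_locLipschitz_maxEmp (d r : ℕ) (M : Type) [Fintype M] [Nonempty M]
    (g : (↥(SrSet d r) → M) → ℝ) : ∃ C : ℝ, 0 < C ∧
    ∀ (n κ : ℕ) (_ : 0 < κ), LocLipschitz d (n := n) (C / n) (maxEmp d r κ g) := by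
  obtain ⟨C, hC, h⟩ := exists_locLipschitz_empVec d r
  refine ⟨C * (∑ x, |g x| + 1), by positivity, fun n κ hκ => LocLipschitz.iSup fun f => ?_⟩
  intro G G' D hD hG hG' hGG
  rw [← Finset.sum_sub_distrib]
  refine (Finset.abs_sum_le_sum_abs _ _).trans ?_
  calc ∑ x, |empVec d r κ G f x * g x - empVec d r κ G' f x * g x|
      ≤ ∑ x, C / n * |g x| := by
        refine Finset.sum_le_sum fun x _ => ?_
        rw [← sub_mul, abs_mul]
        exact mul_le_mul_of_nonneg_right (h M n κ hκ f x G G' D hD hG hG' hGG) (abs_nonneg _)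
    _ ≤ C * (∑ x, |g x| + 1) / n := by
        rw [← Finset.mul_sum, div_mul_eq_mul_div]
        gcongr
        linarith

lemma exists_locLipschitz_minDev (d r : ℕ) (M : Type) [Fintype M] [Nonempty M] :
    ∃ C : ℝ, 0 < C ∧ ∀ (w : (↥(SrSet d r) → M) → ℝ) (n κ : ℕ) (_ : 0 < κ),
      LocLipschitz d (n := n) (C / n) (minDev d r κ w) := by
  obtain ⟨C, hC, h⟩ := exists_locLipschitz_empVec d r
  refine ⟨C * (Fintype.card (↥(SrSet d r) → M) + 1), by positivity,
    fun w n κ hκ => LocLipschitz.iInf fun f => ?_⟩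
  intro G G' D hD hG hG' hGG
  rw [← Finset.sum_sub_distrib]
  refine (Finset.abs_sum_le_sum_abs _ _).trans ?_
  calc ∑ x, |(|empVec d r κ G f x - w x| - |empVec d r κ G' f x - w x|)|
      ≤ ∑ x : ↥(SrSet d r) → M, C / n := by
        refine Finset.sum_le_sum fun x _ => (abs_abs_sub_abs_le _ _).trans ?_
        rw [sub_sub_sub_cancel_right]
        exact h M n κ hκ f x G G' D hD hG hG' hGG
    _ ≤ C * (Fintype.card (↥(SrSet d r) → M) + 1) / n := by
        rw [Finset.sum_const, Finset.card_univ, nsmul_eq_mul, mul_div_assoc', mul_comm]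
        gcongr
        linarith

/-! ### Breadth-first search labels -/

lemma mem_bfsLayer {n : ℕ} {G : SimpleGraph (Fin n)} {v : Fin n} {σ : Equiv.Perm (Fin n)}
    {k : ℕ} {w : Fin n} : w ∈ bfsLayer G v σ k ↔ G.Reachable v w ∧ G.dist v w = k := by
  cases k with
  | zero =>
    simp only [bfsLayer, List.mem_singleton]
    constructor
    · rintro rfl
      exact ⟨SimpleGraph.Reachable.refl _, SimpleGraph.dist_self⟩
    · rintro ⟨h1, h2⟩
      exact (h1.dist_eq_zero_iff.mp h2).symm
  | succ k => simp [bfsLayer, List.mem_mergeSort]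

lemma nodup_bfsLayer (n : ℕ) (G : SimpleGraph (Fin n)) (v : Fin n) (σ : Equiv.Perm (Fin n))
    (k : ℕ) : (bfsLayer G v σ k).Nodup := by
  cases k with
  | zero => simp [bfsLayer]
  | succ k =>
    rw [bfsLayer, (List.mergeSort_perm _ _).nodup_iff]
    exact (List.nodup_finRange n).filter _

lemma length_filter_takeWhile {α : Type*} [DecidableEq α] (l : List α) (w : α) (q : α → Bool)
    (hw : w ∈ l) (hq : q w = true) :
    ((l.takeWhile fun a => decide (a ≠ w)).filter q).length = (l.filter q).idxOf w := by
  induction l with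
  | nil => simp at hw
  | cons a l ih =>
    by_cases ha : a = w
    · subst ha
      simp [hq]
    · have hw' : w ∈ l := by
        rcases List.mem_cons.mp hw with h | h
        · exact absurd h.symm ha
        · exact h
      have ihr := ih hw'
      by_cases hqa : q a = true
      · simp only [List.takeWhile_cons, ha, ne_eq, not_false_eq_true, decide_true, if_true,
          List.filter_cons, hqa, List.length_cons]
        rw [List.idxOf_cons_ne _ ha]
        simp only [ne_eq] at ihr
        rw [ihr]
      · simp only [List.takeWhile_cons, ha, ne_eq, not_false_eq_true, decide_true, if_true,
          List.filter_cons, hqa]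
        simpa using ihr

/-- The parent of `w` in the breadth-first search tree, searched in layer `k`. -/
def bfsPar {n : ℕ} (G : SimpleGraph (Fin n)) (v : Fin n) (σ : Equiv.Perm (Fin n)) (k : ℕ)
    (w : Fin n) : Option (Fin n) :=
  (bfsLayer G v σ k).find? fun u => decide (G.Adj u w)

/-- The children in layer `k + 1` of the vertex `p` in the breadth-first search tree. -/
def bfsChild {n : ℕ} (G : SimpleGraph (Fin n)) (v : Fin n) (σ : Equiv.Perm (Fin n)) (k : ℕ)
    (p : Fin n) : List (Fin n) :=
  (bfsLayer G v σ (k + 1)).filter fun w => decide (bfsPar G v σ k w = some p)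

lemma bfsPar_eq_some {n : ℕ} {G : SimpleGraph (Fin n)} {v : Fin n} {σ : Equiv.Perm (Fin n)}
    {k : ℕ} {w p : Fin n} (h : bfsPar G v σ k w = some p) :
    G.Adj p w ∧ G.Reachable v p ∧ G.dist v p = k := by
  have h1 := List.find?_some h
  have h2 := List.mem_of_find?_eq_some h
  exact ⟨by simpa using h1, mem_bfsLayer.mp h2⟩

lemma exists_adj_dist {V : Type*} {G : SimpleGraph V} {v w : V} {k : ℕ} (hr : G.Reachable v w)
    (hk : G.dist v w = k + 1) : ∃ u, G.Adj u w ∧ G.Reachable v u ∧ G.dist v u = k := by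
  obtain ⟨p, hp⟩ := hr.exists_walk_length_eq_dist
  have hp' : p.reverse.length = k + 1 := by rw [SimpleGraph.Walk.length_reverse, hp, hk]
  cases hq : p.reverse with
  | nil => rw [hq] at hp'; simp at hp'
  | cons h q =>
    rw [hq] at hp'
    simp only [SimpleGraph.Walk.length_cons] at hp'
    refine ⟨_, h.symm, q.reverse.reachable, ?_⟩
    have h1 := SimpleGraph.dist_le q.reverse
    rw [SimpleGraph.Walk.length_reverse] at h1
    obtain ⟨q', hq'⟩ := q.reverse.reachable.exists_walk_length_eq_dist
    have h2 := SimpleGraph.dist_le (q'.concat h.symm)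
    rw [SimpleGraph.Walk.length_concat] at h2
    omega

lemma exists_bfsPar {n : ℕ} {G : SimpleGraph (Fin n)} {v w : Fin n} (σ : Equiv.Perm (Fin n))
    {k : ℕ} (hr : G.Reachable v w) (hk : G.dist v w = k + 1) :
    ∃ p, bfsPar G v σ k w = some p := by
  obtain ⟨u, hu, hu'⟩ := exists_adj_dist hr hk
  rw [← Option.isSome_iff_exists, bfsPar, List.find?_isSome]
  exact ⟨u, mem_bfsLayer.mpr hu', by simpa using hu⟩

lemma bfsPath_self {n : ℕ} (G : SimpleGraph (Fin n)) (v : Fin n) (σ : Equiv.Perm (Fin n)) :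
    bfsPath G v σ v = some [] := by
  simp [bfsPath, bfsPathAux]

lemma bfsPath_succ {n : ℕ} {G : SimpleGraph (Fin n)} {v w p : Fin n} {σ : Equiv.Perm (Fin n)}
    {k : ℕ} (hr : G.Reachable v w) (hk : G.dist v w = k + 1) (hp : bfsPar G v σ k w = some p) :
    bfsPath G v σ w =
      (bfsPath G v σ p).map fun l => (1 + (bfsChild G v σ k p).idxOf w) :: l := by
  obtain ⟨-, hpr, hpk⟩ := bfsPar_eq_some hp
  rw [bfsPath, if_pos hr, hk, bfsPath, if_pos hpr, hpk, bfsPathAux]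
  have hp' := hp
  unfold bfsPar at hp'
  simp only [hp']
  congr 1
  funext l
  congr 2
  have := length_filter_takeWhile (bfsLayer G v σ (k + 1)) w
    (fun w' => decide (bfsPar G v σ k w' = some p)) (mem_bfsLayer.mpr ⟨hr, hk⟩) (by simpa using hp)
  unfold bfsChild
  rw [← this]
  rfl

lemma mem_bfsChild {n : ℕ} {G : SimpleGraph (Fin n)} {v w p : Fin n} {σ : Equiv.Perm (Fin n)}
    {k : ℕ} : w ∈ bfsChild G v σ k p ↔
      (G.Reachable v w ∧ G.dist v w = k + 1) ∧ bfsPar G v σ k w = some p := by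
  rw [bfsChild, List.mem_filter, mem_bfsLayer, decide_eq_true_iff]

/-- Every vertex of the component has a label, of length its distance to the root. -/
lemma exists_bfsPath {n : ℕ} {G : SimpleGraph (Fin n)} {v : Fin n} (σ : Equiv.Perm (Fin n))
    (k : ℕ) : ∀ w, G.Reachable v w → G.dist v w = k →
      ∃ l, bfsPath G v σ w = some l ∧ l.length = k := by
  induction k with
  | zero =>
    intro w hr hk
    obtain rfl := hr.dist_eq_zero_iff.mp hk
    exact ⟨[], bfsPath_self G _ σ, rfl⟩
  | succ k ih =>
    intro w hr hk
    obtain ⟨p, hp⟩ := exists_bfsPar σ hr hk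
    obtain ⟨-, hpr, hpk⟩ := bfsPar_eq_some hp
    obtain ⟨l, hl, hlk⟩ := ih p hpr hpk
    exact ⟨_, by rw [bfsPath_succ hr hk hp, hl]; rfl, by simp [hlk]⟩

lemma bfsPath_reachable {n : ℕ} {G : SimpleGraph (Fin n)} {v w : Fin n}
    {σ : Equiv.Perm (Fin n)} {l : List ℕ} (h : bfsPath G v σ w = some l) :
    G.Reachable v w ∧ G.dist v w = l.length := by
  by_cases hr : G.Reachable v w
  · obtain ⟨l', hl', hk⟩ := exists_bfsPath σ _ w hr rfl
    rw [h, Option.some_inj] at hl'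
    exact ⟨hr, by rw [hl', hk]⟩
  · rw [bfsPath, if_neg hr] at h
    exact absurd h (by simp)

/-- The recursive structure of labels. -/
lemma bfsPath_cons {n : ℕ} {G : SimpleGraph (Fin n)} {v w : Fin n}
    {σ : Equiv.Perm (Fin n)} {i : ℕ} {l : List ℕ} (h : bfsPath G v σ w = some (i :: l)) :
    ∃ p, bfsPar G v σ l.length w = some p ∧ bfsPath G v σ p = some l ∧
      i = 1 + (bfsChild G v σ l.length p).idxOf w ∧ w ∈ bfsChild G v σ l.length p := by
  obtain ⟨hr, hk⟩ := bfsPath_reachable h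
  rw [List.length_cons] at hk
  obtain ⟨p, hp⟩ := exists_bfsPar σ hr hk
  rw [bfsPath_succ hr hk hp] at h
  obtain ⟨l', hl', hil⟩ := Option.map_eq_some_iff.mp h
  rw [List.cons.injEq] at hil
  exact ⟨p, hp, by rw [hl', hil.2], hil.1.symm, mem_bfsChild.mpr ⟨⟨hr, hk⟩, hp⟩⟩

/-- Labels are injective. -/
lemma bfsPath_injective {n : ℕ} {G : SimpleGraph (Fin n)} {v : Fin n} {σ : Equiv.Perm (Fin n)}
    (l : List ℕ) : ∀ w w', bfsPath G v σ w = some l → bfsPath G v σ w' = some l → w = w' := by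
  induction l with
  | nil =>
    intro w w' h h'
    obtain ⟨h1, h2⟩ := bfsPath_reachable h
    obtain ⟨h1', h2'⟩ := bfsPath_reachable h'
    exact (h1.dist_eq_zero_iff.mp h2).symm.trans (h1'.dist_eq_zero_iff.mp h2')
  | cons i l ih =>
    intro w w' h h'
    obtain ⟨p, -, hp, hi, hw⟩ := bfsPath_cons h
    obtain ⟨p', -, hp', hi', -⟩ := bfsPath_cons h'
    obtain rfl := ih p p' hp hp'
    refine (List.idxOf_inj hw).mp ?_
    omega

lemma card_bfsChild_le {n d : ℕ} {G : SimpleGraph (Fin n)} (hG : G ∈ regularGraphs d n)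
    {v p : Fin n} {σ : Equiv.Perm (Fin n)} {k : ℕ} (hr : G.Reachable v p) (hk : G.dist v p = k) :
    (bfsChild G v σ k p).length ≤ if k = 0 then d else d - 1 := by
  have hnd : (bfsChild G v σ k p).Nodup := (nodup_bfsLayer n G v σ (k + 1)).filter _
  have hsub : (bfsChild G v σ k p).toFinset ⊆ (G.neighborSet p).toFinset := by
    intro w hw
    rw [List.mem_toFinset, mem_bfsChild] at hw
    simpa using (bfsPar_eq_some hw.2).1
  have hd : (G.neighborSet p).toFinset.card = d := by
    rw [← Set.ncard_eq_toFinset_card', hG p]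
  rw [← List.toFinset_card_of_nodup hnd]
  split_ifs with h0
  · exact (Finset.card_le_card hsub).trans hd.le
  · obtain ⟨k, rfl⟩ := Nat.exists_eq_succ_of_ne_zero h0
    obtain ⟨u, hu, -, huk⟩ := exists_adj_dist hr hk
    have hsub' : (bfsChild G v σ (k + 1) p).toFinset ⊆ (G.neighborSet p).toFinset.erase u := by
      intro w hw
      refine Finset.mem_erase.mpr ⟨?_, hsub hw⟩
      rintro rfl
      rw [List.mem_toFinset, mem_bfsChild] at hw
      omega
    refine (Finset.card_le_card hsub').trans ?_
    rw [Finset.card_erase_of_mem (by simpa using hu.symm), hd]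

lemma bfsPath_valid {n d : ℕ} {G : SimpleGraph (Fin n)} (hG : G ∈ regularGraphs d n)
    {v : Fin n} {σ : Equiv.Perm (Fin n)} (l : List ℕ) :
    ∀ w, bfsPath G v σ w = some l → ValidTd d l := by
  induction l with
  | nil => exact fun _ _ => validTd_nil
  | cons i l ih =>
    intro w h
    obtain ⟨p, -, hp, hi, hw⟩ := bfsPath_cons h
    have hl := ih p hp
    obtain ⟨hr, hk⟩ := bfsPath_reachable hp
    have hc := card_bfsChild_le hG (σ := σ) hr hk
    have hidx := List.idxOf_lt_length_of_mem hw
    cases l with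
    | nil =>
      rw [validTd_singleton]
      simp only [List.length_nil, if_true] at hc hidx hi
      omega
    | cons j l =>
      rw [validTd_cons_cons]
      simp only [List.length_cons, Nat.succ_ne_zero, if_false] at hc hidx hi
      exact ⟨by omega, hl⟩

/-! ### Roots with tree-like neighborhoods -/

/-- Every vertex of the ball of radius `r` around `v` has at most one neighbor which is not
farther from `v`: the `r`-ball, including the edges leaving it to non-farther vertices, is a
tree. -/
def IsNice {n : ℕ} (r : ℕ) (G : SimpleGraph (Fin n)) (v : Fin n) : Prop :=
  ∀ w, G.Reachable v w → G.dist v w ≤ r → ∀ u u', G.Adj w u → G.Adj w u' →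
    G.dist v u ≤ G.dist v w → G.dist v u' ≤ G.dist v w → u = u'

lemma IsNice.bfsPar_eq {n r : ℕ} {G : SimpleGraph (Fin n)} {v : Fin n} (hv : IsNice r G v)
    (σ : Equiv.Perm (Fin n)) {k : ℕ} {w u : Fin n} (hr : G.Reachable v w)
    (hk : G.dist v w = k + 1) (hkr : k + 1 ≤ r) (hu : G.Adj w u) (huk : G.dist v u ≤ k + 1) :
    bfsPar G v σ k w = some u := by
  obtain ⟨p, hp⟩ := exists_bfsPar σ hr hk
  obtain ⟨hpa, -, hpk⟩ := bfsPar_eq_some hp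
  rw [hp, hv w hr (by omega) p u hpa.symm hu (by omega) (by omega)]

lemma dist_le_succ_of_adj {n : ℕ} {G : SimpleGraph (Fin n)} {v w u : Fin n}
    (hr : G.Reachable v w) (h : G.Adj w u) : G.dist v u ≤ G.dist v w + 1 := by
  obtain ⟨q, hq⟩ := hr.exists_walk_length_eq_dist
  have := SimpleGraph.dist_le (q.concat h)
  rwa [SimpleGraph.Walk.length_concat, hq] at this

lemma IsNice.card_bfsChild {n r d : ℕ} {G : SimpleGraph (Fin n)} {v : Fin n}
    (hv : IsNice r G v) (hG : G ∈ regularGraphs d n) (σ : Equiv.Perm (Fin n)) {k : ℕ}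
    {p : Fin n} (hr : G.Reachable v p) (hk : G.dist v p = k) (hkr : k + 1 ≤ r) :
    (if k = 0 then d else d - 1) ≤ (bfsChild G v σ k p).length := by
  have hnd : (bfsChild G v σ k p).Nodup := (nodup_bfsLayer n G v σ (k + 1)).filter _
  have hd : (G.neighborSet p).toFinset.card = d := by
    rw [← Set.ncard_eq_toFinset_card', hG p]
  have key : ∀ u, G.Adj p u → ¬ G.dist v u ≤ k → u ∈ (bfsChild G v σ k p).toFinset := by
    intro u hu huk
    have h1 := dist_le_succ_of_adj hr hu
    have hur : G.Reachable v u := hr.trans hu.reachable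
    rw [List.mem_toFinset, mem_bfsChild]
    have hk1 : G.dist v u = k + 1 := by omega
    exact ⟨⟨hur, hk1⟩, hv.bfsPar_eq σ hur hk1 hkr hu.symm (by omega)⟩
  rw [← List.toFinset_card_of_nodup hnd]
  split_ifs with h0
  · rw [← hd]
    refine Finset.card_le_card fun u hu => key u (by simpa using hu) fun h => ?_
    subst h0
    have hu' : G.Adj p u := by simpa using hu
    have h1 := hr.dist_eq_zero_iff.mp hk
    have h2 := (hr.trans hu'.reachable).dist_eq_zero_iff.mp (Nat.le_zero.mp h)
    exact hu'.ne (h1.symm.trans h2)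
  · obtain ⟨k, rfl⟩ := Nat.exists_eq_succ_of_ne_zero h0
    obtain ⟨u₀, hu₀, -, huk⟩ := exists_adj_dist hr hk
    rw [← hd, ← Finset.card_erase_of_mem (a := u₀) (by simpa using hu₀.symm)]
    refine Finset.card_le_card fun u hu => ?_
    obtain ⟨hne, hu⟩ := Finset.mem_erase.mp hu
    have hu' : G.Adj p u := by simpa using hu
    exact key u hu' fun h =>
      hne (hv p hr (by omega) u u₀ hu' hu₀.symm (by omega) (by omega))

lemma IsNice.exists_label {n r d : ℕ} {G : SimpleGraph (Fin n)} {v : Fin n}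
    (hv : IsNice r G v) (hG : G ∈ regularGraphs d n) (σ : Equiv.Perm (Fin n)) (l : List ℕ) :
    ValidTd d l → l.length ≤ r → ∃ w, bfsPath G v σ w = some l := by
  induction l with
  | nil => exact fun _ _ => ⟨v, bfsPath_self G v σ⟩
  | cons i l ih =>
    intro hl hlr
    obtain ⟨p, hp⟩ := ih hl.tail (Nat.le_of_succ_le hlr)
    obtain ⟨hr, hk⟩ := bfsPath_reachable hp
    have hc := hv.card_bfsChild hG σ hr hk hlr
    have hi : 1 ≤ i ∧ i - 1 < (bfsChild G v σ l.length p).length := by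
      cases l with
      | nil =>
        rw [validTd_singleton] at hl
        simp only [List.length_nil, if_true] at hc ⊢
        omega
      | cons j l =>
        rw [validTd_cons_cons] at hl
        simp only [List.length_cons, Nat.succ_ne_zero, if_false] at hc ⊢
        omega
    have hnd : (bfsChild G v σ l.length p).Nodup := (nodup_bfsLayer n G v σ _).filter _
    set w := (bfsChild G v σ l.length p)[i - 1]'hi.2 with hw
    have hmem : w ∈ bfsChild G v σ l.length p := List.getElem_mem _
    obtain ⟨⟨h1, h2⟩, h3⟩ := mem_bfsChild.mp hmem
    refine ⟨w, ?_⟩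
    rw [bfsPath_succ h1 h2 h3, hp, Option.map_some, hw, hnd.idxOf_getElem]
    congr 2
    omega

lemma IsNice.adj_iff {n r : ℕ} {G : SimpleGraph (Fin n)} {v : Fin n} (hv : IsNice r G v)
    (σ : Equiv.Perm (Fin n)) {w w' : Fin n} {l l' : List ℕ} (hw : bfsPath G v σ w = some l)
    (hw' : bfsPath G v σ w' = some l') (hl : l.length ≤ r) (hl' : l'.length ≤ r) :
    G.Adj w w' ↔ (∃ i, l' = i :: l) ∨ (∃ i, l = i :: l') := by
  have down : ∀ {w w' : Fin n} {l l' : List ℕ}, bfsPath G v σ w = some l →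
      bfsPath G v σ w' = some l' → l'.length ≤ r → G.Adj w w' → l.length ≤ l'.length →
      ∃ i, l' = i :: l := by
    intro w w' l l' hw hw' hl' h hll
    obtain ⟨hr, hk⟩ := bfsPath_reachable hw
    cases l' with
    | nil =>
      obtain ⟨hr', hk'⟩ := bfsPath_reachable hw'
      have h1 := hr.dist_eq_zero_iff.mp (by simp only [List.length_nil] at hll; omega)
      have h2 := hr'.dist_eq_zero_iff.mp hk'
      exact absurd (h1.symm.trans h2) h.ne
    | cons i l' =>
      obtain ⟨hr', hk'⟩ := bfsPath_reachable hw'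
      obtain ⟨p, hp, hpl, -, -⟩ := bfsPath_cons hw'
      simp only [List.length_cons] at hk' hl' hll
      have := hv.bfsPar_eq σ hr' hk' hl' h.symm (by omega)
      rw [hp, Option.some_inj] at this
      subst this
      rw [hw, Option.some_inj] at hpl
      exact ⟨i, by rw [hpl]⟩
  have up : ∀ {w w' : Fin n} {l : List ℕ} {i : ℕ}, bfsPath G v σ w = some l →
      bfsPath G v σ w' = some (i :: l) → G.Adj w w' := by
    intro w w' l i hw hw'
    obtain ⟨p, hp, hpl, -, -⟩ := bfsPath_cons hw'
    obtain rfl := bfsPath_injective l _ _ hw hpl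
    exact (bfsPar_eq_some hp).1
  constructor
  · intro h
    rcases le_total l.length l'.length with hll | hll
    · exact Or.inl (down hw hw' hl' h hll)
    · exact Or.inr (down hw' hw hl h.symm hll)
  · rintro (⟨i, rfl⟩ | ⟨i, rfl⟩)
    · exact up hw hw'
    · exact (up hw' hw).symm

/-- The map sending a label to the vertex carrying it. -/
def bfsMap (d r : ℕ) {n : ℕ} (G : SimpleGraph (Fin n)) (v : Fin n) (σ : Equiv.Perm (Fin n))
    (t : ↥(SrSet d r)) : Fin n :=
  if h : ∃ w, bfsPath G v σ w = some t.1.1 then h.choose else v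

section nice

variable {n r d : ℕ} {G : SimpleGraph (Fin n)} {v : Fin n}

lemma IsNice.bfsPath_bfsMap (hv : IsNice r G v) (hG : G ∈ regularGraphs d n)
    (σ : Equiv.Perm (Fin n)) (t : ↥(SrSet d r)) :
    bfsPath G v σ (bfsMap d r G v σ t) = some t.1.1 := by
  have h := hv.exists_label hG σ t.1.1 t.1.2 t.2
  rw [bfsMap, dif_pos h]
  exact h.choose_spec

lemma IsNice.bfsMap_mem_covSet (hv : IsNice r G v) (hG : G ∈ regularGraphs d n)
    (σ : Equiv.Perm (Fin n)) : bfsMap d r G v σ ∈ covSet (SrGraph d r) G := by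
  refine ⟨fun s t hst => ?_, fun s t t' _ _ h => ?_⟩
  · exact (hv.adj_iff σ (hv.bfsPath_bfsMap hG σ s) (hv.bfsPath_bfsMap hG σ t) s.2 t.2).mpr hst
  · have h1 := hv.bfsPath_bfsMap hG σ t
    rw [h, hv.bfsPath_bfsMap hG σ t', Option.some_inj] at h1
    exact Subtype.ext (Subtype.ext h1.symm)

lemma IsNice.bfsMap_root (hv : IsNice r G v) (hG : G ∈ regularGraphs d n)
    (σ : Equiv.Perm (Fin n)) : bfsMap d r G v σ (rootSr d r) = v :=
  bfsPath_injective [] _ _ (hv.bfsPath_bfsMap hG σ (rootSr d r)) (bfsPath_self G v σ)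

lemma IsNice.resS_bfsRCG {M : Type*} (hv : IsNice r G v) (hG : G ∈ regularGraphs d n)
    (σ : Equiv.Perm (Fin n)) (f : Fin n → M) :
    resS r (bfsRCG G f v σ) = iotaSr d r (f ∘ bfsMap d r G v σ) := by
  refine RCG.ext ?_ ?_
  · funext l
    simp only [resS, iotaSr, bfsRCG]
    by_cases hl : l.length ≤ r
    · by_cases hv' : ValidTd d l
      · have h := hv.exists_label hG σ l hv' hl
        rw [if_pos hl, dif_pos h, dif_pos ⟨hv', hl⟩]
        congr 2
        exact bfsPath_injective l _ _ h.choose_spec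
          (hv.bfsPath_bfsMap hG σ ⟨⟨l, hv'⟩, hl⟩)
      · rw [if_pos hl, dif_neg fun ⟨w, hw⟩ => hv' (bfsPath_valid hG l w hw),
          dif_neg fun h => hv' h.1]
    · rw [if_neg hl, dif_neg fun h => hl h.2]
  · funext ⟨l, l'⟩
    simp only [resS, iotaSr, bfsRCG]
    by_cases hl : l.length ≤ r ∧ l'.length ≤ r
    · rw [if_pos hl]
      refine if_congr ?_ rfl rfl
      constructor
      · rintro ⟨w, w', hw, hw', ha⟩
        exact ⟨bfsPath_valid hG l w hw, bfsPath_valid hG l' w' hw', hl.1, hl.2,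
          (hv.adj_iff σ hw hw' hl.1 hl.2).mp ha⟩
      · rintro ⟨h1, h2, -, -, h⟩
        obtain ⟨w, hw⟩ := hv.exists_label hG σ l h1 hl.1
        obtain ⟨w', hw'⟩ := hv.exists_label hG σ l' h2 hl.2
        exact ⟨w, w', hw, hw', (hv.adj_iff σ hw hw' hl.1 hl.2).mpr h⟩
    · rw [if_neg hl, if_neg fun h => hl ⟨h.2.2.1, h.2.2.2.1⟩]

end nice

/-! ### Uniformity of the breadth-first-search map on tree-like neighborhoods -/

lemma idxOf_map_of_injective {α β : Type*} [DecidableEq α] [DecidableEq β] {g : α → β}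
    (hg : Function.Injective g) (l : List α) (a : α) : (l.map g).idxOf (g a) = l.idxOf a := by
  induction l with
  | nil => rfl
  | cons b l ih =>
    rw [List.map_cons]
    by_cases h : b = a
    · subst h
      rw [List.idxOf_cons_self, List.idxOf_cons_self]
    · rw [List.idxOf_cons_ne _ h, List.idxOf_cons_ne _ fun hh => h (hg hh), ih]

/-- The sorting key used to order the layer following the list `prev`. -/
def bfsKey {n : ℕ} (G : SimpleGraph (Fin n)) (v : Fin n) (σ : Equiv.Perm (Fin n))
    (prev : List (Fin n)) (w : Fin n) : ℕ :=
  prev.idxOf ((prev.find? fun u => decide (G.Adj u w)).getD v) * n + (σ w : ℕ)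

lemma bfsKey_injective {n : ℕ} (G : SimpleGraph (Fin n)) (v : Fin n) (σ : Equiv.Perm (Fin n))
    (prev : List (Fin n)) : Function.Injective (bfsKey G v σ prev) := by
  intro a b h
  have h1 := congrArg (· % n) h
  simp only [bfsKey, Nat.mul_add_mod_self_right, Nat.mod_eq_of_lt (σ a).2,
    Nat.mod_eq_of_lt (σ b).2] at h1
  exact σ.injective (Fin.ext h1)

lemma bfsLayer_succ {n : ℕ} (G : SimpleGraph (Fin n)) (v : Fin n) (σ : Equiv.Perm (Fin n))
    (k : ℕ) : bfsLayer G v σ (k + 1) = ((List.finRange n).filter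
      fun w => decide (G.Reachable v w ∧ G.dist v w = k + 1)).mergeSort
        fun a b => bfsKey G v σ (bfsLayer G v σ k) a ≤ bfsKey G v σ (bfsLayer G v σ k) b := rfl

lemma pairwise_bfsLayer_succ {n : ℕ} (G : SimpleGraph (Fin n)) (v : Fin n)
    (σ : Equiv.Perm (Fin n)) (k : ℕ) : (bfsLayer G v σ (k + 1)).Pairwise fun a b =>
      bfsKey G v σ (bfsLayer G v σ k) a ≤ bfsKey G v σ (bfsLayer G v σ k) b := by
  rw [bfsLayer_succ]
  refine (List.pairwise_mergeSort ?_ ?_ _).imp fun h => of_decide_eq_true h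
  · intro a b c h h'
    simp only [decide_eq_true_eq] at h h' ⊢
    exact h.trans h'
  · intro a b
    simp only [Bool.or_eq_true, decide_eq_true_eq]
    exact le_total _ _

/-- A permutation of the vertices which acts as an automorphism of the rooted `r`-ball. -/
structure BallAut {n : ℕ} (r : ℕ) (G : SimpleGraph (Fin n)) (v : Fin n)
    (θ : Equiv.Perm (Fin n)) : Prop where
  layer : ∀ k ≤ r, ∀ w, (G.Reachable v (θ w) ∧ G.dist v (θ w) = k) ↔
    (G.Reachable v w ∧ G.dist v w = k)
  adj : ∀ w w', G.Reachable v w → G.dist v w ≤ r → G.Reachable v w' → G.dist v w' ≤ r →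
    (G.Adj (θ w) (θ w') ↔ G.Adj w w')

lemma BallAut.find {n r : ℕ} {G : SimpleGraph (Fin n)} {v : Fin n} {θ : Equiv.Perm (Fin n)}
    (hθ : BallAut r G v θ) (σ : Equiv.Perm (Fin n)) {k : ℕ} (hk : k ≤ r) {w : Fin n}
    (hw : G.Reachable v w) (hwr : G.dist v w ≤ r) :
    ((bfsLayer G v σ k).map θ).find? (fun u => decide (G.Adj u (θ w))) =
      (bfsPar G v σ k w).map θ := by
  rw [List.find?_map, bfsPar]
  congr 1
  refine List.find?_congr fun u hu => ?_
  obtain ⟨h1, h2⟩ := mem_bfsLayer.mp hu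
  simp only [Function.comp]
  exact decide_eq_decide.mpr (hθ.adj u w h1 (h2.trans_le hk) hw hwr)

lemma BallAut.bfsLayer_map {n r : ℕ} {G : SimpleGraph (Fin n)} {v : Fin n}
    {θ : Equiv.Perm (Fin n)} (hθ : BallAut r G v θ) (σ : Equiv.Perm (Fin n)) (k : ℕ) :
    k ≤ r → bfsLayer G v (θ.symm.trans σ) k = (bfsLayer G v σ k).map θ := by
  induction k with
  | zero =>
    intro _
    obtain ⟨h1, h2⟩ := (hθ.layer 0 (Nat.zero_le r) v).mpr
      ⟨SimpleGraph.Reachable.refl _, SimpleGraph.dist_self⟩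
    have := h1.dist_eq_zero_iff.mp h2
    simp [bfsLayer, ← this]
  | succ k ih =>
    intro hk
    have ih := ih (Nat.le_of_succ_le hk)
    have hkey : ∀ w ∈ bfsLayer G v σ (k + 1),
        bfsKey G v (θ.symm.trans σ) (bfsLayer G v (θ.symm.trans σ) k) (θ w) =
          bfsKey G v σ (bfsLayer G v σ k) w := by
      intro w hw
      obtain ⟨h1, h2⟩ := mem_bfsLayer.mp hw
      obtain ⟨p, hp⟩ := exists_bfsPar σ h1 h2
      have hf := hθ.find σ (Nat.le_of_succ_le hk) h1 (h2.trans_le hk)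
      rw [hp] at hf
      unfold bfsPar at hp
      simp only [bfsKey, ih, hf, hp, Option.map_some, Option.getD_some,
        idxOf_map_of_injective θ.injective, Equiv.trans_apply, Equiv.symm_apply_apply]
    refine List.Perm.eq_of_pairwise (le := fun a b =>
        bfsKey G v (θ.symm.trans σ) (bfsLayer G v (θ.symm.trans σ) k) a ≤
          bfsKey G v (θ.symm.trans σ) (bfsLayer G v (θ.symm.trans σ) k) b)
      (fun a b _ _ h h' => bfsKey_injective _ _ _ _ (le_antisymm h h'))
      (pairwise_bfsLayer_succ G v _ k) ?_ ?_
    · rw [List.pairwise_map]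
      refine (pairwise_bfsLayer_succ G v σ k).imp_of_mem fun ha hb h => ?_
      rwa [hkey _ ha, hkey _ hb]
    · rw [List.perm_ext_iff_of_nodup (nodup_bfsLayer _ _ _ _ _)
        ((nodup_bfsLayer _ _ _ _ _).map θ.injective)]
      intro w
      rw [mem_bfsLayer, List.mem_map]
      constructor
      · intro h
        refine ⟨θ.symm w, mem_bfsLayer.mpr ((hθ.layer (k + 1) hk _).mp ?_),
          θ.apply_symm_apply w⟩
        rwa [θ.apply_symm_apply]
      · rintro ⟨u, hu, rfl⟩
        exact (hθ.layer (k + 1) hk u).mpr (mem_bfsLayer.mp hu)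

lemma BallAut.bfsPath_map {n r : ℕ} {G : SimpleGraph (Fin n)} {v : Fin n}
    {θ : Equiv.Perm (Fin n)} (hθ : BallAut r G v θ) (σ : Equiv.Perm (Fin n)) (k : ℕ) :
    k ≤ r → ∀ w, G.Reachable v w → G.dist v w = k →
      bfsPath G v (θ.symm.trans σ) (θ w) = bfsPath G v σ w := by
  have hpar : ∀ k, k + 1 ≤ r → ∀ w, G.Reachable v w → G.dist v w = k + 1 →
      bfsPar G v (θ.symm.trans σ) k (θ w) = (bfsPar G v σ k w).map θ := by
    intro k hk w hw hwk
    rw [← hθ.find σ (Nat.le_of_succ_le hk) hw (hwk.trans_le hk), bfsPar,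
      hθ.bfsLayer_map σ k (Nat.le_of_succ_le hk)]
  induction k with
  | zero =>
    intro _ w hw hwk
    obtain ⟨h1, h2⟩ := (hθ.layer 0 (Nat.zero_le r) w).mpr ⟨hw, hwk⟩
    rw [← hw.dist_eq_zero_iff.mp hwk]
    rw [← hw.dist_eq_zero_iff.mp hwk] at h1 h2
    rw [← h1.dist_eq_zero_iff.mp h2, bfsPath_self, bfsPath_self]
  | succ k ih =>
    intro hk w hw hwk
    obtain ⟨h1, h2⟩ := (hθ.layer (k + 1) hk w).mpr ⟨hw, hwk⟩
    obtain ⟨p, hp⟩ := exists_bfsPar σ hw hwk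
    obtain ⟨-, hpr, hpk⟩ := bfsPar_eq_some hp
    have hp' := hpar k hk w hw hwk
    rw [hp, Option.map_some] at hp'
    rw [bfsPath_succ h1 h2 hp', bfsPath_succ hw hwk hp, ih (Nat.le_of_succ_le hk) p hpr hpk]
    have hc : bfsChild G v (θ.symm.trans σ) k (θ p) = (bfsChild G v σ k p).map θ := by
      rw [bfsChild, bfsChild, hθ.bfsLayer_map σ (k + 1) hk, List.filter_map]
      congr 1
      refine List.filter_congr fun u hu => ?_
      obtain ⟨hu1, hu2⟩ := mem_bfsLayer.mp hu
      simp only [Function.comp, hpar k hk u hu1 hu2]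
      refine decide_eq_decide.mpr ?_
      rw [← Option.map_some, (Option.map_injective θ.injective).eq_iff]
    rw [hc, idxOf_map_of_injective θ.injective]

lemma BallAut.bfsMap_comp {n r d : ℕ} {G : SimpleGraph (Fin n)} {v : Fin n}
    {θ : Equiv.Perm (Fin n)} (hθ : BallAut r G v θ) (hv : IsNice r G v)
    (hG : G ∈ regularGraphs d n) (σ : Equiv.Perm (Fin n)) :
    bfsMap d r G v (θ.symm.trans σ) = θ ∘ bfsMap d r G v σ := by
  funext t
  have h := hv.bfsPath_bfsMap hG σ t
  obtain ⟨h1, h2⟩ := bfsPath_reachable h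
  refine bfsPath_injective t.1.1 _ _ (hv.bfsPath_bfsMap hG _ t) ?_
  rw [Function.comp, hθ.bfsPath_map σ _ t.2 _ h1 h2, h]

section cover

variable {n r d : ℕ} {G : SimpleGraph (Fin n)} {v : Fin n}

lemma SrGraph_adj_iff {s t : ↥(SrSet d r)} : (SrGraph d r).Adj s t ↔
    (∃ i, t.1.1 = i :: s.1.1) ∨ (∃ i, s.1.1 = i :: t.1.1) := Iff.rfl

/-- The parent of a nonroot vertex of `S_r`. -/
lemma exists_parent {t : ↥(SrSet d r)} {i : ℕ} {l : List ℕ} (ht : t.1.1 = i :: l) :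
    l.length + 1 ≤ r ∧ ∃ s : ↥(SrSet d r), s.1.1 = l ∧ (SrGraph d r).Adj s t := by
  have htr : l.length + 1 ≤ r := by
    have := t.2
    simpa [SrSet, ht] using this
  have htv : ValidTd d (i :: l) := ht ▸ t.1.2
  exact ⟨htr, ⟨⟨l, htv.tail⟩, Nat.le_of_succ_le htr⟩, rfl,
    SrGraph_adj_iff.mpr (Or.inl ⟨i, ht⟩)⟩

lemma IsNice.dist_cover (hv : IsNice r G v) {e : ↥(SrSet d r) → Fin n}
    (he : e ∈ covSet (SrGraph d r) G) (hev : e (rootSr d r) = v) (t : ↥(SrSet d r)) :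
    G.Reachable v (e t) ∧ G.dist v (e t) = t.1.1.length := by
  suffices h : ∀ k, ∀ t : ↥(SrSet d r), t.1.1.length ≤ k →
      G.Reachable v (e t) ∧ G.dist v (e t) = t.1.1.length from h _ t le_rfl
  intro k
  have hroot : ∀ t : ↥(SrSet d r), t.1.1 = [] → G.Reachable v (e t) ∧ G.dist v (e t) = 0 := by
    intro t ht
    have : t = rootSr d r := Subtype.ext (Subtype.ext ht)
    rw [this, hev]
    exact ⟨SimpleGraph.Reachable.refl _, SimpleGraph.dist_self⟩
  induction k with
  | zero =>
    intro t ht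
    have ht' := List.length_eq_zero_iff.mp (Nat.le_zero.mp ht)
    rw [ht']
    exact hroot t ht'
  | succ k ih =>
    intro t htk
    cases ht : t.1.1 with
    | nil => exact hroot t ht
    | cons i l =>
      obtain ⟨htr, s, hs, hst⟩ := exists_parent ht
      rw [ht, List.length_cons] at htk
      obtain ⟨hs1, hs2⟩ := ih s (by rw [hs]; omega)
      rw [hs] at hs2
      have ha : G.Adj (e s) (e t) := he.1 s t hst
      have htr' : G.Reachable v (e t) := hs1.trans ha.reachable
      refine ⟨htr', ?_⟩
      have h1 := dist_le_succ_of_adj hs1 ha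
      rw [hs2] at h1
      by_contra hne
      have hle : G.dist v (e t) ≤ l.length := by
        simp only [List.length_cons] at hne
        omega
      cases l with
      | nil =>
        have h3 := hs1.dist_eq_zero_iff.mp hs2
        have h4 := htr'.dist_eq_zero_iff.mp (Nat.le_zero.mp hle)
        exact ha.ne (h3.symm.trans h4)
      | cons j l =>
        obtain ⟨-, s', hs', hss⟩ := exists_parent hs
        simp only [List.length_cons] at htk htr hs2 hle
        obtain ⟨-, hs2'⟩ := ih s' (by rw [hs']; omega)
        have hee := hv (e s) hs1 (by omega) (e t) (e s') ha (he.1 s' s hss).symm (by omega)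
          (by rw [hs2', hs']; omega)
        have htt := he.2 s t s' hst hss.symm hee
        rw [htt, hs'] at ht
        have := congrArg List.length ht
        simp at this
        omega

lemma IsNice.cover_injective (hv : IsNice r G v) {e : ↥(SrSet d r) → Fin n}
    (he : e ∈ covSet (SrGraph d r) G) (hev : e (rootSr d r) = v) : Function.Injective e := by
  suffices h : ∀ l : List ℕ, ∀ t t' : ↥(SrSet d r), t.1.1 = l → e t = e t' → t = t' from
    fun t t' htt => h _ t t' rfl htt
  intro l
  induction l with
  | nil =>
    intro t t' ht htt
    have h1 := (hv.dist_cover he hev t).2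
    rw [htt, (hv.dist_cover he hev t').2, ht] at h1
    exact Subtype.ext (Subtype.ext (ht.trans (List.length_eq_zero_iff.mp h1).symm))
  | cons i l ih =>
    intro t t' ht htt
    have h1 := (hv.dist_cover he hev t).2
    rw [htt, (hv.dist_cover he hev t').2, ht] at h1
    cases ht' : t'.1.1 with
    | nil => rw [ht'] at h1; simp at h1
    | cons i' l' =>
      rw [ht', List.length_cons, List.length_cons] at h1
      obtain ⟨htr, s, hs, hst⟩ := exists_parent ht
      obtain ⟨-, s', hs', hst'⟩ := exists_parent ht'
      obtain ⟨hr1, hk1⟩ := hv.dist_cover he hev t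
      have hks := (hv.dist_cover he hev s).2
      have hks' := (hv.dist_cover he hev s').2
      rw [ht, List.length_cons] at hk1
      rw [hs] at hks
      rw [hs'] at hks'
      have hss := hv (e t) hr1 (by omega) (e s) (e s') (he.1 s t hst).symm
        (htt ▸ (he.1 s' t' hst').symm) (by omega) (by omega)
      obtain rfl := ih s s' hs hss
      exact he.2 s t t' hst hst' htt

lemma IsNice.range_bfsMap (hv : IsNice r G v) (hG : G ∈ regularGraphs d n)
    (σ : Equiv.Perm (Fin n)) :
    Set.range (bfsMap d r G v σ) = {w | G.Reachable v w ∧ G.dist v w ≤ r} := by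
  ext w
  constructor
  · rintro ⟨t, rfl⟩
    obtain ⟨h1, h2⟩ := bfsPath_reachable (hv.bfsPath_bfsMap hG σ t)
    exact ⟨h1, h2.trans_le t.2⟩
  · rintro ⟨h1, h2⟩
    obtain ⟨l, hl, hk⟩ := exists_bfsPath σ _ w h1 rfl
    exact ⟨⟨⟨l, bfsPath_valid hG l w hl⟩, hk.trans_le h2⟩,
      bfsPath_injective l _ _ (hv.bfsPath_bfsMap hG σ _) hl⟩

lemma IsNice.range_cover (hv : IsNice r G v) (hG : G ∈ regularGraphs d n)
    {e : ↥(SrSet d r) → Fin n} (he : e ∈ covSet (SrGraph d r) G) (hev : e (rootSr d r) = v) :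
    Set.range e = {w | G.Reachable v w ∧ G.dist v w ≤ r} := by
  have hb := hv.range_bfsMap hG (Equiv.refl _)
  refine Set.eq_of_subset_of_ncard_le ?_ ?_ (Set.toFinite _)
  · rintro _ ⟨t, rfl⟩
    obtain ⟨h1, h2⟩ := hv.dist_cover he hev t
    exact ⟨h1, h2.trans_le t.2⟩
  · rw [← hb, ← Set.image_univ, ← Set.image_univ,
      Set.ncard_image_of_injective _ (hv.cover_injective he hev)]
    exact Set.ncard_image_le

lemma IsNice.cover_adj (hv : IsNice r G v) {e : ↥(SrSet d r) → Fin n}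
    (he : e ∈ covSet (SrGraph d r) G) (hev : e (rootSr d r) = v) (s t : ↥(SrSet d r)) :
    G.Adj (e s) (e t) ↔ (SrGraph d r).Adj s t := by
  refine ⟨?_, he.1 s t⟩
  have key : ∀ s t : ↥(SrSet d r), s.1.1.length ≤ t.1.1.length → G.Adj (e s) (e t) →
      (SrGraph d r).Adj s t := by
    intro s t hst ha
    obtain ⟨hr1, hk1⟩ := hv.dist_cover he hev t
    have hks := (hv.dist_cover he hev s).2
    cases ht : t.1.1 with
    | nil =>
      have hs : s.1.1 = [] := by
        rw [ht] at hst
        exact List.length_eq_zero_iff.mp (Nat.le_zero.mp hst)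
      have : s = t := Subtype.ext (Subtype.ext (hs.trans ht.symm))
      exact absurd (congrArg e this) ha.ne
    | cons i l =>
      obtain ⟨htr, u, hu, hut⟩ := exists_parent ht
      have hku := (hv.dist_cover he hev u).2
      have hl : t.1.1.length = l.length + 1 := by rw [ht, List.length_cons]
      rw [hu] at hku
      have := hv (e t) hr1 (by omega) (e s) (e u) ha.symm (he.1 u t hut).symm (by omega)
        (by omega)
      rwa [hv.cover_injective he hev this]
  intro h
  rcases le_total s.1.1.length t.1.1.length with hl | hl
  · exact key s t hl h
  · exact (key t s hl h.symm).symm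

lemma IsNice.exists_ballAut (hv : IsNice r G v) (hG : G ∈ regularGraphs d n)
    {e e' : ↥(SrSet d r) → Fin n} (he : e ∈ covSet (SrGraph d r) G)
    (hev : e (rootSr d r) = v) (he' : e' ∈ covSet (SrGraph d r) G)
    (hev' : e' (rootSr d r) = v) : ∃ θ, BallAut r G v θ ∧ θ ∘ e = e' := by
  have hi := hv.cover_injective he hev
  have hi' := hv.cover_injective he' hev'
  have hr := hv.range_cover hG he hev
  have hr' := hv.range_cover hG he' hev'
  have hrr : Set.range e' = Set.range e := hr'.trans hr.symm
  let τ : Equiv.Perm ↥(Set.range e) := (Equiv.ofInjective e hi).symm.trans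
    ((Equiv.ofInjective e' hi').trans (Equiv.setCongr hrr))
  let θ : Equiv.Perm (Fin n) := Equiv.Perm.ofSubtype τ
  have hθ : ∀ t, θ (e t) = e' t := by
    intro t
    have h1 : θ (e t) = τ ⟨e t, t, rfl⟩ :=
      Equiv.Perm.ofSubtype_apply_of_mem τ (⟨t, rfl⟩ : e t ∈ Set.range e)
    have h2 : (Equiv.ofInjective e hi).symm ⟨e t, t, rfl⟩ = t :=
      (Equiv.symm_apply_eq _).mpr rfl
    rw [h1]
    simp only [τ, Equiv.trans_apply, h2]
    rfl
  have hθn : ∀ w, w ∉ Set.range e → θ w = w := fun w hw =>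
    Equiv.Perm.ofSubtype_apply_of_not_mem τ hw
  refine ⟨θ, ⟨?_, ?_⟩, funext hθ⟩
  · intro k hk w
    by_cases hw : w ∈ Set.range e
    · obtain ⟨t, rfl⟩ := hw
      rw [hθ]
      obtain ⟨h1, h2⟩ := hv.dist_cover he hev t
      obtain ⟨h1', h2'⟩ := hv.dist_cover he' hev' t
      rw [h2, h2']
      simp only [h1, h1']
    · rw [hθn w hw]
  · intro w w' h1 h2 h1' h2'
    have hw : w ∈ Set.range e := hr ▸ ⟨h1, h2⟩
    have hw' : w' ∈ Set.range e := hr ▸ ⟨h1', h2'⟩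
    obtain ⟨t, rfl⟩ := hw
    obtain ⟨t', rfl⟩ := hw'
    rw [hθ, hθ, hv.cover_adj he' hev', hv.cover_adj he hev]

lemma IsNice.card_bfsMap_le (hv : IsNice r G v) (hG : G ∈ regularGraphs d n)
    {e e' : ↥(SrSet d r) → Fin n} (he : e ∈ covSet (SrGraph d r) G)
    (hev : e (rootSr d r) = v) (he' : e' ∈ covSet (SrGraph d r) G)
    (hev' : e' (rootSr d r) = v) :
    (Finset.univ.filter fun σ => bfsMap d r G v σ = e).card ≤
      (Finset.univ.filter fun σ => bfsMap d r G v σ = e').card := by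
  obtain ⟨θ, hθ, rfl⟩ := hv.exists_ballAut hG he hev he' hev'
  refine Finset.card_le_card_of_injOn (fun σ => θ.symm.trans σ) ?_ ?_
  · intro σ hσ
    simp only [Finset.coe_filter, Finset.mem_univ, true_and, Set.mem_ofPred_eq] at hσ ⊢
    rw [hθ.bfsMap_comp hv hG, hσ]
  · intro σ _ σ' _ h
    ext w
    have := congrArg (fun ρ : Equiv.Perm (Fin n) => ρ (θ w)) h
    simpa using congrArg Fin.val this

/-- At a tree-like vertex the breadth-first-search map is uniformly distributed over the rooted
locally injective homomorphisms. -/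
lemma IsNice.card_bfsMap (hv : IsNice r G v) (hG : G ∈ regularGraphs d n)
    (P : (↥(SrSet d r) → Fin n) → Prop) :
    (Finset.univ.filter fun σ => P (bfsMap d r G v σ)).card *
        {e ∈ covSet (SrGraph d r) G | e (rootSr d r) = v}.ncard =
      n.factorial * {e ∈ covSet (SrGraph d r) G | e (rootSr d r) = v ∧ P e}.ncard := by
  let e₀ := bfsMap d r G v (Equiv.refl _)
  have h₀ := hv.bfsMap_mem_covSet hG (Equiv.refl _)
  have h₀' := hv.bfsMap_root hG (Equiv.refl _)
  let N := (Finset.univ.filter fun σ => bfsMap d r G v σ = e₀).card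
  have hN : ∀ e, e ∈ covSet (SrGraph d r) G → e (rootSr d r) = v →
      (Finset.univ.filter fun σ => bfsMap d r G v σ = e).card = N := fun e he hev =>
    le_antisymm (hv.card_bfsMap_le hG he hev h₀ h₀') (hv.card_bfsMap_le hG h₀ h₀' he hev)
  have key : ∀ P : (↥(SrSet d r) → Fin n) → Prop,
      (Finset.univ.filter fun σ => P (bfsMap d r G v σ)).card =
        {e ∈ covSet (SrGraph d r) G | e (rootSr d r) = v ∧ P e}.ncard * N := by
    intro P
    rw [Set.ncard_eq_toFinset_card', Finset.card_eq_sum_card_fiberwise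
      (f := fun σ => bfsMap d r G v σ)
      (t := {e ∈ covSet (SrGraph d r) G | e (rootSr d r) = v ∧ P e}.toFinset)
      (fun σ hσ => by
        have hσ' : P (bfsMap d r G v σ) := by simpa using hσ
        exact Set.mem_toFinset.mpr ⟨hv.bfsMap_mem_covSet hG σ, hv.bfsMap_root hG σ, hσ'⟩)]
    refine Finset.sum_const_nat fun e he => ?_
    have he' : e ∈ covSet (SrGraph d r) G ∧ e (rootSr d r) = v ∧ P e :=
      Set.mem_toFinset (s := {e ∈ covSet (SrGraph d r) G | e (rootSr d r) = v ∧ P e}).mp he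
    rw [← hN e he'.1 he'.2.1, Finset.filter_filter]
    congr 1
    refine Finset.filter_congr fun σ _ => ⟨fun h => h.2, fun h => ⟨h ▸ he'.2.2, h⟩⟩
  have h1 := key fun _ => True
  have h2 := key P
  have h3 : n.factorial =
      {e ∈ covSet (SrGraph d r) G | e (rootSr d r) = v ∧ True}.ncard * N := by
    rw [← h1]
    simp [Fintype.card_perm]
  simp only [and_true] at h3
  rw [h2, h3]
  ring

end cover

/-! ### Vertices without a tree-like neighborhood are close to short cycles -/

lemma exists_walk_avoiding {n : ℕ} {G : SimpleGraph (Fin n)} {v w u : Fin n}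
    (hu : G.Reachable v u) (hd : G.dist v u ≤ G.dist v w) (hne : w ≠ u) :
    ∃ p : G.Walk v u, p.length = G.dist v u ∧ w ∉ p.support := by
  obtain ⟨p, hp⟩ := hu.exists_walk_length_eq_dist
  refine ⟨p, hp, fun hw => ?_⟩
  have h1 := SimpleGraph.dist_le (p.takeUntil w hw)
  have h2 := p.length_takeUntil_lt_length hw hne
  omega

lemma exists_cycle_of_not_isNice {n r : ℕ} {G : SimpleGraph (Fin n)} {v : Fin n}
    (h : ¬ IsNice r G v) : ∃ k < 2 * r, ∃ e : Fin (k + 2 + 1) → Fin n,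
      (Function.Injective e ∧ ∀ i, G.Adj (e i) (e (i + 1))) ∧
        G.Reachable v (e 0) ∧ G.dist v (e 0) ≤ r := by
  simp only [IsNice, not_forall] at h
  obtain ⟨w, hr, hwr, u, u', hu, hu', hd, hd', hne⟩ := h
  obtain ⟨p, hp, hpw⟩ := exists_walk_avoiding (hr.trans hu.reachable) hd hu.ne
  obtain ⟨p', hp', hpw'⟩ := exists_walk_avoiding (hr.trans hu'.reachable) hd' hu'.ne
  set q := (p.reverse.append p').bypass with hq
  have hqp : q.IsPath := SimpleGraph.Walk.bypass_isPath _
  have hqw : w ∉ q.support := fun hw => by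
    have := (p.reverse.append p').support_bypass_subset_support hw
    rw [SimpleGraph.Walk.mem_support_append_iff, SimpleGraph.Walk.support_reverse,
      List.mem_reverse] at this
    exact this.elim hpw hpw'
  have hql : q.length ≤ 2 * r := by
    have := (p.reverse.append p').length_bypass_le_length
    rw [SimpleGraph.Walk.length_append, SimpleGraph.Walk.length_reverse, ← hq] at this
    omega
  have hq0 : q.length ≠ 0 := fun h0 => hne (SimpleGraph.Walk.eq_of_length_eq_zero h0)
  obtain ⟨k, hk⟩ := Nat.exists_eq_succ_of_ne_zero hq0
  have hinj : Function.Injective fun i : Fin (k + 2) => q.getVert i := by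
    intro i j hij
    exact Fin.ext (hqp.getVert_injOn (by simp only [Set.mem_ofPred_eq]; omega)
      (by simp only [Set.mem_ofPred_eq]; omega) hij)
  refine ⟨k, by omega, Fin.cons w fun i : Fin (k + 2) => q.getVert i, ⟨?_, ?_⟩, ?_, ?_⟩
  · rw [Fin.cons_injective_iff]
    refine ⟨?_, hinj⟩
    rintro ⟨i, hi⟩
    exact hqw (hi ▸ q.getVert_mem_support i)
  · intro i
    refine Fin.cases ?_ (fun j => ?_) i
    · have : (0 : Fin (k + 2 + 1)) + 1 = Fin.succ 0 := by simp
      rw [this, Fin.cons_zero, Fin.cons_succ]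
      simpa using hu
    · rw [Fin.cons_succ]
      refine Fin.lastCases ?_ (fun j => ?_) j
      · have : (Fin.last (k + 1)).succ + 1 = (0 : Fin (k + 2 + 1)) := by
          rw [Fin.succ_last, Fin.last_add_one]
        rw [this, Fin.cons_zero]
        have h1 : q.getVert (k + 1) = u' := by
          rw [← Nat.succ_eq_add_one, ← hk, SimpleGraph.Walk.getVert_length]
        simpa [h1] using hu'.symm
      · have : j.castSucc.succ + 1 = (j.succ.succ : Fin (k + 2 + 1)) := by
          rw [Fin.succ_castSucc, Fin.coeSucc_eq_succ]
        rw [this, Fin.cons_succ]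
        simpa using q.adj_getVert_succ (i := j) (by omega)
  · simpa using hr
  · simpa using hwr

lemma mem_ballF_of_walk {n : ℕ} {G : SimpleGraph (Fin n)} {v w : Fin n} (p : G.Walk v w) :
    v ∈ ballF G w p.length := by
  induction p with
  | nil => simp [ballF]
  | cons h p ih => exact ballF_adj ih h.symm

/-- The number of vertices without a tree-like `r`-neighborhood is controlled by the number of
short cycles. -/
lemma card_not_isNice_le {n d r : ℕ} {G : SimpleGraph (Fin n)} (hG : G ∈ regularGraphs d n) :
    (Finset.univ.filter fun v => ¬ IsNice r G v).card ≤
      (d + 1) ^ r * shortCycles (2 * r) G := by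
  have hG' : ∀ v, (G.neighborSet v).ncard ≤ d := fun v => (hG v).le
  let S : ℕ → Finset (Fin n) := fun k =>
    (Finset.univ : Finset {e : Fin (k + 2 + 1) → Fin n //
      Function.Injective e ∧ ∀ i, G.Adj (e i) (e (i + 1))}).biUnion fun e => ballF G (e.1 0) r
  have hS : ∀ k, (S k).card ≤ (d + 1) ^ r * cycCount (k + 2) G := by
    intro k
    refine (Finset.card_biUnion_le_card_mul _ _ ((d + 1) ^ r) fun e _ =>
      ballF_card_le hG' _ _).trans ?_
    rw [mul_comm, cycCount, Finset.card_univ]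
  calc (Finset.univ.filter fun v => ¬ IsNice r G v).card
      ≤ ((Finset.range (2 * r)).biUnion S).card := by
        refine Finset.card_le_card fun v hv => ?_
        obtain ⟨k, hk, e, he, hr, hd⟩ :=
          exists_cycle_of_not_isNice (Finset.mem_filter.mp hv).2
        obtain ⟨p, hp⟩ := hr.exists_walk_length_eq_dist
        exact Finset.mem_biUnion.mpr ⟨k, Finset.mem_range.mpr hk, Finset.mem_biUnion.mpr
          ⟨⟨e, he⟩, Finset.mem_univ _, ballF_mono G _ (hp.trans_le hd) (mem_ballF_of_walk p)⟩⟩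
    _ ≤ ∑ k ∈ Finset.range (2 * r), (S k).card := Finset.card_biUnion_le
    _ ≤ (d + 1) ^ r * shortCycles (2 * r) G := by
        rw [shortCycles, Finset.mul_sum]
        exact Finset.sum_le_sum fun k _ => hS k

lemma not_isNice_rare (d : ℕ) (hd : 0 < d) (r : ℕ) (δ η : ℝ) (hδ : 0 < δ) (hη : 0 < η) :
    ∀ᶠ n in goodFilter d, PrG d n {G | δ * n <
      ((Finset.univ.filter fun v => ¬ IsNice r G v).card : ℝ)} ≤ η := by
  have hD : (0 : ℝ) < (d + 1 : ℝ) ^ r := by positivity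
  filter_upwards [shortCycles_rare d hd (2 * r) (δ / (d + 1 : ℝ) ^ r) η (by positivity) hη]
    with n hn
  refine le_trans ?_ hn
  unfold PrG
  refine div_le_div_of_nonneg_right ?_ (Nat.cast_nonneg _)
  refine Nat.cast_le.mpr (Set.ncard_le_ncard ?_ (Set.toFinite _))
  rintro G ⟨hG, h⟩
  refine ⟨hG, ?_⟩
  have h1 : ((Finset.univ.filter fun v => ¬ IsNice r G v).card : ℝ) ≤
      (d + 1 : ℝ) ^ r * shortCycles (2 * r) G := by
    exact_mod_cast card_not_isNice_le hG
  have h2 : δ * n < _ := h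
  rw [Set.mem_ofPred_eq, div_mul_eq_mul_div, div_lt_iff₀ hD]
  linarith

/-! ### Local averages along the breadth-first search -/

lemma resS_resS {M : Type*} (r : ℕ) (g : RCG M) : resS r (resS r g) = resS r g := by
  refine RCG.ext ?_ ?_
  · funext l
    simp only [resS]
    split_ifs <;> rfl
  · funext p
    simp only [resS]
    split_ifs <;> rfl

lemma resS_iotaSr {M : Type*} (d r : ℕ) (x : ↥(SrSet d r) → M) :
    resS r (iotaSr d r x) = iotaSr d r x := by
  refine RCG.ext ?_ ?_
  · funext l
    simp only [resS, iotaSr]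
    by_cases h : l.length ≤ r
    · rw [if_pos h]
    · rw [if_neg h, dif_neg fun h' => h h'.2]
  · funext p
    simp only [resS, iotaSr]
    by_cases h : p.1.length ≤ r ∧ p.2.length ≤ r
    · rw [if_pos h]
    · rw [if_neg h, if_neg fun h' => h ⟨h'.2.2.1, h'.2.2.2.1⟩]

lemma iotaSr_injective {M : Type*} (d r : ℕ) :
    Function.Injective (iotaSr d r : (↥(SrSet d r) → M) → RCG M) := by
  intro x y h
  funext t
  have h1 := congrFun (congrArg RCG.col h) t.1.1
  have ht : ValidTd d t.1.1 ∧ t.1.1.length ≤ r := ⟨t.1.2, t.2⟩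
  simp only [iotaSr] at h1
  rw [dif_pos ht, dif_pos ht, Option.some_inj] at h1
  exact h1

lemma IsRadiusRFn.comp_resS {M : Type*} {r : ℕ} {ψ : RCG M → ℝ} (hψ : IsRadiusRFn r ψ)
    (g : RCG M) : ψ (resS r g) = ψ g := by
  refine hψ _ _ ?_
  rw [resS_resS]
  exact ⟨Equiv.refl _, fun _ => rfl, fun _ _ => rfl, fun _ _ => rfl⟩

lemma dist_eq_rcgDist {M : Type*} (g g' : RCG M) : dist g g' = rcgDist g g' := rfl

lemma resS_eq_of_dist_lt {M : Type*} {r : ℕ} {g g' : RCG M} (h : dist g g' < (2 : ℝ)⁻¹ ^ r) :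
    resS r g = resS r g' := by
  by_contra hne
  have h0 : ∀ k, (0 : ℝ) ≤ if resS k g = resS k g' then 0 else 2⁻¹ ^ k := fun k => by
    split_ifs <;> positivity
  have h2 : Summable fun k => if resS k g = resS k g' then (0 : ℝ) else 2⁻¹ ^ k :=
    Summable.of_nonneg_of_le h0 (fun k => by split_ifs <;> first | positivity | exact le_rfl)
      (summable_geometric_of_lt_one (by norm_num : (0 : ℝ) ≤ 2⁻¹) (by norm_num))
  have h1 := h2.le_tsum r fun k _ => h0 k
  rw [if_neg hne] at h1
  rw [dist_eq_rcgDist, rcgDist] at h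
  linarith

lemma isOpen_resS_preimage {M : Type*} (r : ℕ) (A : Set (RCG M)) : IsOpen (resS r ⁻¹' A) := by
  refine Metric.isOpen_iff.mpr fun g hg => ⟨(2 : ℝ)⁻¹ ^ r, by positivity, fun g' hg' => ?_⟩
  rw [Set.mem_preimage, resS_eq_of_dist_lt (Metric.mem_ball.mp hg')]
  exact hg

lemma measurable_resS {M : Type*} (r : ℕ) : Measurable (resS r : RCG M → RCG M) :=
  fun A _ => (isOpen_resS_preimage r A).measurableSet

/-- The rooted colored graphs of radius `r` all of whose labels have digits at most `d`. -/
def locRange (d r : ℕ) (M : Type*) : Set (RCG M) :=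
  {g | (∀ l, ¬ (l.length ≤ r ∧ ∀ i ∈ l, i ≤ d) → g.col l = none) ∧
    ∀ p : List ℕ × List ℕ, ¬ ((p.1.length ≤ r ∧ ∀ i ∈ p.1, i ≤ d) ∧
      (p.2.length ≤ r ∧ ∀ i ∈ p.2, i ≤ d)) → g.adj p = false}

lemma finite_locRange (d r : ℕ) (M : Type*) [Finite M] : (locRange d r M).Finite := by
  let S := {l : List ℕ | l.length ≤ r ∧ ∀ i ∈ l, i ≤ d}
  have : Finite S := (finite_lists_le d r).to_subtype
  have hinj : Set.InjOn (fun g : RCG M => ((fun l : S => g.col l.1,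
      fun p : S × S => g.adj (p.1.1, p.2.1)) : (S → Option M) × (S × S → Bool)))
      (locRange d r M) := by
    rintro g ⟨hg1, hg2⟩ g' ⟨hg1', hg2'⟩ h
    have h1 := congrArg Prod.fst h
    have h2 := congrArg Prod.snd h
    refine RCG.ext ?_ ?_
    · funext l
      by_cases hl : l ∈ S
      · exact congrFun h1 ⟨l, hl⟩
      · rw [hg1 l hl, hg1' l hl]
    · funext p
      by_cases hp : p.1 ∈ S ∧ p.2 ∈ S
      · exact congrFun h2 (⟨p.1, hp.1⟩, ⟨p.2, hp.2⟩)
      · rw [hg2 p hp, hg2' p hp]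
  exact Set.Finite.of_finite_image (Set.toFinite _) hinj

lemma resS_bfsRCG_mem_locRange {M : Type*} {n d : ℕ} (r : ℕ) {G : SimpleGraph (Fin n)}
    (hG : G ∈ regularGraphs d n) (f : Fin n → M) (v : Fin n) (σ : Equiv.Perm (Fin n)) :
    resS r (bfsRCG G f v σ) ∈ locRange d r M := by
  refine ⟨fun l hl => ?_, fun p hp => ?_⟩
  · simp only [resS, bfsRCG]
    split_ifs with h1 h2
    · obtain ⟨w, hw⟩ := h2
      exact absurd ⟨h1, (bfsPath_valid hG l w hw).mem_le⟩ hl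
    · rfl
    · rfl
  · simp only [resS, bfsRCG]
    split_ifs with h1 h2
    · obtain ⟨w, w', hw, hw', -⟩ := h2
      exact absurd ⟨⟨h1.1, (bfsPath_valid hG _ w hw).mem_le⟩,
        h1.2, (bfsPath_valid hG _ w' hw').mem_le⟩ hp
    · rfl
    · rfl

lemma iotaSr_mem_locRange {M : Type*} (d r : ℕ) (x : ↥(SrSet d r) → M) :
    iotaSr d r x ∈ locRange d r M := by
  refine ⟨fun l hl => ?_, fun p hp => ?_⟩
  · simp only [iotaSr]
    exact dif_neg fun h => hl ⟨h.2, h.1.mem_le⟩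
  · simp only [iotaSr]
    exact if_neg fun h => hp ⟨⟨h.2.2.1, h.1.mem_le⟩, h.2.2.2.1, h.2.1.mem_le⟩

/-- The average of `g` over the random labelings of the component of `v`. -/
def bfsAvg {M : Type*} {n : ℕ} (G : SimpleGraph (Fin n)) (f : Fin n → M) (g : RCG M → ℝ)
    (v : Fin n) : ℝ :=
  (n.factorial : ℝ)⁻¹ * ∑ σ : Equiv.Perm (Fin n), g (bfsRCG G f v σ)

/-- The proportion of rooted locally injective homomorphisms at `v` inducing the coloring `x`. -/
def coverFreq (d r κ : ℕ) {M : Type*} {n : ℕ} (G : SimpleGraph (Fin n)) (f : Fin n → M)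
    (v : Fin n) (x : ↥(SrSet d r) → M) : ℝ :=
  {e ∈ covSet (SrGraph d r) G | e (rootSr d r) = v ∧ f ∘ e = x}.ncard / κ

lemma sum_coverFreq {d r κ : ℕ} {M : Type*} [Fintype M] {n : ℕ} {G : SimpleGraph (Fin n)}
    (hκ0 : 0 < κ) {v : Fin n} (hκ : {e ∈ covSet (SrGraph d r) G | e (rootSr d r) = v}.ncard = κ)
    (f : Fin n → M) : ∑ x, coverFreq d r κ G f v x = 1 := by
  have h : ∑ x, {e ∈ covSet (SrGraph d r) G | e (rootSr d r) = v ∧ f ∘ e = x}.ncard = κ := by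
    rw [← hκ, Set.ncard_eq_toFinset_card', Finset.card_eq_sum_card_fiberwise
      (f := fun e => f ∘ e) (t := Finset.univ) fun _ _ => Finset.mem_coe.mpr (Finset.mem_univ _)]
    refine Finset.sum_congr rfl fun x _ => ?_
    rw [Set.ncard_eq_toFinset_card']
    congr 1
    ext e
    simp only [Finset.mem_filter, Set.mem_toFinset, Set.mem_ofPred_eq]
    tauto
  unfold coverFreq
  rw [← Finset.sum_div, ← Nat.cast_sum, h, div_self (Nat.cast_ne_zero.mpr hκ0.ne')]

lemma coverFreq_nonneg {d r κ : ℕ} {M : Type*} {n : ℕ} (G : SimpleGraph (Fin n))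
    (f : Fin n → M) (v : Fin n) (x : ↥(SrSet d r) → M) : 0 ≤ coverFreq d r κ G f v x :=
  div_nonneg (Nat.cast_nonneg _) (Nat.cast_nonneg _)

lemma empVec_eq_sum (d r κ : ℕ) {M : Type*} {n : ℕ} (G : SimpleGraph (Fin n)) (f : Fin n → M)
    (x : ↥(SrSet d r) → M) :
    empVec d r κ G f x = (n : ℝ)⁻¹ * ∑ v, coverFreq d r κ G f v x := by
  have h : covCount d r G f x =
      ∑ v, {e ∈ covSet (SrGraph d r) G | e (rootSr d r) = v ∧ f ∘ e = x}.ncard := by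
    rw [covCount, Set.ncard_eq_toFinset_card', Finset.card_eq_sum_card_fiberwise
      (f := fun e => e (rootSr d r)) (t := Finset.univ)
      fun _ _ => Finset.mem_coe.mpr (Finset.mem_univ _)]
    refine Finset.sum_congr rfl fun v _ => ?_
    rw [Set.ncard_eq_toFinset_card']
    congr 1
    ext e
    simp only [Finset.mem_filter, Set.mem_toFinset, Set.mem_ofPred_eq]
    tauto
  unfold coverFreq
  rw [empVec, h, ← Finset.sum_div, ← Nat.cast_sum, ← div_div, div_eq_inv_mul _ (n : ℝ),
    mul_div_assoc]

lemma IsNice.bfsAvg_eq {d r κ n : ℕ} {M : Type*} [Fintype M] {G : SimpleGraph (Fin n)}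
    {v : Fin n} (hv : IsNice r G v) (hG : G ∈ regularGraphs d n) (hκ0 : 0 < κ)
    (hκ : {e ∈ covSet (SrGraph d r) G | e (rootSr d r) = v}.ncard = κ) (f : Fin n → M)
    {g : RCG M → ℝ} (hg : ∀ x, g (resS r x) = g x) :
    bfsAvg G f g v = ∑ x, coverFreq d r κ G f v x * g (iotaSr d r x) := by
  have h1 : ∀ σ : Equiv.Perm (Fin n), g (bfsRCG G f v σ) =
      ∑ x, if f ∘ bfsMap d r G v σ = x then g (iotaSr d r x) else 0 := by
    intro σ
    rw [← hg, hv.resS_bfsRCG hG, Finset.sum_ite_eq, if_pos (Finset.mem_univ _)]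
  simp only [bfsAvg, h1]
  rw [Finset.sum_comm, Finset.mul_sum]
  refine Finset.sum_congr rfl fun x _ => ?_
  rw [← Finset.sum_filter, Finset.sum_const, nsmul_eq_mul, ← mul_assoc]
  congr 1
  have h2 := hv.card_bfsMap hG fun e => f ∘ e = x
  rw [hκ] at h2
  have h3 : (κ : ℝ) ≠ 0 := Nat.cast_ne_zero.mpr hκ0.ne'
  have h4 : (n.factorial : ℝ) ≠ 0 := Nat.cast_ne_zero.mpr n.factorial_ne_zero
  rw [coverFreq, eq_div_iff h3, mul_assoc, inv_mul_eq_iff_eq_mul₀ h4]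
  have h5 : (({σ | f ∘ bfsMap d r G v σ = x} : Finset (Equiv.Perm (Fin n))).card : ℝ) * κ =
    n.factorial * {e ∈ covSet (SrGraph d r) G | e (rootSr d r) = v ∧ f ∘ e = x}.ncard := by
    rw [← Nat.cast_mul, ← Nat.cast_mul, ← h2]
    congr!
  exact h5

lemma abs_bfsAvg_le {d r n : ℕ} {M : Type*} {G : SimpleGraph (Fin n)}
    (hG : G ∈ regularGraphs d n) (f : Fin n → M) {g : RCG M → ℝ}
    (hg : ∀ x, g (resS r x) = g x) {B : ℝ} (hB : ∀ x ∈ locRange d r M, |g x| ≤ B) (v : Fin n) :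
    |bfsAvg G f g v| ≤ B := by
  have h4 : (0 : ℝ) < n.factorial := Nat.cast_pos.mpr n.factorial_pos
  rw [bfsAvg, abs_mul, abs_of_pos (inv_pos.mpr h4), inv_mul_le_iff₀ h4]
  refine (Finset.abs_sum_le_sum_abs _ _).trans ?_
  refine (Finset.sum_le_sum fun σ _ => (?_ : |g (bfsRCG G f v σ)| ≤ B)).trans ?_
  · rw [← hg]
    exact hB _ (resS_bfsRCG_mem_locRange r hG f v σ)
  · simp [Fintype.card_perm]

/-- Local averages agree with averages against the empirical vector up to the proportion of
vertices which do not have a tree-like neighborhood. -/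
lemma abs_avg_bfsAvg_sub_le {d r κ n : ℕ} {M : Type*} [Fintype M] {G : SimpleGraph (Fin n)}
    (hG : G ∈ regularGraphs d n) (hκ0 : 0 < κ)
    (hκ : ∀ v, {e ∈ covSet (SrGraph d r) G | e (rootSr d r) = v}.ncard = κ) (f : Fin n → M)
    {g : RCG M → ℝ} (hg : ∀ x, g (resS r x) = g x) {B : ℝ}
    (hB : ∀ x ∈ locRange d r M, |g x| ≤ B) :
    |(n : ℝ)⁻¹ * ∑ v, bfsAvg G f g v - ∑ x, empVec d r κ G f x * g (iotaSr d r x)| ≤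
      2 * B * ((Finset.univ.filter fun v => ¬ IsNice r G v).card / n) := by
  have h1 : ∑ x, empVec d r κ G f x * g (iotaSr d r x) =
      (n : ℝ)⁻¹ * ∑ v, ∑ x, coverFreq d r κ G f v x * g (iotaSr d r x) := by
    simp only [empVec_eq_sum]
    rw [Finset.sum_comm, Finset.mul_sum]
    exact Finset.sum_congr rfl fun x _ => by rw [mul_assoc, Finset.sum_mul]
  have h2 : ∀ v, |bfsAvg G f g v - ∑ x, coverFreq d r κ G f v x * g (iotaSr d r x)| ≤
      if ¬ IsNice r G v then 2 * B else 0 := by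
    intro v
    split_ifs with hv
    · rw [hv.bfsAvg_eq hG hκ0 (hκ v) f hg, sub_self, abs_zero]
    · have h3 := abs_bfsAvg_le hG f hg hB v
      have h4 : |∑ x, coverFreq d r κ G f v x * g (iotaSr d r x)| ≤ B := by
        refine (Finset.abs_sum_le_sum_abs _ _).trans ?_
        calc ∑ x, |coverFreq d r κ G f v x * g (iotaSr d r x)|
            ≤ ∑ x, coverFreq d r κ G f v x * B := Finset.sum_le_sum fun x _ => by
              rw [abs_mul, abs_of_nonneg (coverFreq_nonneg _ _ _ _)]
              exact mul_le_mul_of_nonneg_left (hB _ (iotaSr_mem_locRange d r x))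
                (coverFreq_nonneg _ _ _ _)
          _ = B := by rw [← Finset.sum_mul, sum_coverFreq hκ0 (hκ v), one_mul]
      exact (abs_sub _ _).trans (by linarith)
  rw [h1, ← mul_sub, ← Finset.sum_sub_distrib, abs_mul, abs_of_nonneg (by positivity),
    div_eq_inv_mul, mul_left_comm]
  refine mul_le_mul_of_nonneg_left ?_ (by positivity)
  refine (Finset.abs_sum_le_sum_abs _ _).trans ((Finset.sum_le_sum fun v _ => h2 v).trans ?_)
  rw [← Finset.sum_filter, Finset.sum_const, nsmul_eq_mul, mul_comm]

lemma integral_distrAt {M : Type*} {n : ℕ} (G : SimpleGraph (Fin n)) (f : Fin n → M)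
    (v : Fin n) (g : RCG M → ℝ) : ∫ x, g x ∂(distrAt G f v) = bfsAvg G f g v := by
  rw [distrAt, integral_smul_measure, integral_finsetSum_measure fun σ _ =>
    integrable_dirac (by simp)]
  simp [bfsAvg]

lemma distrG_real {M : Type*} {n : ℕ} (G : SimpleGraph (Fin n)) (f : Fin n → M) (r : ℕ)
    {A : Set (RCG M)} (hA : MeasurableSet A) : ((distrG G f).map (resS r)).real A =
      (n : ℝ)⁻¹ * ∑ v, bfsAvg G f (fun x => A.indicator 1 (resS r x)) v := by
  have hA' : MeasurableSet (resS r ⁻¹' A) := measurable_resS r hA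
  have hat : ∀ v, (distrAt G f v).real (resS r ⁻¹' A) =
      bfsAvg G f (fun x => A.indicator 1 (resS r x)) v := by
    intro v
    rw [← integral_distrAt, ← integral_indicator_one hA']
    rfl
  rw [Measure.real, Measure.map_apply (measurable_resS r) hA, distrG, Measure.smul_apply,
    Measure.finsetSum_apply, smul_eq_mul, ENNReal.toReal_mul, ENNReal.toReal_inv,
    ENNReal.toReal_natCast, ENNReal.toReal_sum]
  · simp only [← hat, Measure.real]
  · intro v _
    rw [distrAt, Measure.smul_apply, Measure.finsetSum_apply, smul_eq_mul]
    refine ENNReal.mul_ne_top ?_ ?_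
    · simp [Nat.factorial_ne_zero]
    · exact ENNReal.sum_ne_top.mpr fun σ _ => measure_ne_top _ _

/-! ### Microstates and empirical vectors -/

lemma resS_eq_of_le {M : Type*} {j k : ℕ} (hjk : j ≤ k) {g g' : RCG M}
    (h : resS k g = resS k g') : resS j g = resS j g' := by
  refine RCG.ext ?_ ?_
  · funext l
    have h1 := congrFun (congrArg RCG.col h) l
    simp only [resS] at h1 ⊢
    split_ifs with hl
    · rwa [if_pos (hl.trans hjk), if_pos (hl.trans hjk)] at h1
    · rfl
  · funext p
    have h1 := congrFun (congrArg RCG.adj h) p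
    simp only [resS] at h1 ⊢
    split_ifs with hp
    · have hp' : p.1.length ≤ k ∧ p.2.length ≤ k := ⟨hp.1.trans hjk, hp.2.trans hjk⟩
      rwa [if_pos hp', if_pos hp'] at h1
    · rfl

lemma dist_le_of_resS_eq {M : Type*} {k : ℕ} {g g' : RCG M} (h : resS k g = resS k g') :
    dist g g' ≤ 2 * (2 : ℝ)⁻¹ ^ k := by
  have h0 : ∀ j, (if resS j g = resS j g' then (0 : ℝ) else 2⁻¹ ^ j) ≤
      if j < k then 0 else 2⁻¹ ^ j := fun j => by
    by_cases hj : j < k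
    · rw [if_pos (resS_eq_of_le hj.le h), if_pos hj]
    · rw [if_neg hj]
      split_ifs <;> first | positivity | exact le_rfl
  have hgeo : Summable fun j => (2 : ℝ)⁻¹ ^ j :=
    summable_geometric_of_lt_one (by norm_num : (0 : ℝ) ≤ 2⁻¹) (by norm_num)
  have hs : Summable fun j => if j < k then (0 : ℝ) else 2⁻¹ ^ j :=
    Summable.of_nonneg_of_le (fun j => by split_ifs <;> positivity)
      (fun j => by split_ifs <;> first | positivity | exact le_rfl) hgeo
  have hs' : Summable fun j => if resS j g = resS j g' then (0 : ℝ) else 2⁻¹ ^ j :=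
    Summable.of_nonneg_of_le (fun j => by split_ifs <;> positivity) h0 hs
  rw [dist_eq_rcgDist, rcgDist]
  refine (hs'.tsum_le_tsum h0 hs).trans (le_of_eq ?_)
  rw [← hs.sum_add_tsum_nat_add k, Finset.sum_eq_zero fun j hj => if_pos (Finset.mem_range.mp hj),
    zero_add, tsum_congr fun i => if_neg (show ¬ i + k < k by omega)]
  simp only [pow_add]
  rw [tsum_mul_right, tsum_geometric_of_lt_one (by norm_num) (by norm_num)]
  norm_num

lemma isOpen_eq_iUnion_resS {M : Type*} {U : Set (RCG M)} (hU : IsOpen U) :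
    U = ⋃ k, resS k ⁻¹' {g | ∀ g', resS k g' = g → g' ∈ U} := by
  ext g
  simp only [Set.mem_iUnion, Set.mem_preimage, Set.mem_ofPred_eq]
  refine ⟨fun hg => ?_, fun ⟨k, hk⟩ => hk g rfl⟩
  obtain ⟨ε, hε, hb⟩ := Metric.isOpen_iff.mp hU g hg
  obtain ⟨k, hk⟩ := exists_pow_lt_of_lt_one (half_pos hε) (by norm_num : (2 : ℝ)⁻¹ < 1)
  refine ⟨k, fun g' hg' => hb (Metric.mem_ball.mpr ?_)⟩
  have := dist_le_of_resS_eq hg'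
  linarith

lemma resS_iotaTd {M : Type*} (d k : ℕ) (x : TdVertex d → M) :
    resS k (iotaTd d x) = iotaSr d k fun v => x v.1 := by
  refine RCG.ext ?_ ?_
  · funext l
    simp only [resS, iotaTd, iotaSr]
    by_cases h1 : l.length ≤ k <;> by_cases h2 : ValidTd d l <;> simp [h1, h2]
  · funext p
    simp only [resS, iotaTd, iotaSr]
    by_cases h1 : p.1.length ≤ k <;> by_cases h2 : p.2.length ≤ k <;> simp [h1, h2]

lemma measurable_iotaTd (d : ℕ) (M : Type*) [Fintype M] [MeasurableSpace M]
    [DiscreteMeasurableSpace M] : Measurable (iotaTd d : (TdVertex d → M) → RCG M) := by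
  refine measurable_of_isOpen fun U hU => ?_
  rw [isOpen_eq_iUnion_resS hU, Set.preimage_iUnion]
  refine MeasurableSet.iUnion fun k => ?_
  rw [← Set.preimage_comp, show resS k ∘ iotaTd d =
    iotaSr d k ∘ fun (x : TdVertex d → M) (v : ↥(SrSet d k)) => x v.1 from
    funext fun x => resS_iotaTd d k x, Set.preimage_comp]
  exact (measurable_pi_lambda _ fun v => measurable_pi_apply _) MeasurableSet.of_discrete

lemma map_resS_lawTd (d r : ℕ) {M : Type*} [Fintype M] [MeasurableSpace M]
    [DiscreteMeasurableSpace M] (μ : Measure (TdVertex d → M)) :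
    (lawTd d μ).map (resS r) = (restrictTo (SrSet d r) μ).map (iotaSr d r) := by
  have hm : Measurable fun (x : TdVertex d → M) (v : ↥(SrSet d r)) => x v.1 :=
    measurable_pi_lambda _ fun v => measurable_pi_apply _
  rw [lawTd, Measure.map_map (measurable_resS r) (measurable_iotaTd d M), restrictTo,
    Measure.map_map Measurable.of_discrete hm]
  congr 1
  exact funext fun x => resS_iotaTd d r x

lemma thickening_resS_preimage {M : Type*} {r : ℕ} {c : ℝ} (hc : c ≤ (2 : ℝ)⁻¹ ^ r)
    (A : Set (RCG M)) : Metric.thickening c (resS r ⁻¹' A) ⊆ resS r ⁻¹' A := by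
  intro g hg
  obtain ⟨g', hg', hd⟩ := Metric.mem_thickening_iff.mp hg
  rw [Set.mem_preimage, resS_eq_of_dist_lt (hd.trans_le hc)]
  exact hg'

lemma abs_real_sub_le_of_levyProkhorovDist_lt {M : Type*} {r : ℕ} {P Q : Measure (RCG M)}
    [IsFiniteMeasure P] [IsFiniteMeasure Q] {c : ℝ} (h : levyProkhorovDist P Q < c)
    (hc : c ≤ (2 : ℝ)⁻¹ ^ r) (A : Set (RCG M)) :
    |P.real (resS r ⁻¹' A) - Q.real (resS r ⁻¹' A)| ≤ c := by
  have hc0 : 0 < c := lt_of_le_of_lt ENNReal.toReal_nonneg h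
  have hlt : levyProkhorovEDist P Q < ENNReal.ofReal c :=
    (ENNReal.lt_ofReal_iff_toReal_lt (levyProkhorovEDist_ne_top P Q)).mpr h
  have hA := (isOpen_resS_preimage r A).measurableSet
  have h1 := left_measure_le_of_levyProkhorovEDist_lt hlt hA
  have h2 := right_measure_le_of_levyProkhorovEDist_lt hlt hA
  rw [ENNReal.toReal_ofReal hc0.le] at h1 h2
  have key : ∀ P' Q' : Measure (RCG M), IsFiniteMeasure P' → IsFiniteMeasure Q' →
      P' (resS r ⁻¹' A) ≤ Q' (Metric.thickening c (resS r ⁻¹' A)) + ENNReal.ofReal c →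
      P'.real (resS r ⁻¹' A) ≤ Q'.real (resS r ⁻¹' A) + c := by
    intro P' Q' _ _ h
    have h3 := h.trans (add_le_add_left (measure_mono (thickening_resS_preimage hc A)) _)
    have h4 := ENNReal.toReal_mono (by simp [measure_ne_top]) h3
    rwa [ENNReal.toReal_add (measure_ne_top _ _) ENNReal.ofReal_ne_top,
      ENNReal.toReal_ofReal hc0.le] at h4
  have h3 := key P Q inferInstance inferInstance h1
  have h4 := key Q P inferInstance inferInstance h2
  rw [abs_sub_le_iff]
  constructor <;> linarith

lemma isProbabilityMeasure_distrG {M : Type*} {n : ℕ} (hn : 0 < n) (G : SimpleGraph (Fin n))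
    (f : Fin n → M) : IsProbabilityMeasure (distrG G f) := by
  have h : ∀ v, distrAt G f v Set.univ = 1 := fun v => by
    rw [distrAt, Measure.smul_apply, Measure.finsetSum_apply]
    simp only [measure_univ, Finset.sum_const, Finset.card_univ, Fintype.card_perm,
      Fintype.card_fin, smul_eq_mul, nsmul_eq_mul, mul_one]
    exact ENNReal.inv_mul_cancel (by simp [Nat.factorial_ne_zero]) (by simp)
  refine ⟨?_⟩
  rw [distrG, Measure.smul_apply, Measure.finsetSum_apply, Finset.sum_congr rfl fun v _ => h v]
  simp only [Finset.sum_const, Finset.card_univ, Fintype.card_fin, smul_eq_mul, nsmul_eq_mul,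
    mul_one]
  exact ENNReal.inv_mul_cancel (by simp [hn.ne']) (by simp)

/-- The proportion of vertices without a tree-like neighborhood of radius `r`. -/
def badFrac (r : ℕ) {n : ℕ} (G : SimpleGraph (Fin n)) : ℝ :=
  (Finset.univ.filter fun v => ¬ IsNice r G v).card / n

lemma abs_distrG_real_sub_le {d r κ n : ℕ} {M : Type*} [Fintype M] {G : SimpleGraph (Fin n)}
    (hG : G ∈ regularGraphs d n) (hκ0 : 0 < κ)
    (hκ : ∀ v, {e ∈ covSet (SrGraph d r) G | e (rootSr d r) = v}.ncard = κ) (f : Fin n → M)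
    {A : Set (RCG M)} (hA : MeasurableSet A) :
    |((distrG G f).map (resS r)).real A -
      ∑ x, empVec d r κ G f x * A.indicator 1 (iotaSr d r x)| ≤ 2 * badFrac r G := by
  have h := abs_avg_bfsAvg_sub_le (B := 1) hG hκ0 hκ f
    (g := fun x => A.indicator 1 (resS r x)) (fun x => by rw [resS_resS]) fun x _ => by
      by_cases hx : resS r x ∈ A <;> simp [hx]
  rw [mul_one] at h
  rw [distrG_real G f r hA]
  simpa only [resS_iotaSr, badFrac] using h

lemma abs_empVec_sub_le_of_mem_FSet {d r κ n : ℕ} {M : Type*} [Fintype M] [MeasurableSpace M]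
    [DiscreteMeasurableSpace M] {G : SimpleGraph (Fin n)} (hn : 0 < n)
    (hG : G ∈ regularGraphs d n) (hκ0 : 0 < κ)
    (hκ : ∀ v, {e ∈ covSet (SrGraph d r) G | e (rootSr d r) = v}.ncard = κ) {f : Fin n → M}
    {μ : Measure (TdVertex d → M)} {p : Measure (↥(SrSet d r) → M)} [IsProbabilityMeasure p]
    (hp : restrictTo (SrSet d r) μ = p) {ε c : ℝ} (hf : f ∈ FSet d μ r ε G) (hεc : ε < c)
    (hc : c ≤ (2 : ℝ)⁻¹ ^ r) (x : ↥(SrSet d r) → M) :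
    |empVec d r κ G f x - p.real {x}| ≤ c + 2 * badFrac r G := by
  have hP := isProbabilityMeasure_distrG hn G f
  have hP' : IsProbabilityMeasure ((distrG G f).map (resS r)) :=
    Measure.isProbabilityMeasure_map (measurable_resS r).aemeasurable
  have hm : Measurable (iotaSr d r : (↥(SrSet d r) → M) → RCG M) := Measurable.of_discrete
  have hQ' : IsProbabilityMeasure (p.map (iotaSr d r)) :=
    Measure.isProbabilityMeasure_map hm.aemeasurable
  have hf' : levyProkhorovDist ((distrG G f).map (resS r)) (p.map (iotaSr d r)) ≤ ε := by
    rw [← hp, ← map_resS_lawTd]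
    exact hf
  have hA := (isOpen_resS_preimage r {iotaSr d r x}).measurableSet
  have h1 := abs_real_sub_le_of_levyProkhorovDist_lt (hf'.trans_lt hεc) hc {iotaSr d r x}
  have h2 := abs_distrG_real_sub_le hG hκ0 hκ f hA
  have h3 : (p.map (iotaSr d r)).real (resS r ⁻¹' {iotaSr d r x}) = p.real {x} := by
    rw [Measure.real, Measure.map_apply hm hA, Measure.real]
    congr 2
    ext y
    simp [resS_iotaSr, (iotaSr_injective d r).eq_iff]
  have h4 : ∑ y, empVec d r κ G f y *
      (resS r ⁻¹' {iotaSr d r x}).indicator 1 (iotaSr d r y) = empVec d r κ G f x := by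
    rw [Finset.sum_eq_single x]
    · simp [resS_iotaSr]
    · intro y _ hy
      simp [resS_iotaSr, (iotaSr_injective d r).eq_iff, hy]
    · simp
  rw [h3] at h1
  rw [h4] at h2
  rw [abs_sub_comm] at h2
  exact (abs_sub_le _ _ _).trans (by linarith)

lemma mem_FSet_of_sum_abs_le {d r κ n : ℕ} {M : Type*} [Fintype M] [MeasurableSpace M]
    [DiscreteMeasurableSpace M] {G : SimpleGraph (Fin n)} (hn : 0 < n)
    (hG : G ∈ regularGraphs d n) (hκ0 : 0 < κ)
    (hκ : ∀ v, {e ∈ covSet (SrGraph d r) G | e (rootSr d r) = v}.ncard = κ) {f : Fin n → M}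
    {μ : Measure (TdVertex d → M)} {w : (↥(SrSet d r) → M) → ℝ} (hw : w ∈ IdrVec d r M)
    (hp : restrictTo (SrSet d r) μ = vecMeas w) {ε : ℝ}
    (h : ∑ x, |empVec d r κ G f x - w x| + 2 * badFrac r G ≤ ε) : f ∈ FSet d μ r ε G := by
  have hP := isProbabilityMeasure_distrG hn G f
  have hP' : IsProbabilityMeasure ((distrG G f).map (resS r)) :=
    Measure.isProbabilityMeasure_map (measurable_resS r).aemeasurable
  have hm : Measurable (iotaSr d r : (↥(SrSet d r) → M) → RCG M) := Measurable.of_discrete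
  have hQ : IsProbabilityMeasure (vecMeas w) := (vecMeas_mem_IdrMeas hw).1
  have hQ' : IsProbabilityMeasure ((vecMeas w).map (iotaSr d r)) :=
    Measure.isProbabilityMeasure_map hm.aemeasurable
  have hε : 0 ≤ ε := le_trans (add_nonneg (Finset.sum_nonneg fun _ _ => abs_nonneg _)
    (by unfold badFrac; positivity)) h
  rw [FSet, Set.mem_ofPred_eq, map_resS_lawTd, hp]
  refine levyProkhorovDist_le_of_forall_le _ _ hε fun ε' B hε' hB => ?_
  have hε0 : 0 < ε' := hε.trans_lt hε'
  have h1 := abs_distrG_real_sub_le hG hκ0 hκ f hB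
  have h2 : ((vecMeas w).map (iotaSr d r)).real B =
      ∑ x, w x * B.indicator 1 (iotaSr d r x) := by
    rw [← integral_vecMeas hw.1, Measure.real, Measure.map_apply hm hB, ← Measure.real,
      ← integral_indicator_one (hm hB)]
    rfl
  have h3 : ∑ x, empVec d r κ G f x * B.indicator 1 (iotaSr d r x) -
      ∑ x, w x * B.indicator 1 (iotaSr d r x) ≤ ∑ x, |empVec d r κ G f x - w x| := by
    rw [← Finset.sum_sub_distrib]
    refine Finset.sum_le_sum fun x _ => ?_
    by_cases hx : iotaSr d r x ∈ B
    · simp only [Set.indicator_of_mem hx, Pi.one_apply, mul_one]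
      exact le_abs_self _
    · simp [hx]
  have h4 : ((distrG G f).map (resS r)).real B ≤
      ((vecMeas w).map (iotaSr d r)).real B + ε' := by
    have := (abs_sub_le_iff.mp h1).1
    linarith
  calc ((distrG G f).map (resS r)) B
      = ENNReal.ofReal (((distrG G f).map (resS r)).real B) :=
        (ofReal_measureReal).symm
    _ ≤ ENNReal.ofReal (((vecMeas w).map (iotaSr d r)).real B + ε') :=
        ENNReal.ofReal_le_ofReal h4
    _ = ((vecMeas w).map (iotaSr d r)) B + ENNReal.ofReal ε' := by
        rw [ENNReal.ofReal_add measureReal_nonneg hε0.le, ofReal_measureReal]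
    _ ≤ _ := add_le_add_left (measure_mono (Metric.self_subset_thickening hε0 B)) _

lemma abs_ciSup_sub_ciSup_le {ι : Type*} [Finite ι] [Nonempty ι] {a b : ι → ℝ} {c : ℝ}
    (h : ∀ i, |a i - b i| ≤ c) : |(⨆ i, a i) - ⨆ i, b i| ≤ c := by
  rw [abs_sub_le_iff, sub_le_iff_le_add, sub_le_iff_le_add]
  refine ⟨ciSup_le fun i => ?_, ciSup_le fun i => ?_⟩
  · have h1 := le_ciSup (Set.finite_range b).bddAbove i
    have h2 := (abs_sub_le_iff.mp (h i)).1
    linarith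
  · have h1 := le_ciSup (Set.finite_range a).bddAbove i
    have h2 := (abs_sub_le_iff.mp (h i)).2
    linarith

lemma LG_div_eq {n : ℕ} {M : Type*} (G : SimpleGraph (Fin n)) (ψ : RCG M → ℝ) :
    LG G ψ / n = ⨆ f : Fin n → M, (n : ℝ)⁻¹ * ∑ v, bfsAvg G f ψ v := by
  have h : LG G ψ = ⨆ f : Fin n → M, ∑ v, bfsAvg G f ψ v := by
    rw [LG, iSup]
    congr 1
    ext x
    simp only [psiAt, integral_distrAt, Set.mem_ofPred_eq, Set.mem_range, eq_comm]
  rw [h, div_eq_inv_mul, Real.mul_iSup_of_nonneg (by positivity)]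

lemma abs_LG_div_sub_le {d r κ n : ℕ} {M : Type*} [Fintype M] [Nonempty M]
    {G : SimpleGraph (Fin n)} (hG : G ∈ regularGraphs d n) (hκ0 : 0 < κ)
    (hκ : ∀ v, {e ∈ covSet (SrGraph d r) G | e (rootSr d r) = v}.ncard = κ)
    {ψ : RCG M → ℝ} (hψ : ∀ x, ψ (resS r x) = ψ x) {B : ℝ}
    (hB : ∀ x ∈ locRange d r M, |ψ x| ≤ B) :
    |LG G ψ / n - maxEmp d r κ (fun x => ψ (iotaSr d r x)) G| ≤ 2 * B * badFrac r G := by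
  rw [LG_div_eq, maxEmp]
  exact abs_ciSup_sub_ciSup_le fun f => abs_avg_bfsAvg_sub_le hG hκ0 hκ f hψ hB

lemma abs_LG_div_le {d r n : ℕ} {M : Type*} [Fintype M] [Nonempty M] (hn : 0 < n)
    {G : SimpleGraph (Fin n)} (hG : G ∈ regularGraphs d n)
    {ψ : RCG M → ℝ} (hψ : ∀ x, ψ (resS r x) = ψ x) {B : ℝ}
    (hB : ∀ x ∈ locRange d r M, |ψ x| ≤ B) : |LG G ψ / n| ≤ B := by
  have hn' : (0 : ℝ) < n := Nat.cast_pos.mpr hn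
  have h : |(⨆ f : Fin n → M, (n : ℝ)⁻¹ * ∑ v, bfsAvg G f ψ v) - ⨆ _ : Fin n → M, (0 : ℝ)| ≤ B := by
    refine abs_ciSup_sub_ciSup_le fun f => ?_
    rw [sub_zero, abs_mul, abs_of_pos (inv_pos.mpr hn'), inv_mul_le_iff₀ hn']
    refine (Finset.abs_sum_le_sum_abs _ _).trans
      ((Finset.sum_le_sum fun v _ => abs_bfsAvg_le hG f hψ hB v).trans ?_)
    simp
  rw [LG_div_eq]
  simpa using h

/-! ### Uniform random regular graphs: probabilities and expectations -/

lemma PrG_mono {d n : ℕ} {A B : Set (SimpleGraph (Fin n))}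
    (h : ∀ G ∈ regularGraphs d n, G ∈ A → G ∈ B) : PrG d n A ≤ PrG d n B := by
  refine div_le_div_of_nonneg_right (Nat.cast_le.mpr ?_) (Nat.cast_nonneg _)
  exact Set.ncard_le_ncard (fun G hG => ⟨hG.1, h G hG.1 hG.2⟩) (Set.toFinite _)

lemma PrG_union_le {d n : ℕ} (A B : Set (SimpleGraph (Fin n))) :
    PrG d n (A ∪ B) ≤ PrG d n A + PrG d n B := by
  rw [PrG, PrG, PrG, ← add_div, Set.inter_union_distrib_left]
  refine div_le_div_of_nonneg_right ?_ (Nat.cast_nonneg _)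
  exact_mod_cast Set.ncard_union_le _ _

lemma PrG_biUnion_le {d n : ℕ} {ι : Type*} (t : Finset ι) (A : ι → Set (SimpleGraph (Fin n))) :
    PrG d n (⋃ i ∈ t, A i) ≤ ∑ i ∈ t, PrG d n (A i) := by
  induction t using Finset.induction_on with
  | empty => simp [PrG]
  | insert i t hi ih =>
    rw [Finset.set_biUnion_insert, Finset.sum_insert hi]
    exact (PrG_union_le _ _).trans (by linarith)

lemma PrG_univ {d n : ℕ} (hne : (regularGraphs d n).Nonempty) : PrG d n Set.univ = 1 := by
  rw [PrG, Set.inter_univ, div_self]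
  exact Nat.cast_ne_zero.mpr (Set.ncard_ne_zero_of_mem hne.some_mem)

lemma exists_mem_regularGraphs_of_PrG_lt {d n : ℕ} {A B : Set (SimpleGraph (Fin n))}
    (h : PrG d n A < PrG d n B) : ∃ G ∈ regularGraphs d n, G ∈ B ∧ G ∉ A := by
  by_contra! hc
  exact absurd (PrG_mono hc) (not_le.mpr h)

lemma abs_ExG_sub_le {d n : ℕ} (hne : (regularGraphs d n).Nonempty)
    {F : SimpleGraph (Fin n) → ℝ} {A : Set (SimpleGraph (Fin n))} {a s T : ℝ} (hs : 0 ≤ s)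
    (hF : ∀ G ∈ regularGraphs d n, G ∉ A → |F G - a| ≤ s)
    (hT : ∀ G ∈ regularGraphs d n, |F G - a| ≤ T) : |ExG d n F - a| ≤ s + T * PrG d n A := by
  have hfin := (regularGraphs d n).toFinite
  have hN : ((regularGraphs d n).ncard : ℝ) = hfin.toFinset.card := by
    rw [Set.ncard_eq_toFinset_card _ hfin]
  have hpos : (0 : ℝ) < hfin.toFinset.card := by
    rw [← hN]
    exact Nat.cast_pos.mpr ((Set.ncard_pos hfin).mpr hne)
  have hA : ((regularGraphs d n ∩ A).ncard : ℝ) =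
      (hfin.toFinset.filter fun G => G ∈ A).card := by
    rw [← Set.ncard_coe_finset]
    congr 2
    ext G
    simp
  rw [ExG, PrG, hN, hA, finsum_mem_eq_finite_toFinset_sum _ hfin,
    show (∑ G ∈ hfin.toFinset, F G) / hfin.toFinset.card - a =
      (∑ G ∈ hfin.toFinset, (F G - a)) / hfin.toFinset.card by
      rw [Finset.sum_sub_distrib, Finset.sum_const, nsmul_eq_mul]
      field_simp,
    abs_div, abs_of_pos hpos, div_le_iff₀ hpos, add_mul, mul_assoc, div_mul_cancel₀ _ hpos.ne']
  refine (Finset.abs_sum_le_sum_abs _ _).trans ?_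
  calc ∑ G ∈ hfin.toFinset, |F G - a|
      ≤ ∑ G ∈ hfin.toFinset, (s + if G ∈ A then T else 0) := by
        refine Finset.sum_le_sum fun G hG => ?_
        rw [Set.Finite.mem_toFinset] at hG
        by_cases hGA : G ∈ A
        · rw [if_pos hGA]
          linarith [hT G hG]
        · rw [if_neg hGA, add_zero]
          exact hF G hG hGA
    _ = s * hfin.toFinset.card + T * (hfin.toFinset.filter fun G => G ∈ A).card := by
        rw [Finset.sum_add_distrib, Finset.sum_const, ← Finset.sum_filter, Finset.sum_const,
          nsmul_eq_mul, nsmul_eq_mul, mul_comm, mul_comm T]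

lemma neBot_goodFilter (d : ℕ) : (goodFilter d).NeBot := by
  rw [neBot_iff]
  intro h
  have h1 : ∀ᶠ n in goodFilter d, False := by rw [h]; exact eventually_bot
  obtain ⟨n₀, hn₀⟩ := eventually_goodFilter.mp h1
  exact hn₀ (2 * (n₀ + d + 1)) (by omega) ⟨by omega, by simp [mul_assoc]⟩

/-- `κ n` is the number of locally injective homomorphisms from the ball `S_r` to a `d`-regular
graph on `n` vertices with a prescribed root. -/
def IsCoverNumber (d r : ℕ) (κ : ℕ → ℕ) : Prop :=
  ∀ n, ∀ G ∈ regularGraphs d n, ∀ v,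
    {e ∈ covSet (SrGraph d r) G | e (rootSr d r) = v}.ncard = κ n

lemma exists_isCoverNumber (d r : ℕ) : ∃ κ, IsCoverNumber d r κ :=
  ⟨fun n => (exists_card_covSet d n r).choose, fun n => (exists_card_covSet d n r).choose_spec⟩

lemma badFrac_rare {d : ℕ} (hd : 0 < d) (r : ℕ) {δ η : ℝ} (hδ : 0 < δ) (hη : 0 < η) :
    ∀ᶠ n in goodFilter d, PrG d n {G | δ < badFrac r G} ≤ η := by
  filter_upwards [not_isNice_rare d hd r δ η hδ hη,
    mem_inf_of_left (Ioi_mem_atTop 0)] with n h hn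
  have hn' : (0 : ℝ) < n := Nat.cast_pos.mpr hn
  refine (PrG_mono fun G _ hG => ?_).trans h
  exact (lt_div_iff₀ hn').mp hG

lemma eventually_nonempty_regularGraphs {d : ℕ} (hd : 0 < d) :
    ∀ᶠ n in goodFilter d, 0 < n ∧ (regularGraphs d n).Nonempty := by
  filter_upwards [concentration_regular d hd 1 1 1 one_pos one_pos one_pos,
    mem_inf_of_left (Ioi_mem_atTop 0)] with n h hn
  exact ⟨hn, h.1⟩

lemma IsCoverNumber.eventually_pos {d r : ℕ} {κ : ℕ → ℕ} (hκ : IsCoverNumber d r κ)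
    (hd : 0 < d) : ∀ᶠ n in goodFilter d, 0 < κ n := by
  filter_upwards [badFrac_rare hd r (by norm_num : (0 : ℝ) < 1 / 2) (by norm_num : (0 : ℝ) < 1 / 2),
    eventually_nonempty_regularGraphs hd] with n h1 ⟨hn, hne⟩
  have hn' : (0 : ℝ) < n := Nat.cast_pos.mpr hn
  obtain ⟨G, hG, -, hb⟩ := exists_mem_regularGraphs_of_PrG_lt
    (B := Set.univ) (h1.trans_lt (by rw [PrG_univ hne]; norm_num))
  have hnice : ∃ v, IsNice r G v := by
    by_contra! hc
    refine hb ?_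
    simp only [Set.mem_ofPred_eq, badFrac]
    rw [Finset.filter_true_of_mem fun v _ => hc v, Finset.card_univ, Fintype.card_fin,
      div_self hn'.ne']
    norm_num
  obtain ⟨v, hv⟩ := hnice
  rw [← hκ n G hG v]
  exact (Set.ncard_pos (Set.toFinite _)).mpr
    ⟨bfsMap d r G v (Equiv.refl _), hv.bfsMap_mem_covSet hG _, hv.bfsMap_root hG _⟩

lemma IsCoverNumber.maxEmp_concentrated {d r : ℕ} {κ : ℕ → ℕ} (hκ : IsCoverNumber d r κ)
    (hd : 0 < d) {M : Type} [Fintype M] [Nonempty M] (g : (↥(SrSet d r) → M) → ℝ) {δ η : ℝ}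
    (hδ : 0 < δ) (hη : 0 < η) : ∀ᶠ n in goodFilter d,
      PrG d n {G | δ < |maxEmp d r (κ n) g G - cfgMean (n := n) d (maxEmp d r (κ n) g)|} ≤ η := by
  obtain ⟨C, hC, h⟩ := exists_locLipschitz_maxEmp d r M g
  filter_upwards [concentration_regular d hd C δ η hC hδ hη, hκ.eventually_pos hd] with n h1 h2
  exact h1.2 _ (h n (κ n) h2)

lemma IsCoverNumber.minDev_concentrated {d r : ℕ} {κ : ℕ → ℕ} (hκ : IsCoverNumber d r κ)
    (hd : 0 < d) {M : Type} [Fintype M] [Nonempty M] (w : (↥(SrSet d r) → M) → ℝ) {δ η : ℝ}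
    (hδ : 0 < δ) (hη : 0 < η) : ∀ᶠ n in goodFilter d,
      PrG d n {G | δ < |minDev d r (κ n) w G - cfgMean (n := n) d (minDev d r (κ n) w)|} ≤ η := by
  obtain ⟨C, hC, h⟩ := exists_locLipschitz_minDev d r M
  filter_upwards [concentration_regular d hd C δ η hC hδ hη, hκ.eventually_pos hd] with n h1 h2
  exact h1.2 _ (h w n (κ n) h2)

/-- The expected normalized ground-state energy is asymptotically the mean of `maxEmp`. -/
lemma IsCoverNumber.abs_ExG_LG_sub_le {d r : ℕ} {κ : ℕ → ℕ} (hκ : IsCoverNumber d r κ)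
    (hd : 0 < d) {M : Type} [Fintype M] [Nonempty M] {ψ : RCG M → ℝ}
    (hψ : ∀ x, ψ (resS r x) = ψ x) {δ : ℝ} (hδ : 0 < δ) : ∀ᶠ n in goodFilter d,
      |ExG d n (fun G => LG G ψ / n) -
        cfgMean (n := n) d (maxEmp d r (κ n) fun x => ψ (iotaSr d r x))| ≤ δ := by
  obtain ⟨B₀, hB₀⟩ := ((finite_locRange d r M).image fun x => |ψ x|).bddAbove
  set B := max B₀ 0
  have hB0 : 0 ≤ B := le_max_right _ _
  have hB : ∀ x ∈ locRange d r M, |ψ x| ≤ B := fun x hx =>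
    (hB₀ (Set.mem_image_of_mem _ hx)).trans (le_max_left _ _)
  set s := min (δ / (2 * (2 * B + 1))) 1
  have hs : 0 < s := lt_min (by positivity) one_pos
  set η := min (δ / (4 * (4 * B + 1))) (1 / 4)
  have hη : 0 < η := lt_min (by positivity) (by norm_num)
  filter_upwards [eventually_nonempty_regularGraphs hd, hκ.eventually_pos hd,
    badFrac_rare hd r hs hη, hκ.maxEmp_concentrated hd (fun x => ψ (iotaSr d r x)) hs hη]
    with n ⟨hn, hne⟩ hκ0 h1 h2
  set a := cfgMean (n := n) d (maxEmp d r (κ n) fun x => ψ (iotaSr d r x))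
  set A := {G : SimpleGraph (Fin n) | s < badFrac r G} ∪
    {G | s < |maxEmp d r (κ n) (fun x => ψ (iotaSr d r x)) G - a|}
  have hA : PrG d n A ≤ 2 * η := (PrG_union_le _ _).trans (by linarith)
  have hη4 : η ≤ 1 / 4 := min_le_right _ _
  have hs1 : s ≤ 1 := min_le_right _ _
  have hs2 : s * (2 * (2 * B + 1)) ≤ δ := (le_div_iff₀ (by positivity)).mp (min_le_left _ _)
  have hη2 : η * (4 * (4 * B + 1)) ≤ δ := (le_div_iff₀ (by positivity)).mp (min_le_left _ _)
  have hF : ∀ G ∈ regularGraphs d n, G ∉ A → |LG G ψ / n - a| ≤ (2 * B + 1) * s := by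
    intro G hG hGA
    simp only [A, Set.mem_union, Set.mem_ofPred_eq, not_or, not_lt] at hGA
    have h3 := abs_LG_div_sub_le hG hκ0 (hκ n G hG) hψ hB
    have h4 : 2 * B * badFrac r G ≤ 2 * B * s :=
      mul_le_mul_of_nonneg_left hGA.1 (by positivity)
    refine (abs_sub_le _ _ _).trans ((add_le_add h3 hGA.2).trans ?_)
    linarith
  obtain ⟨G₀, hG₀, -, hG₀A⟩ := exists_mem_regularGraphs_of_PrG_lt
    (B := Set.univ) (hA.trans_lt (by rw [PrG_univ hne]; linarith))
  have hs3 : (2 * B + 1) * s ≤ 2 * B + 1 := mul_le_of_le_one_right (by positivity) hs1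
  have ha : |a| ≤ 3 * B + 1 := by
    have h3 := hF G₀ hG₀ hG₀A
    have h4 := abs_LG_div_le hn hG₀ hψ hB
    have h5 := abs_sub_abs_le_abs_sub a (LG G₀ ψ / n)
    rw [abs_sub_comm] at h5
    linarith
  have hT : ∀ G ∈ regularGraphs d n, |LG G ψ / n - a| ≤ 4 * B + 1 := fun G hG => by
    have h4 := abs_LG_div_le hn hG hψ hB
    have h5 := abs_sub (LG G ψ / n) a
    linarith
  refine (abs_ExG_sub_le hne (by positivity) hF hT).trans ?_
  have h6 : (4 * B + 1) * PrG d n A ≤ (4 * B + 1) * (2 * η) :=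
    mul_le_mul_of_nonneg_left hA (by positivity)
  linarith

lemma pairing_eq_sum {d r : ℕ} {M : Type*} [Fintype M] [MeasurableSpace M]
    [DiscreteMeasurableSpace M] (p : Measure (↥(SrSet d r) → M)) [IsProbabilityMeasure p]
    (ψ : RCG M → ℝ) : pairing d r p ψ = ∑ x, p.real {x} * ψ (iotaSr d r x) := by
  rw [pairing, integral_fintype Integrable.of_finite]
  simp

lemma FSet_nonempty_of_le_HG {d r n : ℕ} {M : Type*} [MeasurableSpace M]
    {μ : Measure (TdVertex d → M)} {ε : ℝ} {G : SimpleGraph (Fin n)} {h : EReal} (h0 : 0 ≤ h)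
    (hG : h ≤ HG d μ r ε G) : (FSet d μ r ε G).Nonempty := by
  rw [Set.nonempty_iff_ne_empty]
  intro he
  rw [HG, if_pos he] at hG
  exact absurd (h0.trans hG) (by simp)

lemma HG_nonneg_of_nonempty {d r n : ℕ} {M : Type*} [MeasurableSpace M]
    {μ : Measure (TdVertex d → M)} {ε : ℝ} {G : SimpleGraph (Fin n)}
    (h : (FSet d μ r ε G).Nonempty) : 0 ≤ HG d μ r ε G := by
  rw [HG, if_neg h.ne_empty]
  exact EReal.coe_nonneg.mpr (div_nonneg (Real.log_natCast_nonneg _) (Nat.cast_nonneg _))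

lemma half_le_PrG_FSet_of_hlowR_nonneg {d r : ℕ} {M : Type*} [MeasurableSpace M]
    {μ : Measure (TdVertex d → M)} (h : 0 ≤ hlowR d μ r) {ε : ℝ} (hε : 0 < ε) :
    ∀ᶠ n in goodFilter d, 1 / 2 ≤
      PrG d n {G : SimpleGraph (Fin n) | (FSet d μ r ε G).Nonempty} := by
  have h1 : (-1 : EReal) < (goodFilter d).liminf fun n => hquant d μ r ε (1 / 2) n :=
    lt_of_lt_of_le (by norm_num) (h.trans (iInf_le
      (fun ε : {e : ℝ // 0 < e} => (goodFilter d).liminf fun n => hquant d μ r ε.1 (1 / 2) n)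
      ⟨ε, hε⟩))
  filter_upwards [eventually_lt_of_lt_liminf h1] with n hn
  obtain ⟨e, ⟨he1, he2⟩, he3⟩ := lt_sSup_iff.mp hn
  have he0 : 0 ≤ e := he1.resolve_left fun h => by simp [h] at he3
  exact he2.trans (PrG_mono fun G _ hG => FSet_nonempty_of_le_HG he0 hG)

lemma PrG_FSet_lt_half_of_hbarR_neg {d r : ℕ} {M : Type*} [MeasurableSpace M]
    {μ : Measure (TdVertex d → M)} (h : hbarR d μ r < 0) : ∃ ε : ℝ, 0 < ε ∧
    ∀ᶠ n in goodFilter d,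
      PrG d n {G : SimpleGraph (Fin n) | (FSet d μ r ε G).Nonempty} < 1 / 2 := by
  obtain ⟨⟨ε, hε⟩, h1⟩ := iInf_lt_iff.mp h
  refine ⟨ε, hε, ?_⟩
  filter_upwards [eventually_lt_of_limsup_lt h1] with n hn
  by_contra! hc
  refine absurd hn (not_lt.mpr (le_sSup ⟨Or.inr le_rfl, hc.trans ?_⟩))
  exact PrG_mono fun G _ hG => HG_nonneg_of_nonempty hG

/-- Processes with nonnegative lower entropy bound the mean of `maxEmp` from below. -/
lemma IsCoverNumber.pairing_sub_le {d r : ℕ} {κ : ℕ → ℕ} (hκ : IsCoverNumber d r κ)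
    (hd : 0 < d) {M : Type} [Fintype M] [Nonempty M] [MeasurableSpace M]
    [DiscreteMeasurableSpace M] (ψ : RCG M → ℝ) {p : Measure (↥(SrSet d r) → M)}
    [IsProbabilityMeasure p] {μ : Measure (TdVertex d → M)}
    (hp : restrictTo (SrSet d r) μ = p) (h : 0 ≤ hlowR d μ r) {δ : ℝ} (hδ : 0 < δ) :
    ∀ᶠ n in goodFilter d, pairing d r p ψ - δ ≤
      cfgMean (n := n) d (maxEmp d r (κ n) fun x => ψ (iotaSr d r x)) := by
  set S := ∑ x : ↥(SrSet d r) → M, |ψ (iotaSr d r x)|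
  have hS : 0 ≤ S := Finset.sum_nonneg fun _ _ => abs_nonneg _
  set s := min (δ / (4 * S + 1)) ((2 : ℝ)⁻¹ ^ r / 2)
  have hs : 0 < s := lt_min (by positivity) (by positivity)
  have hs1 : s * (4 * S + 1) ≤ δ := (le_div_iff₀ (by positivity)).mp (min_le_left _ _)
  have hs2 : s ≤ (2 : ℝ)⁻¹ ^ r / 2 := min_le_right _ _
  have h8 : (0 : ℝ) < 1 / 8 := by norm_num
  filter_upwards [eventually_nonempty_regularGraphs hd, hκ.eventually_pos hd,
    badFrac_rare hd r hs h8, hκ.maxEmp_concentrated hd (fun x => ψ (iotaSr d r x)) hs h8,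
    half_le_PrG_FSet_of_hlowR_nonneg h hs] with n ⟨hn, hne⟩ hκ0 h1 h2 h3
  set a := cfgMean (n := n) d (maxEmp d r (κ n) fun x => ψ (iotaSr d r x))
  obtain ⟨G, hG, ⟨f, hf⟩, hGA⟩ := exists_mem_regularGraphs_of_PrG_lt
    (lt_of_lt_of_le ((PrG_union_le {G : SimpleGraph (Fin n) | s < badFrac r G}
      {G | s < |maxEmp d r (κ n) (fun x => ψ (iotaSr d r x)) G - a|}).trans_lt (by linarith)) h3)
  simp only [Set.mem_union, Set.mem_ofPred_eq, not_or, not_lt] at hGA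
  have h4 : ∑ x, empVec d r (κ n) G f x * ψ (iotaSr d r x) ≤
      maxEmp d r (κ n) (fun x => ψ (iotaSr d r x)) G :=
    le_ciSup (f := fun f : Fin n → M => ∑ x, empVec d r (κ n) G f x * ψ (iotaSr d r x))
      (Set.finite_range _).bddAbove f
  have h5 : pairing d r p ψ - ∑ x, empVec d r (κ n) G f x * ψ (iotaSr d r x) ≤ 4 * s * S := by
    rw [pairing_eq_sum, ← Finset.sum_sub_distrib, Finset.mul_sum]
    refine Finset.sum_le_sum fun x _ => ?_
    rw [← sub_mul]
    refine (le_abs_self _).trans ?_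
    rw [abs_mul]
    refine mul_le_mul_of_nonneg_right ?_ (abs_nonneg _)
    have h6 := abs_empVec_sub_le_of_mem_FSet hn hG hκ0 (hκ n G hG) hp hf
      (show s < 2 * s by linarith) (by linarith) x
    rw [abs_sub_comm] at h6
    linarith [hGA.1]
  have h6 := (abs_sub_le_iff.mp hGA.2).1
  linarith

/-- Processes with negative upper entropy are not approximated by colorings. -/
lemma IsCoverNumber.minDev_lt_rare {d r : ℕ} {κ : ℕ → ℕ} (hκ : IsCoverNumber d r κ)
    (hd : 0 < d) {M : Type} [Fintype M] [Nonempty M] [MeasurableSpace M]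
    [DiscreteMeasurableSpace M] {w : (↥(SrSet d r) → M) → ℝ} (hw : w ∈ IdrVec d r M)
    {μ : Measure (TdVertex d → M)} (hp : restrictTo (SrSet d r) μ = vecMeas w)
    (h : hbarR d μ r < 0) : ∃ ε : ℝ, 0 < ε ∧ ∀ η > 0, ∀ᶠ n in goodFilter d,
      PrG d n {G : SimpleGraph (Fin n) | minDev d r (κ n) w G < ε} ≤ η := by
  obtain ⟨ε, hε, h0⟩ := PrG_FSet_lt_half_of_hbarR_neg h
  refine ⟨ε / 4, by positivity, fun η hη => ?_⟩
  have h8 : (0 : ℝ) < 1 / 8 := by norm_num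
  have hε8 : 0 < ε / 8 := by positivity
  filter_upwards [eventually_nonempty_regularGraphs hd, hκ.eventually_pos hd,
    badFrac_rare hd r hε8 h8, hκ.minDev_concentrated hd w hε8 (lt_min hη h8), h0]
    with n ⟨hn, hne⟩ hκ0 h1 h2 h3
  set m := cfgMean (n := n) d (minDev d r (κ n) w)
  have hm : 3 * ε / 8 ≤ m := by
    by_contra! hc
    have h4 : PrG d n ({G : SimpleGraph (Fin n) | ε / 8 < badFrac r G} ∪
        {G | ε / 8 < |minDev d r (κ n) w G - m|}) ≤ 1 / 4 :=
      (PrG_union_le _ _).trans (by linarith [h2.trans (min_le_right _ _)])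
    obtain ⟨G, hG, -, hGA⟩ := exists_mem_regularGraphs_of_PrG_lt (B := Set.univ)
      (((PrG_union_le _ _).trans (add_le_add h3.le h4)).trans_lt
        (by rw [PrG_univ hne]; norm_num))
    simp only [Set.mem_union, Set.mem_ofPred_eq, not_or, not_lt] at hGA
    obtain ⟨hG1, hG2, hG3⟩ := hGA
    obtain ⟨f, hf⟩ := exists_eq_ciInf_of_finite
      (f := fun f : Fin n → M => ∑ x, |empVec d r (κ n) G f x - w x|)
    refine hG1 ⟨f, mem_FSet_of_sum_abs_le hn hG hκ0 (hκ n G hG) hw hp ?_⟩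
    have h5 : ∑ x, |empVec d r (κ n) G f x - w x| = minDev d r (κ n) w G := hf
    have h6 := (abs_sub_le_iff.mp hG3).1
    linarith
  refine ((PrG_mono fun G _ hG => ?_).trans h2).trans (min_le_left _ _)
  rw [Set.mem_ofPred_eq] at hG ⊢
  rw [abs_sub_comm]
  exact lt_of_lt_of_le (by linarith) (le_abs_self _)

lemma isCompact_IdrVec_inter (d r : ℕ) (M : Type*) [Fintype M] (g : (↥(SrSet d r) → M) → ℝ)
    (c : ℝ) : IsCompact (IdrVec d r M ∩ {w | c ≤ ∑ x, w x * g x}) := by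
  refine IsCompact.of_isClosed_subset (isCompact_univ_pi fun _ => isCompact_Icc (a := (0 : ℝ))
    (b := 1)) ?_ ?_
  · refine IsClosed.inter ?_ (isClosed_le continuous_const (by fun_prop))
    have h : IdrVec d r M = (⋂ x, {w | 0 ≤ w x}) ∩ ({w | ∑ x, w x = 1} ∩
        ((⋂ φ : SrGraph d r ≃g SrGraph d r, ⋂ x, {w | w (x ∘ φ) = w x}) ∩
        ⋂ φ : ErGraph d r ≃g ErGraph d r, ⋂ y, {w |
          ∑ x with resEr d r x = y ∘ φ, w x = ∑ x with resEr d r x = y, w x})) := by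
      ext w
      simp [IdrVec]
    rw [h]
    refine IsClosed.inter (isClosed_iInter fun x => ?_) (IsClosed.inter ?_ (IsClosed.inter
      (isClosed_iInter fun φ => isClosed_iInter fun x => ?_)
      (isClosed_iInter fun φ => isClosed_iInter fun y => ?_)))
    · exact isClosed_le continuous_const (continuous_apply x)
    · exact isClosed_eq (by fun_prop) continuous_const
    · exact isClosed_eq (continuous_apply _) (continuous_apply x)
    · exact isClosed_eq (by fun_prop) (by fun_prop)
  · rintro w ⟨⟨h0, h1, -⟩, -⟩ x -
    refine ⟨h0 x, ?_⟩
    rw [← h1]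
    exact Finset.single_le_sum (fun y _ => h0 y) (Finset.mem_univ x)

/-- If all processes with pairing at least `c` have negative upper entropy then the mean of
`maxEmp` is asymptotically at most `c`. -/
lemma IsCoverNumber.cfgMean_maxEmp_le {d r : ℕ} {κ : ℕ → ℕ} (hκ : IsCoverNumber d r κ)
    (hd : 0 < d) (hr : 1 ≤ r) {M : Type} [Fintype M] [Nonempty M] [MeasurableSpace M]
    [DiscreteMeasurableSpace M] (g : (↥(SrSet d r) → M) → ℝ) (c : ℝ)
    (μOf : Measure (↥(SrSet d r) → M) → Measure (TdVertex d → M))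
    (hμ : ∀ w ∈ IdrVec d r M, restrictTo (SrSet d r) (μOf (vecMeas w)) = vecMeas w)
    (hneg : ∀ w ∈ IdrVec d r M, c ≤ ∑ x, w x * g x → hbarR d (μOf (vecMeas w)) r < 0)
    {δ : ℝ} (hδ : 0 < δ) : ∀ᶠ n in goodFilter d,
      cfgMean (n := n) d (maxEmp d r (κ n) g) ≤ c + δ := by
  have hK := isCompact_IdrVec_inter d r M g c
  set K := IdrVec d r M ∩ {w | c ≤ ∑ x, w x * g x}
  have hε : ∀ w, ∃ ε : ℝ, 0 < ε ∧ (w ∈ K → ∀ η > 0, ∀ᶠ n in goodFilter d,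
      PrG d n {G : SimpleGraph (Fin n) | minDev d r (κ n) w G < ε} ≤ η) := by
    intro w
    by_cases hw : w ∈ K
    · obtain ⟨ε, hε, h⟩ := hκ.minDev_lt_rare hd hw.1 (hμ w hw.1) (hneg w hw.1 hw.2)
      exact ⟨ε, hε, fun _ => h⟩
    · exact ⟨1, one_pos, fun h => absurd h hw⟩
  choose ε hε0 hε using hε
  obtain ⟨t, htK, ht⟩ := hK.elim_nhds_subcover (fun w => {w' | ∑ x, |w' x - w x| < ε w})
    fun w _ => IsOpen.mem_nhds (isOpen_lt (by fun_prop) continuous_const) (by simpa using hε0 w)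
  set η : ℝ := 1 / (4 * (t.card + 1))
  have hη : 0 < η := by positivity
  have hev : ∀ᶠ n in goodFilter d, ∀ w ∈ t,
      PrG d n {G : SimpleGraph (Fin n) | minDev d r (κ n) w G < ε w} ≤ η :=
    (Filter.eventually_all_finset t).mpr fun w hw => hε w (htK w hw) η hη
  filter_upwards [eventually_nonempty_regularGraphs hd, hκ.eventually_pos hd,
    hκ.maxEmp_concentrated hd g hδ (by norm_num : (0 : ℝ) < 1 / 4), hev]
    with n ⟨hn, hne⟩ hκ0 h1 h2
  set a := cfgMean (n := n) d (maxEmp d r (κ n) g)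
  have h3 : PrG d n (⋃ w ∈ t, {G : SimpleGraph (Fin n) | minDev d r (κ n) w G < ε w}) ≤ 1 / 4 := by
    refine (PrG_biUnion_le t _).trans ((Finset.sum_le_sum h2).trans ?_)
    rw [Finset.sum_const, nsmul_eq_mul]
    simp only [η]
    rw [mul_one_div, div_le_div_iff₀ (by positivity) (by norm_num)]
    linarith
  obtain ⟨G, hG, -, hGA⟩ := exists_mem_regularGraphs_of_PrG_lt (B := Set.univ)
    (((PrG_union_le _ _).trans (add_le_add h1 h3)).trans_lt (by rw [PrG_univ hne]; norm_num))
  simp only [Set.mem_union, Set.mem_ofPred_eq, Set.mem_iUnion, not_or, not_lt, not_exists] at hGA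
  by_contra! hc
  obtain ⟨f, hf⟩ := exists_eq_ciSup_of_finite
    (f := fun f : Fin n → M => ∑ x, empVec d r (κ n) G f x * g x)
  have h4 : ∑ x, empVec d r (κ n) G f x * g x = maxEmp d r (κ n) g G := hf
  have h5 := (abs_sub_le_iff.mp hGA.1).2
  have hfK : empVec d r (κ n) G f ∈ K :=
    ⟨empVec_mem d r hr hn hκ0 hG (hκ n G hG) f, by rw [Set.mem_ofPred_eq, h4]; linarith⟩
  obtain ⟨w, hw, hfw⟩ := Set.mem_iUnion₂.mp (ht hfK)
  have h6 : minDev d r (κ n) w G ≤ ∑ x, |empVec d r (κ n) G f x - w x| :=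
    ciInf_le (f := fun f : Fin n → M => ∑ x, |empVec d r (κ n) G f x - w x|)
      (Set.finite_range _).bddBelow f
  exact absurd (h6.trans_lt hfw) (not_lt.mpr (hGA.2 w hw))

/-- Combinatorial optimization: for `r ≥ 1` and a function `ψ` of rooted
unlabeled `M`-colored graphs of radius `r`,
`sup {⟨p,ψ⟩ : p ∈ I_{d,r}(M), h̲(p) ≥ 0} ≤ liminf_n E[L_{G_n}]/n
  ≤ limsup_n E[L_{G_n}]/n ≤ sup {⟨p,ψ⟩ : p ∈ I_{d,r}(M), h̄(p) ≥ 0}`. -/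
theorem combinatorial_optimization
    (d : ℕ) (hd : 3 ≤ d) (M : Type) [Fintype M] [Nonempty M] [MeasurableSpace M]
    [DiscreteMeasurableSpace M]
    (r : ℕ) (hr : 1 ≤ r) (ψ : RCG M → ℝ) (hψ : IsRadiusRFn r ψ)
    (μOf : Measure (↥(SrSet d r) → M) → Measure (TdVertex d → M))
    (hμOf : ∀ p ∈ IdrMeas d r M, μOf p ∈ InvMeas d M ∧ rMarkov r (μOf p) ∧
      restrictTo (SrSet d r) (μOf p) = p) :
    sSup {x : EReal | ∃ p ∈ IdrMeas d r M,
        (0 : EReal) ≤ hlowR d (μOf p) r ∧ x = ((pairing d r p ψ : ℝ) : EReal)}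
      ≤ (goodFilter d).liminf
          (fun n => ((ExG d n (fun G => LG G ψ / n) : ℝ) : EReal)) ∧
    (goodFilter d).liminf (fun n => ((ExG d n (fun G => LG G ψ / n) : ℝ) : EReal))
      ≤ (goodFilter d).limsup (fun n => ((ExG d n (fun G => LG G ψ / n) : ℝ) : EReal)) ∧
    (goodFilter d).limsup (fun n => ((ExG d n (fun G => LG G ψ / n) : ℝ) : EReal))
      ≤ sSup {x : EReal | ∃ p ∈ IdrMeas d r M,
          (0 : EReal) ≤ hbarR d (μOf p) r ∧ x = ((pairing d r p ψ : ℝ) : EReal)} := by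
  have hd0 : 0 < d := by omega
  have hψ' : ∀ x, ψ (resS r x) = ψ x := hψ.comp_resS
  have hne := neBot_goodFilter d
  obtain ⟨κ, hκ⟩ := exists_isCoverNumber d r
  refine ⟨sSup_le ?_, liminf_le_limsup, ?_⟩
  · rintro _ ⟨p, hp, hlow, rfl⟩
    have hprob : IsProbabilityMeasure p := hp.1
    refine le_of_forall_lt_imp_le_of_dense fun c hc => ?_
    obtain ⟨y, hcy, hyp⟩ := EReal.lt_iff_exists_real_btwn.mp hc
    have hδ : 0 < (pairing d r p ψ - y) / 2 := half_pos (sub_pos.mpr (EReal.coe_lt_coe_iff.mp hyp))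
    refine hcy.le.trans (le_liminf_of_le (by isBoundedDefault) ?_)
    filter_upwards [hκ.abs_ExG_LG_sub_le hd0 hψ' hδ,
      hκ.pairing_sub_le hd0 ψ (hμOf p hp).2.2 hlow hδ] with n h1 h2
    have h3 := (abs_sub_le_iff.mp h1).2
    exact EReal.coe_le_coe_iff.mpr (by linarith)
  · refine le_of_forall_gt_imp_ge_of_dense fun b hb => ?_
    obtain ⟨c, hc, hcb⟩ := EReal.lt_iff_exists_real_btwn.mp hb
    refine le_trans ?_ hcb.le
    refine le_of_forall_gt_imp_ge_of_dense fun b' hb' => ?_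
    obtain ⟨y, hcy, hyb⟩ := EReal.lt_iff_exists_real_btwn.mp hb'
    have hδ : 0 < (y - c) / 2 := half_pos (sub_pos.mpr (EReal.coe_lt_coe_iff.mp hcy))
    refine le_trans (limsup_le_of_le (by isBoundedDefault) ?_) hyb.le
    have hneg : ∀ w ∈ IdrVec d r M, c ≤ ∑ x, w x * ψ (iotaSr d r x) →
        hbarR d (μOf (vecMeas w)) r < 0 := by
      intro w hw hcw
      by_contra! hh
      refine absurd hc (not_lt.mpr (le_trans ?_
        (le_sSup ⟨vecMeas w, vecMeas_mem_IdrMeas hw, hh, rfl⟩)))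
      rw [pairing, integral_vecMeas hw.1]
      exact EReal.coe_le_coe_iff.mpr hcw
    filter_upwards [hκ.abs_ExG_LG_sub_le hd0 hψ' hδ,
      hκ.cfgMean_maxEmp_le hd0 hr _ c μOf
        (fun w hw => (hμOf _ (vecMeas_mem_IdrMeas hw)).2.2) hneg hδ] with n h1 h2
    have h3 := (abs_sub_le_iff.mp h1).1
    exact EReal.coe_le_coe_iff.mpr (by linarith)

end TreeEntropy
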